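/- Let Λ_Φ be a good sponge, i.e. a self-affine sponge for which every probability measure on E is good. Then HD(Λ_Φ) = sup_{r∈R} δ(r) and DynD(Φ) = sup_{p∈P} δ(p). -/

import Mathlib

open MeasureTheory Filter Set Metric
open scoped Classical Topology ENNReal NNReal

namespace SelfAffineSponge

/-- A diagonal IFS on `[0,1]^d`: for each coordinate `i ∈ D = Fin d` a finite alphabet
`A i` indexing affine maps `x ↦ slope i a * x + off i a` of `[0,1]`, together with a
set `E ⊆ ∏ i, A i` of allowed tuples of symbols. -/
structure DiagIFS (d : ℕ) (A : Fin d → Type) [∀ i, Fintype (A i)] where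
  slope : ∀ i : Fin d, A i → ℝ
  off : ∀ i : Fin d, A i → ℝ
  E : Finset (∀ i, A i)

variable {d : ℕ} {A : Fin d → Type} [∀ i, Fintype (A i)]

namespace DiagIFS

/-- the base similarity `φ_{i,a}` in coordinate `i` -/
def base (Φ : DiagIFS d A) (i : Fin d) (a : A i) (x : ℝ) : ℝ :=
  Φ.slope i a * x + Φ.off i a

/-- the data defines an honest diagonal IFS: `E` is nonempty and each base map is a
contracting similarity of `[0,1]` -/
def Valid (Φ : DiagIFS d A) : Prop :=
  Φ.E.Nonempty ∧ (∀ i a, Φ.slope i a ≠ 0) ∧ (∀ i a, |Φ.slope i a| < 1) ∧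
    ∀ i a, ∀ x ∈ Set.Icc (0:ℝ) 1, Φ.base i a x ∈ Set.Icc (0:ℝ) 1

/-- the alphabet `E` of the IFS, as a type -/
abbrev Symb (Φ : DiagIFS d A) : Type _ := {a : ∀ i, A i // a ∈ Φ.E}

instance (Φ : DiagIFS d A) : MeasurableSpace Φ.Symb := ⊤
instance (Φ : DiagIFS d A) : TopologicalSpace Φ.Symb := ⊥

/-- the affine contraction `φ_a` of `[0,1]^d` associated to a tuple of symbols -/
def affMap (Φ : DiagIFS d A) (a : ∀ i, A i) (x : Fin d → ℝ) : Fin d → ℝ :=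
  fun i => Φ.base i (a i) (x i)

/-- the coding map `π(ω) = lim_n φ_{ω_0}∘⋯∘φ_{ω_{n-1}}(0)`, written in closed form -/
noncomputable def coding (Φ : DiagIFS d A) (ω : ℕ → Φ.Symb) : Fin d → ℝ :=
  fun i => ∑' n : ℕ, (∏ k ∈ Finset.range n, Φ.slope i ((ω k).1 i)) * Φ.off i ((ω n).1 i)

/-- the limit set `Λ_Φ = π(E^ℕ)` (the self-affine sponge) -/
def limitSet (Φ : DiagIFS d A) : Set (Fin d → ℝ) :=
  Set.range Φ.coding

theorem coding_mem (Φ : DiagIFS d A) (ω : ℕ → Φ.Symb) : Φ.coding ω ∈ Φ.limitSet :=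
  ⟨ω, rfl⟩

/-- the `i`-th Lyapunov exponent `χ_i(p) = -∫ log|φ'_{a,i}| dp(a)` of a finite measure
`p` on `E` (given by its density) -/
noncomputable def chi (Φ : DiagIFS d A) (i : Fin d) (p : Φ.Symb → ℝ) : ℝ :=
  -∑ a : Φ.Symb, p a * Real.log |Φ.slope i (a.1 i)|

/-- the mass `p([a]_I)` of the cylinder `[a]_I = {b ∈ E : b_i = a_i ∀ i ∈ I}` -/
noncomputable def cylMass (Φ : DiagIFS d A) (I : Finset (Fin d)) (p : Φ.Symb → ℝ)
    (a : Φ.Symb) : ℝ :=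
  ∑ b : Φ.Symb, if ∀ i ∈ I, b.1 i = a.1 i then p b else 0

/-- the entropy `h(I; p) = -∫ log p([a]_I) dp(a)` -/
noncomputable def entropy (Φ : DiagIFS d A) (I : Finset (Fin d)) (p : Φ.Symb → ℝ) : ℝ :=
  -∑ a : Φ.Symb, p a * Real.log (Φ.cylMass I p a)

/-- the conditional entropy `h(I' | I; p) = h(I';p) - h(I;p)` -/
noncomputable def condEntropy (Φ : DiagIFS d A) (I I' : Finset (Fin d))
    (p : Φ.Symb → ℝ) : ℝ :=
  Φ.entropy I' p - Φ.entropy I p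

/-- a coordinate set `I ⊆ D` is good if the projected IFS `Φ_I` satisfies the open set
condition: the boxes `φ_{I,a}((0,1)^I)`, indexed by distinct projections of elements of
`E`, are pairwise disjoint (equivalently, some coordinate has disjoint intervals). -/
def GoodIdx (Φ : DiagIFS d A) (I : Finset (Fin d)) : Prop :=
  ∀ a ∈ Φ.E, ∀ b ∈ Φ.E, (∃ i ∈ I, a i ≠ b i) →
    ∃ i ∈ I, Disjoint (Φ.base i (a i) '' Set.Ioo (0:ℝ) 1)
      (Φ.base i (b i) '' Set.Ioo (0:ℝ) 1)

/-- Barański condition: each base IFS satisfies the open set condition w.r.t. `(0,1)` -/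
def Baranski (Φ : DiagIFS d A) : Prop :=
  ∀ i : Fin d, ∀ a b : A i, a ≠ b →
    Disjoint (Φ.base i a '' Set.Ioo (0:ℝ) 1) (Φ.base i b '' Set.Ioo (0:ℝ) 1)

/-- strong Barański condition: each base IFS satisfies the strong separation condition
w.r.t. `[0,1]` -/
def StronglyBaranski (Φ : DiagIFS d A) : Prop :=
  ∀ i : Fin d, ∀ a b : A i, a ≠ b →
    Disjoint (Φ.base i a '' Set.Icc (0:ℝ) 1) (Φ.base i b '' Set.Icc (0:ℝ) 1)

/-- coordinate ordering condition: some permutation `σ` of the coordinates has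
`|φ'_{a,σ(1)}| > ⋯ > |φ'_{a,σ(d)}|` for all `a ∈ E` -/
def CoordOrdering (Φ : DiagIFS d A) : Prop :=
  ∃ σ : Equiv.Perm (Fin d), ∀ a ∈ Φ.E, ∀ i j : Fin d, i < j →
    |Φ.slope (σ j) (a (σ j))| < |Φ.slope (σ i) (a (σ i))|

end DiagIFS

/-- a probability vector (probability measure on a finite set, via its density) -/
def IsProbVec {α : Type*} [Fintype α] (p : α → ℝ) : Prop :=
  (∀ a, 0 ≤ p a) ∧ ∑ a, p a = 1

/-- a measure `p` on `E` is good if `I(p,x) = {i : χ_i(p) ≤ x}` is good for all `x > 0` -/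
def DiagIFS.GoodVec (Φ : DiagIFS d A) (p : Φ.Symb → ℝ) : Prop :=
  ∀ x > 0, Φ.GoodIdx (Finset.univ.filter fun i => Φ.chi i p ≤ x)

/-- a cycle on `E`: a continuous exponentially `λ`-periodic map `(0,∞) → P`,
where `λ = 1` means constant -/
structure Cycle (Φ : DiagIFS d A) where
  lam : ℝ
  one_le_lam : 1 ≤ lam
  r : ℝ → Φ.Symb → ℝ
  prob : ∀ b > 0, IsProbVec (r b)
  cont : ContinuousOn r (Set.Ioi 0)
  periodic : ∀ b > 0, r (lam * b) = r b
  const_of_lam_eq_one : lam = 1 → ∀ b > 0, ∀ b' > 0, r b = r b'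

/-- the number `B_i`, determined by `B = ∫_0^{B_i} χ_i(r_b) db` (written via `sInf`;
for a cycle the function `x ↦ ∫_0^x χ_i(r_b) db` is continuous and strictly
increasing, so the infimum is the unique solution) -/
noncomputable def Bcoord (Φ : DiagIFS d A) (r : ℝ → Φ.Symb → ℝ) (B : ℝ) (i : Fin d) : ℝ :=
  sInf {x : ℝ | 0 ≤ x ∧ B ≤ ∫ b in Set.Ioc (0:ℝ) x, Φ.chi i (r b)}

/-- `δ(r, B) = B⁻¹ ∫_0^∞ h({i : b ≤ B_i}; r_b) db` -/
noncomputable def deltaRB (Φ : DiagIFS d A) (r : ℝ → Φ.Symb → ℝ) (B : ℝ) : ℝ :=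
  B⁻¹ * ∫ b in Set.Ioi (0:ℝ),
    Φ.entropy (Finset.univ.filter fun i => b ≤ Bcoord Φ r B i) (r b)

/-- `δ(r) = inf_{B ∈ [1,λ]} δ(r,B)` -/
noncomputable def Cycle.delta {Φ : DiagIFS d A} (c : Cycle Φ) : ℝ :=
  sInf (deltaRB Φ c.r '' Set.Icc 1 c.lam)

/-- `δ(p) = ∫_0^∞ h({i : b ≤ 1/χ_i(p)}; p) db` -/
noncomputable def deltaP (Φ : DiagIFS d A) (p : Φ.Symb → ℝ) : ℝ :=
  ∫ b in Set.Ioi (0:ℝ),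
    Φ.entropy (Finset.univ.filter fun i => b ≤ (Φ.chi i p)⁻¹) p

/-- the normalized average `R̂_B = B⁻¹ ∫_0^B r_b db` of a cycle -/
noncomputable def cycleAvg {Φ : DiagIFS d A} (c : Cycle Φ) (B : ℝ) : Φ.Symb → ℝ :=
  fun a => B⁻¹ * ∫ b in Set.Ioc (0:ℝ) B, c.r b a

/-- a cycle is good if all its normalized averages `R̂_B` are good -/
def Cycle.Good {Φ : DiagIFS d A} (c : Cycle Φ) : Prop :=
  ∀ B > 0, Φ.GoodVec (cycleAvg c B)

/-- a cycle is nondegenerate if `{b > 0 : r_b(a) > 0 ∀ a ∈ E_r}` is dense in `(0,∞)` -/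
def Cycle.Nondeg {Φ : DiagIFS d A} (c : Cycle Φ) : Prop :=
  Set.Ioi (0:ℝ) ⊆
    closure {b : ℝ | 0 < b ∧ ∀ a : Φ.Symb, (∃ b' > 0, 0 < c.r b' a) → 0 < c.r b a}

/-- the lower pointwise dimension `d̲(x,μ) = liminf_{ρ→0} log μ(B(x,ρ))/log ρ` -/
noncomputable def lowerPtDim {X : Type*} [PseudoMetricSpace X] [MeasurableSpace X]
    (μ : Measure X) (x : X) : ℝ≥0∞ :=
  Filter.liminf
    (fun ρ : ℝ => ENNReal.ofReal (Real.log (μ (Metric.ball x ρ)).toReal / Real.log ρ))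
    (𝓝[>] (0:ℝ))

/-- the Hausdorff dimension of a measure: the essential supremum of its lower
pointwise dimension -/
noncomputable def measDim {X : Type*} [PseudoMetricSpace X] [MeasurableSpace X]
    (μ : Measure X) : ℝ≥0∞ :=
  essSup (lowerPtDim μ) μ

/-- the shift map on `E^ℕ` -/
def shift {α : Type*} (ω : ℕ → α) : ℕ → α := fun n => ω (n + 1)

/-- the dynamical dimension: the supremum of `HD(π_*μ)` over shift-invariant
probability measures `μ` on `E^ℕ` -/
noncomputable def DiagIFS.dynDim (Φ : DiagIFS d A) : ℝ≥0∞ :=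
  sSup {x : ℝ≥0∞ | ∃ μ : Measure (ℕ → Φ.Symb), IsProbabilityMeasure μ ∧
    Measure.map shift μ = μ ∧ x = measDim (Measure.map Φ.coding μ)}

/-- `μ` is the product measure on `E^ℕ` whose `k`-th factor has density `p k`
(this property characterizes `μ` uniquely) -/
def IsProductMeasure (Φ : DiagIFS d A) (p : ℕ → Φ.Symb → ℝ)
    (μ : Measure (ℕ → Φ.Symb)) : Prop :=
  IsProbabilityMeasure μ ∧
    ∀ (n : ℕ) (w : ℕ → Φ.Symb),
      (μ {ω | ∀ k < n, ω k = w k}).toReal = ∏ k ∈ Finset.range n, p k (w k)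

/-- the set of Hausdorff dimensions of Bernoulli measures `ν_p = π_*[p^ℕ]` -/
noncomputable def bernoulliDims (Φ : DiagIFS d A) : Set ℝ≥0∞ :=
  {x | ∃ p : Φ.Symb → ℝ, IsProbVec p ∧ ∃ μ : Measure (ℕ → Φ.Symb),
    IsProductMeasure Φ (fun _ => p) μ ∧ x = measDim (Measure.map Φ.coding μ)}

/-- the set of Hausdorff dimensions of pseudo-Bernoulli measures
`ν_r = π_*[∏_n r_n]` -/
noncomputable def pseudoBernoulliDims (Φ : DiagIFS d A) : Set ℝ≥0∞ :=
  {x | ∃ c : Cycle Φ, ∃ μ : Measure (ℕ → Φ.Symb),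
    IsProductMeasure Φ (fun n => c.r ((n : ℝ) + 1)) μ ∧
      x = measDim (Measure.map Φ.coding μ)}

namespace DiagIFS

/-- the local Lyapunov exponent `-log |φ'_{a,i}|` -/
noncomputable def lyap (Φ : DiagIFS d A) (i : Fin d) (a : Φ.Symb) : ℝ :=
  -Real.log |Φ.slope i (a.1 i)|

theorem chi_eq_sum (Φ : DiagIFS d A) (i : Fin d) (p : Φ.Symb → ℝ) :
    Φ.chi i p = ∑ a, p a * Φ.lyap i a := by
  simp [chi, lyap, Finset.sum_neg_distrib]

theorem continuous_chi (Φ : DiagIFS d A) (i : Fin d) : Continuous (Φ.chi i) := by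
  simp only [funext (Φ.chi_eq_sum i)]
  fun_prop

/-- two-sided bounds for the local Lyapunov exponents of `Φ` -/
structure LyapBounds (Φ : DiagIFS d A) (lo hi : ℝ) : Prop where
  lo_pos : 0 < lo
  lo_le_hi : lo ≤ hi
  lo_le : ∀ i a, lo ≤ Φ.lyap i a
  le_hi : ∀ i a, Φ.lyap i a ≤ hi

theorem Valid.lyap_pos {Φ : DiagIFS d A} (hV : Φ.Valid) (i : Fin d) (a : Φ.Symb) :
    0 < Φ.lyap i a := by
  have h0 := abs_pos.2 (hV.2.1 i (a.1 i))
  have h1 := hV.2.2.1 i (a.1 i)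
  have := Real.log_neg h0 h1
  simp only [lyap]; linarith

theorem Valid.exists_lyapBounds {Φ : DiagIFS d A} (hV : Φ.Valid) :
    ∃ lo hi, Φ.LyapBounds lo hi := by
  obtain ⟨lo, hlo, hlo'⟩ : ∃ lo : ℝ, 0 < lo ∧ ∀ x : Fin d × Φ.Symb, lo ≤ Φ.lyap x.1 x.2 := by
    obtain hE | hE := isEmpty_or_nonempty (Fin d × Φ.Symb)
    · exact ⟨1, one_pos, fun x => (hE.false x).elim⟩
    · obtain ⟨x, hx⟩ := Finite.exists_min (fun x : Fin d × Φ.Symb => Φ.lyap x.1 x.2)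
      exact ⟨_, hV.lyap_pos x.1 x.2, hx⟩
  obtain ⟨hi, hhi⟩ : ∃ hi : ℝ, ∀ x : Fin d × Φ.Symb, Φ.lyap x.1 x.2 ≤ hi := by
    obtain hE | hE := isEmpty_or_nonempty (Fin d × Φ.Symb)
    · exact ⟨1, fun x => (hE.false x).elim⟩
    · obtain ⟨x, hx⟩ := Finite.exists_max (fun x : Fin d × Φ.Symb => Φ.lyap x.1 x.2)
      exact ⟨_, hx⟩
  exact ⟨lo, max lo hi, hlo, le_max_left _ _, fun i a => hlo' (i, a),
    fun i a => (hhi (i, a)).trans (le_max_right _ _)⟩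

theorem LyapBounds.hi_pos {Φ : DiagIFS d A} {lo hi : ℝ} (hb : Φ.LyapBounds lo hi) : 0 < hi :=
  hb.lo_pos.trans_le hb.lo_le_hi

theorem LyapBounds.lo_le_chi {Φ : DiagIFS d A} {lo hi : ℝ} (hb : Φ.LyapBounds lo hi)
    (i : Fin d) {p : Φ.Symb → ℝ} (hp : IsProbVec p) : lo ≤ Φ.chi i p := by
  rw [chi_eq_sum]
  calc lo = ∑ a, p a * lo := by rw [← Finset.sum_mul, hp.2, one_mul]
    _ ≤ _ := Finset.sum_le_sum fun a _ => mul_le_mul_of_nonneg_left (hb.lo_le i a) (hp.1 a)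

theorem LyapBounds.chi_le_hi {Φ : DiagIFS d A} {lo hi : ℝ} (hb : Φ.LyapBounds lo hi)
    (i : Fin d) {p : Φ.Symb → ℝ} (hp : IsProbVec p) : Φ.chi i p ≤ hi := by
  rw [chi_eq_sum]
  calc _ ≤ ∑ a, p a * hi :=
        Finset.sum_le_sum fun a _ => mul_le_mul_of_nonneg_left (hb.le_hi i a) (hp.1 a)
    _ = hi := by rw [← Finset.sum_mul, hp.2, one_mul]

/-- the projection of a symbol to the coordinates in `I` -/
def proj (Φ : DiagIFS d A) (I : Finset (Fin d)) (a : Φ.Symb) : ∀ i, Option (A i) :=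
  fun i => if i ∈ I then some (a.1 i) else none

theorem proj_eq_iff (Φ : DiagIFS d A) (I : Finset (Fin d)) (a b : Φ.Symb) :
    Φ.proj I a = Φ.proj I b ↔ ∀ i ∈ I, a.1 i = b.1 i := by
  constructor
  · intro h i hi
    have := congrFun h i
    simpa [proj, hi] using this
  · intro h
    funext i
    by_cases hi : i ∈ I
    · simp [proj, hi, h i hi]
    · simp [proj, hi]

/-- the push-forward of the density `p` under the projection to the coordinates in `I` -/
noncomputable def projMass (Φ : DiagIFS d A) (I : Finset (Fin d)) (p : Φ.Symb → ℝ)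
    (c : ∀ i, Option (A i)) : ℝ :=
  ∑ a : Φ.Symb, if Φ.proj I a = c then p a else 0

theorem cylMass_eq (Φ : DiagIFS d A) (I : Finset (Fin d)) (p : Φ.Symb → ℝ) (a : Φ.Symb) :
    Φ.cylMass I p a = Φ.projMass I p (Φ.proj I a) := by
  simp only [cylMass, projMass, proj_eq_iff]

theorem projMass_nonneg (Φ : DiagIFS d A) (I : Finset (Fin d)) {p : Φ.Symb → ℝ}
    (hp : IsProbVec p) (c : ∀ i, Option (A i)) : 0 ≤ Φ.projMass I p c :=
  Finset.sum_nonneg fun a _ => by split_ifs <;> simp [hp.1 a]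

theorem sum_projMass (Φ : DiagIFS d A) (I : Finset (Fin d)) {p : Φ.Symb → ℝ}
    (hp : IsProbVec p) : ∑ c, Φ.projMass I p c = 1 := by
  simp only [projMass]
  rw [Finset.sum_comm]
  simpa [-Finset.univ_eq_attach] using hp.2

theorem entropy_eq_sum_negMulLog (Φ : DiagIFS d A) (I : Finset (Fin d)) (p : Φ.Symb → ℝ) :
    Φ.entropy I p = ∑ c, Real.negMulLog (Φ.projMass I p c) := by
  have h : ∀ c, Real.negMulLog (Φ.projMass I p c) =
      -∑ a, (if Φ.proj I a = c then p a * Real.log (Φ.projMass I p c) else 0) := by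
    intro c
    rw [Real.negMulLog, neg_mul]
    conv_lhs => rw [projMass, Finset.sum_mul]
    simp only [ite_mul, zero_mul]
    rfl
  simp only [h, Finset.sum_neg_distrib, entropy, cylMass_eq]
  rw [Finset.sum_comm]
  simp

theorem continuous_entropy (Φ : DiagIFS d A) (I : Finset (Fin d)) :
    Continuous (Φ.entropy I) := by
  simp only [funext (Φ.entropy_eq_sum_negMulLog I), projMass]
  refine continuous_finsetSum _ fun c _ => Real.continuous_negMulLog.comp ?_
  refine continuous_finsetSum _ fun a _ => ?_
  split_ifs
  · exact continuous_apply a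
  · exact continuous_const

theorem le_cylMass (Φ : DiagIFS d A) (I : Finset (Fin d)) {p : Φ.Symb → ℝ}
    (hp : IsProbVec p) (a : Φ.Symb) : p a ≤ Φ.cylMass I p a := by
  have := Finset.single_le_sum (s := Finset.univ)
    (f := fun b : Φ.Symb => if ∀ i ∈ I, b.1 i = a.1 i then p b else 0)
    (fun b _ => by split_ifs <;> simp [hp.1 b]) (Finset.mem_univ a)
  simpa [cylMass] using this

theorem cylMass_nonneg (Φ : DiagIFS d A) (I : Finset (Fin d)) {p : Φ.Symb → ℝ}
    (hp : IsProbVec p) (a : Φ.Symb) : 0 ≤ Φ.cylMass I p a :=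
  (hp.1 a).trans (Φ.le_cylMass I hp a)

theorem cylMass_anti (Φ : DiagIFS d A) {I J : Finset (Fin d)} (hIJ : I ⊆ J) {p : Φ.Symb → ℝ}
    (hp : IsProbVec p) (a : Φ.Symb) : Φ.cylMass J p a ≤ Φ.cylMass I p a := by
  refine Finset.sum_le_sum fun b _ => ?_
  by_cases hJ : ∀ i ∈ J, b.1 i = a.1 i
  · rw [if_pos hJ, if_pos fun i hi => hJ i (hIJ hi)]
  · rw [if_neg hJ]
    split_ifs <;> simp [hp.1 b]

theorem cylMass_le_one (Φ : DiagIFS d A) (I : Finset (Fin d)) {p : Φ.Symb → ℝ}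
    (hp : IsProbVec p) (a : Φ.Symb) : Φ.cylMass I p a ≤ 1 := by
  rw [← hp.2]
  refine Finset.sum_le_sum fun b _ => ?_
  split_ifs <;> simp [hp.1 b]

theorem entropy_mono (Φ : DiagIFS d A) {I J : Finset (Fin d)} (hIJ : I ⊆ J) {p : Φ.Symb → ℝ}
    (hp : IsProbVec p) : Φ.entropy I p ≤ Φ.entropy J p := by
  refine neg_le_neg (Finset.sum_le_sum fun a _ => ?_)
  rcases (hp.1 a).eq_or_lt with h | h
  · simp [← h]
  · exact mul_le_mul_of_nonneg_left (Real.log_le_log (h.trans_le (Φ.le_cylMass J hp a))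
      (Φ.cylMass_anti hIJ hp a)) h.le

theorem entropy_empty (Φ : DiagIFS d A) {p : Φ.Symb → ℝ} (hp : IsProbVec p) :
    Φ.entropy ∅ p = 0 := by
  have h : ∀ a, Φ.cylMass ∅ p a = 1 := fun a => by simpa [cylMass, -Finset.univ_eq_attach] using hp.2
  simp [entropy, h]

theorem entropy_nonneg (Φ : DiagIFS d A) (I : Finset (Fin d)) {p : Φ.Symb → ℝ}
    (hp : IsProbVec p) : 0 ≤ Φ.entropy I p := by
  rw [← Φ.entropy_empty hp]
  exact Φ.entropy_mono (Finset.empty_subset I) hp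

theorem isCompact_probVec (α : Type*) [Fintype α] : IsCompact {p : α → ℝ | IsProbVec p} :=
  isCompact_stdSimplex ℝ α

/-- a uniform upper bound for all entropies -/
theorem exists_entropy_bound (Φ : DiagIFS d A) :
    ∃ H : ℝ, 0 < H ∧ ∀ I (p : Φ.Symb → ℝ), IsProbVec p → Φ.entropy I p ≤ H := by
  obtain ⟨C, hC⟩ := (isCompact_probVec Φ.Symb).exists_bound_of_continuousOn
    (f := Φ.entropy Finset.univ) (Φ.continuous_entropy _).continuousOn
  refine ⟨max C 1, by positivity, fun I p hp => ?_⟩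
  exact (Φ.entropy_mono (Finset.subset_univ I) hp).trans
    ((le_abs_self _).trans ((hC p hp).trans (le_max_left _ _)))

theorem exists_entropy_modulus (Φ : DiagIFS d A) {ε : ℝ} (hε : 0 < ε) :
    ∃ κ > 0, ∀ I (p q : Φ.Symb → ℝ), IsProbVec p → IsProbVec q →
      (∀ a, |p a - q a| ≤ κ) → |Φ.entropy I p - Φ.entropy I q| ≤ ε := by
  have key : ∀ I : Finset (Fin d), ∃ κ > 0, ∀ (p q : Φ.Symb → ℝ), IsProbVec p → IsProbVec q →
      (∀ a, |p a - q a| ≤ κ) → |Φ.entropy I p - Φ.entropy I q| ≤ ε := by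
    intro I
    have hu := (isCompact_probVec Φ.Symb).uniformContinuousOn_of_continuous
      (f := Φ.entropy I) (Φ.continuous_entropy I).continuousOn
    rw [Metric.uniformContinuousOn_iff] at hu
    obtain ⟨κ, hκ, h⟩ := hu ε hε
    refine ⟨κ / 2, by positivity, fun p q hp hq hpq => ?_⟩
    have : dist p q ≤ κ / 2 := (dist_pi_le_iff (by positivity)).2 fun a => hpq a
    exact (h p hp q hq (by linarith)).le
  choose κ hκ h using key
  obtain ⟨I₀, hI₀⟩ := Finite.exists_min κ
  exact ⟨κ I₀, hκ I₀, fun I p q hp hq hpq => h I p q hp hq fun a => (hpq a).trans (hI₀ I)⟩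

theorem abs_chi_sub_le (Φ : DiagIFS d A) {lo hi : ℝ} (hb : Φ.LyapBounds lo hi) (i : Fin d)
    {p q : Φ.Symb → ℝ} {κ : ℝ} (h : ∀ a, |p a - q a| ≤ κ) :
    |Φ.chi i p - Φ.chi i q| ≤ Fintype.card Φ.Symb * hi * κ := by
  rw [chi_eq_sum, chi_eq_sum, ← Finset.sum_sub_distrib]
  refine (Finset.abs_sum_le_sum_abs _ _).trans ?_
  have : ∀ a ∈ Finset.univ, |p a * Φ.lyap i a - q a * Φ.lyap i a| ≤ hi * κ := by
    intro a _
    rw [← sub_mul, abs_mul, mul_comm]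
    have h0 : 0 ≤ Φ.lyap i a := hb.lo_pos.le.trans (hb.lo_le i a)
    rw [abs_of_nonneg h0]
    exact mul_le_mul (hb.le_hi i a) (h a) (abs_nonneg _) hb.hi_pos.le
  refine (Finset.sum_le_sum this).trans ?_
  simp [mul_assoc]

end DiagIFS

/-- a measurable family of probability vectors indexed by `(0,∞)` -/
structure IsProfile (Φ : DiagIFS d A) (r : ℝ → Φ.Symb → ℝ) : Prop where
  prob : ∀ b > 0, IsProbVec (r b)
  meas : Measurable ((Ioi (0 : ℝ)).indicator r)

/-- the integrated Lyapunov exponent `∫_0^x χ_i(r_b) db` -/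
noncomputable def chiInt (Φ : DiagIFS d A) (r : ℝ → Φ.Symb → ℝ) (i : Fin d) (x : ℝ) : ℝ :=
  ∫ b in Ioc (0 : ℝ) x, Φ.chi i (r b)

/-- the entropy at time `b` when coordinate `i` is switched off after time `D i` -/
noncomputable def thrFun (Φ : DiagIFS d A) (r : ℝ → Φ.Symb → ℝ) (D : Fin d → ℝ) (b : ℝ) : ℝ :=
  Φ.entropy (Finset.univ.filter fun i => b ≤ D i) (r b)

theorem deltaRB_eq (Φ : DiagIFS d A) (r : ℝ → Φ.Symb → ℝ) (B : ℝ) :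
    deltaRB Φ r B = B⁻¹ * ∫ b in Ioi (0 : ℝ), thrFun Φ r (Bcoord Φ r B) b := rfl

section Profile

variable {Φ : DiagIFS d A} {lo hi : ℝ} {r : ℝ → Φ.Symb → ℝ}

theorem IsProfile.aestronglyMeasurable (hr : IsProfile Φ r) {f : (Φ.Symb → ℝ) → ℝ}
    (hf : Continuous f) :
    AEStronglyMeasurable (fun b => f (r b)) (volume.restrict (Ioi (0 : ℝ))) := by
  have h1 : Measurable fun b => f ((Ioi (0 : ℝ)).indicator r b) := hf.measurable.comp hr.meas
  refine h1.aestronglyMeasurable.congr ?_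
  filter_upwards [ae_restrict_mem measurableSet_Ioi] with b hb
  simp only [Set.indicator_of_mem hb]

theorem IsProfile.integrableOn_chi (hr : IsProfile Φ r) (hb : Φ.LyapBounds lo hi) (i : Fin d)
    (x : ℝ) : IntegrableOn (fun b => Φ.chi i (r b)) (Ioc (0 : ℝ) x) := by
  refine Integrable.of_bound ((hr.aestronglyMeasurable (Φ.continuous_chi i)).mono_measure
    (Measure.restrict_mono Ioc_subset_Ioi_self le_rfl)) hi ?_
  filter_upwards [ae_restrict_mem measurableSet_Ioc] with b hbm
  have hp := hr.prob b hbm.1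
  rw [Real.norm_eq_abs, abs_of_nonneg (hb.lo_pos.le.trans (hb.lo_le_chi i hp))]
  exact hb.chi_le_hi i hp

theorem IsProfile.chiInt_sub (hr : IsProfile Φ r) (hb : Φ.LyapBounds lo hi) (i : Fin d)
    {x y : ℝ} (hx : 0 ≤ x) (hxy : x ≤ y) :
    lo * (y - x) ≤ chiInt Φ r i y - chiInt Φ r i x ∧
      chiInt Φ r i y - chiInt Φ r i x ≤ hi * (y - x) := by
  have hsplit : chiInt Φ r i y = chiInt Φ r i x + ∫ b in Ioc x y, Φ.chi i (r b) := by
    simp only [chiInt]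
    rw [← Ioc_union_Ioc_eq_Ioc hx hxy, setIntegral_union (Ioc_disjoint_Ioc_of_le le_rfl)
      measurableSet_Ioc (hr.integrableOn_chi hb i x)
      ((hr.integrableOn_chi hb i y).mono_set (Ioc_subset_Ioc_left hx))]
  have hii : IntegrableOn (fun b => Φ.chi i (r b)) (Ioc x y) :=
    (hr.integrableOn_chi hb i y).mono_set (Ioc_subset_Ioc_left hx)
  have hvol : volume.real (Ioc x y) = y - x := by simp [hxy]
  constructor
  · have := setIntegral_mono_on (integrableOn_const (C := lo) (by simp)) hii measurableSet_Ioc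
      (fun b hbm => hb.lo_le_chi i (hr.prob b (hx.trans_lt hbm.1)))
    rw [setIntegral_const, hvol, smul_eq_mul] at this
    linarith
  · have := setIntegral_mono_on hii (integrableOn_const (C := hi) (by simp)) measurableSet_Ioc
      (fun b hbm => hb.chi_le_hi i (hr.prob b (hx.trans_lt hbm.1)))
    rw [setIntegral_const, hvol, smul_eq_mul] at this
    linarith

theorem chiInt_zero (Φ : DiagIFS d A) (r : ℝ → Φ.Symb → ℝ) (i : Fin d) : chiInt Φ r i 0 = 0 := by
  simp [chiInt]

theorem IsProfile.Bcoord_spec (hr : IsProfile Φ r) (hb : Φ.LyapBounds lo hi) (i : Fin d)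
    {B : ℝ} (hB : 0 ≤ B) :
    0 ≤ Bcoord Φ r B i ∧ chiInt Φ r i (Bcoord Φ r B i) = B := by
  have hlo := hb.lo_pos
  have hM : 0 ≤ B / lo := by positivity
  have hcont : ContinuousOn (chiInt Φ r i) (Icc 0 (B / lo)) := by
    refine (LipschitzOnWith.of_dist_le_mul (K := hi.toNNReal) fun x hx y hy => ?_).continuousOn
    rw [Real.coe_toNNReal _ hb.hi_pos.le]
    rcases le_total x y with h | h
    · have := hr.chiInt_sub hb i hx.1 h
      rw [dist_comm, Real.dist_eq, dist_comm, Real.dist_eq, abs_of_nonneg (sub_nonneg.2 h),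
        abs_of_nonneg (by nlinarith [this.1])]
      exact this.2
    · have := hr.chiInt_sub hb i hy.1 h
      rw [Real.dist_eq, Real.dist_eq, abs_of_nonneg (sub_nonneg.2 h),
        abs_of_nonneg (by nlinarith [this.1])]
      exact this.2
  have h1 := hr.chiInt_sub hb i le_rfl hM
  rw [chiInt_zero, sub_zero, sub_zero, mul_div_cancel₀ _ hlo.ne'] at h1
  obtain ⟨x, hx, hxB⟩ := intermediate_value_Icc hM hcont
    (show B ∈ Icc (chiInt Φ r i 0) (chiInt Φ r i (B / lo)) from
      ⟨by rw [chiInt_zero]; exact hB, h1.1⟩)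
  have hset : {x : ℝ | 0 ≤ x ∧ B ≤ ∫ b in Ioc (0 : ℝ) x, Φ.chi i (r b)} = Ici x := by
    ext y
    simp only [mem_ofPred_eq, mem_Ici]
    constructor
    · rintro ⟨hy, hBy⟩
      by_contra! hlt
      have := (hr.chiInt_sub hb i hy hlt.le).1
      have h2 : B ≤ chiInt Φ r i y := hBy
      nlinarith
    · intro hy
      refine ⟨hx.1.trans hy, ?_⟩
      have := (hr.chiInt_sub hb i hx.1 hy).1
      have h2 : B ≤ chiInt Φ r i y := by nlinarith
      exact h2
  have hBx : Bcoord Φ r B i = x := by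
    rw [Bcoord, hset, csInf_Ici]
  rw [hBx]
  exact ⟨hx.1, hxB⟩

theorem IsProfile.le_Bcoord_iff (hr : IsProfile Φ r) (hb : Φ.LyapBounds lo hi) (i : Fin d)
    {B : ℝ} (hB : 0 ≤ B) {b : ℝ} (hb0 : 0 ≤ b) :
    b ≤ Bcoord Φ r B i ↔ chiInt Φ r i b ≤ B := by
  obtain ⟨h0, h1⟩ := hr.Bcoord_spec hb i hB
  have hlo := hb.lo_pos
  constructor
  · intro h
    have := (hr.chiInt_sub hb i hb0 h).1
    nlinarith
  · intro h
    by_contra! hlt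
    have := (hr.chiInt_sub hb i h0 hlt.le).1
    nlinarith

theorem IsProfile.Bcoord_le (hr : IsProfile Φ r) (hb : Φ.LyapBounds lo hi) (i : Fin d)
    {B : ℝ} (hB : 0 ≤ B) : Bcoord Φ r B i ≤ B / lo := by
  obtain ⟨h0, h1⟩ := hr.Bcoord_spec hb i hB
  have := (hr.chiInt_sub hb i le_rfl h0).1
  rw [chiInt_zero, h1] at this
  rw [le_div_iff₀ hb.lo_pos]
  linarith

theorem IsProfile.Bcoord_mono (hr : IsProfile Φ r) (hb : Φ.LyapBounds lo hi) (i : Fin d)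
    {B B' : ℝ} (hB : 0 ≤ B) (hBB' : B ≤ B') : Bcoord Φ r B i ≤ Bcoord Φ r B' i := by
  obtain ⟨h0, h1⟩ := hr.Bcoord_spec hb i hB
  rw [hr.le_Bcoord_iff hb i (hB.trans hBB') h0, h1]
  exact hBB'

theorem IsProfile.aestronglyMeasurable_thrFun (hr : IsProfile Φ r) (D : Fin d → ℝ) :
    AEStronglyMeasurable (thrFun Φ r D) (volume.restrict (Ioi (0 : ℝ))) := by
  have h1 : thrFun Φ r D = ∑ I : Finset (Fin d),
      {b : ℝ | (Finset.univ.filter fun i => b ≤ D i) = I}.indicator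
        (fun b => Φ.entropy I (r b)) := by
    funext b
    rw [Finset.sum_apply, Finset.sum_eq_single (Finset.univ.filter fun i => b ≤ D i)]
    · rw [Set.indicator_of_mem (by rfl)]
      rfl
    · intro I _ hI
      exact Set.indicator_of_notMem (fun h => hI h.symm) _
    · simp
  rw [h1]
  refine Finset.aestronglyMeasurable_sum _ fun I _ => ?_
  refine (hr.aestronglyMeasurable (Φ.continuous_entropy I)).indicator ?_
  have : {b : ℝ | (Finset.univ.filter fun i => b ≤ D i) = I} =
      ⋂ i, {b : ℝ | b ≤ D i ↔ i ∈ I} := by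
    ext b
    simp [Finset.ext_iff]
  rw [this]
  refine MeasurableSet.iInter fun i => ?_
  by_cases hi : i ∈ I
  · have h2 : {b : ℝ | b ≤ D i ↔ i ∈ I} = Iic (D i) := by ext b; simp [hi]
    rw [h2]; exact measurableSet_Iic
  · have h2 : {b : ℝ | b ≤ D i ↔ i ∈ I} = Ioi (D i) := by ext b; simp [hi]
    rw [h2]; exact measurableSet_Ioi

theorem IsProfile.thrFun_eq_zero (hr : IsProfile Φ r) {D : Fin d → ℝ} {M b : ℝ}
    (hD : ∀ i, D i ≤ M) (hb0 : 0 < b) (hb : M < b) : thrFun Φ r D b = 0 := by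
  have : (Finset.univ.filter fun i => b ≤ D i) = ∅ := by
    ext i
    simpa using (hD i).trans_lt hb
  rw [thrFun, this, Φ.entropy_empty (hr.prob b hb0)]

theorem IsProfile.setIntegral_thrFun (hr : IsProfile Φ r) {D : Fin d → ℝ} {M : ℝ}
    (hD : ∀ i, D i ≤ M) :
    ∫ b in Ioi (0 : ℝ), thrFun Φ r D b = ∫ b in Ioc (0 : ℝ) M, thrFun Φ r D b := by
  refine (setIntegral_eq_of_subset_of_forall_sdiff_eq_zero measurableSet_Ioi
    Ioc_subset_Ioi_self fun b hb => ?_)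
  have hb0 : 0 < b := hb.1
  refine hr.thrFun_eq_zero hD hb0 ?_
  by_contra! h
  exact hb.2 ⟨hb0, h⟩

theorem IsProfile.integrableOn_thrFun (hr : IsProfile Φ r) (D : Fin d → ℝ) (M : ℝ) :
    IntegrableOn (thrFun Φ r D) (Ioc (0 : ℝ) M) := by
  obtain ⟨H, -, hH⟩ := Φ.exists_entropy_bound
  refine Integrable.of_bound ((hr.aestronglyMeasurable_thrFun D).mono_measure
    (Measure.restrict_mono Ioc_subset_Ioi_self le_rfl)) H ?_
  filter_upwards [ae_restrict_mem measurableSet_Ioc] with b hbm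
  have hp := hr.prob b hbm.1
  rw [Real.norm_eq_abs, thrFun, abs_of_nonneg (Φ.entropy_nonneg _ hp)]
  exact hH _ _ hp

theorem IsProfile.thrInt_le {R : ℝ → Φ.Symb → ℝ} {D D' : Fin d → ℝ} {M ε H : ℝ} {S : Set ℝ}
    (hr : IsProfile Φ r) (hR : IsProfile Φ R)
    (hH : ∀ I (p : Φ.Symb → ℝ), IsProbVec p → Φ.entropy I p ≤ H) (hH0 : 0 ≤ H)
    (hD : ∀ i, D i ≤ M) (hD' : ∀ i, D' i ≤ M) (hM : 0 ≤ M) (hε : 0 ≤ ε) (hS : MeasurableSet S)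
    (hclose : ∀ b, 0 < b → b ≤ M → b ∉ S → ∀ I, |Φ.entropy I (r b) - Φ.entropy I (R b)| ≤ ε) :
    ∫ b in Ioi (0 : ℝ), thrFun Φ r D b ≤ (∫ b in Ioi (0 : ℝ), thrFun Φ R D' b) + ε * M +
      H * volume.real (S ∩ Ioc 0 M) + H * ∑ i, |D i - D' i| := by
  rw [hr.setIntegral_thrFun hD, hR.setIntegral_thrFun hD']
  set g : ℝ → ℝ := fun b => thrFun Φ R D' b + ε + S.indicator (fun _ => H) b +
    ∑ i, (Ioc (D' i) (D i)).indicator (fun _ => H) b with hg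
  have hpt : ∀ b ∈ Ioc (0 : ℝ) M, thrFun Φ r D b ≤ g b := by
    intro b hb
    have hp := hr.prob b hb.1
    have hP := hR.prob b hb.1
    have hSn : 0 ≤ S.indicator (fun _ => H) b := Set.indicator_nonneg (fun _ _ => hH0) b
    have hsn : 0 ≤ ∑ i, (Ioc (D' i) (D i)).indicator (fun _ => H) b :=
      Finset.sum_nonneg fun i _ => Set.indicator_nonneg (fun _ _ => hH0) b
    have hRn : 0 ≤ thrFun Φ R D' b := Φ.entropy_nonneg _ hP
    have hrH : thrFun Φ r D b ≤ H := hH _ _ hp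
    by_cases h1 : ∃ i, b ∈ Ioc (D' i) (D i)
    · obtain ⟨i, hi⟩ := h1
      have : H ≤ ∑ i, (Ioc (D' i) (D i)).indicator (fun _ => H) b := by
        have := Finset.single_le_sum (f := fun i => (Ioc (D' i) (D i)).indicator (fun _ => H) b)
          (fun i _ => Set.indicator_nonneg (fun _ _ => hH0) b) (Finset.mem_univ i)
        simpa [Set.indicator_of_mem hi] using this
      simp only [hg]; linarith
    · by_cases h2 : b ∈ S
      · have : S.indicator (fun _ => H) b = H := Set.indicator_of_mem h2 _
        simp only [hg]; linarith
      · have hsub : (Finset.univ.filter fun i => b ≤ D i) ⊆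
            (Finset.univ.filter fun i => b ≤ D' i) := by
          intro i hi
          simp only [Finset.mem_filter, Finset.mem_univ, true_and] at hi ⊢
          by_contra! hlt
          exact h1 ⟨i, hlt, hi⟩
        have h3 := Φ.entropy_mono hsub hp
        have h4 := (abs_le.1 (hclose b hb.1 hb.2 h2
          (Finset.univ.filter fun i => b ≤ D' i))).2
        simp only [hg, thrFun] at *
        linarith
  have i1 := hR.integrableOn_thrFun D' M
  have i2 : IntegrableOn (fun _ : ℝ => ε) (Ioc (0 : ℝ) M) := integrableOn_const (by simp)
  have i3 : IntegrableOn (S.indicator fun _ : ℝ => H) (Ioc (0 : ℝ) M) :=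
    (integrableOn_const (by simp)).indicator hS
  have i4 : ∀ i, IntegrableOn ((Ioc (D' i) (D i)).indicator fun _ : ℝ => H) (Ioc (0 : ℝ) M) :=
    fun i => (integrableOn_const (by simp)).indicator measurableSet_Ioc
  have i5 : IntegrableOn (fun b => ∑ i, (Ioc (D' i) (D i)).indicator (fun _ : ℝ => H) b)
      (Ioc (0 : ℝ) M) := integrable_finsetSum _ fun i _ => i4 i
  refine (setIntegral_mono_on (hr.integrableOn_thrFun D M) (((i1.add i2).add i3).add i5)
    measurableSet_Ioc hpt).trans ?_
  have e1 : ∫ b in Ioc (0 : ℝ) M, g b = (∫ b in Ioc (0 : ℝ) M, thrFun Φ R D' b) +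
      (∫ b in Ioc (0 : ℝ) M, ε) + (∫ b in Ioc (0 : ℝ) M, S.indicator (fun _ => H) b) +
      ∑ i, ∫ b in Ioc (0 : ℝ) M, (Ioc (D' i) (D i)).indicator (fun _ => H) b := by
    have a1 := integral_add ((i1.add i2).add i3) i5
    have a2 := integral_add (i1.add i2) i3
    have a3 := integral_add i1 i2
    rw [← integral_finsetSum _ fun i _ => i4 i, ← a3]
    exact a1.trans (congrArg (· + _) a2)
  have e2 : ∫ b in Ioc (0 : ℝ) M, ε = ε * M := by
    rw [setIntegral_const]; simp [hM, mul_comm]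
  have e3 : ∫ b in Ioc (0 : ℝ) M, S.indicator (fun _ => H) b = H * volume.real (S ∩ Ioc 0 M) := by
    rw [integral_indicator hS, setIntegral_const, measureReal_restrict_apply hS, smul_eq_mul,
      mul_comm]
  have e4 : ∀ i, ∫ b in Ioc (0 : ℝ) M, (Ioc (D' i) (D i)).indicator (fun _ => H) b ≤
      H * |D i - D' i| := by
    intro i
    rw [integral_indicator measurableSet_Ioc, setIntegral_const, smul_eq_mul, mul_comm,
      measureReal_restrict_apply measurableSet_Ioc]
    refine mul_le_mul_of_nonneg_left ?_ hH0
    refine (measureReal_mono inter_subset_left (by simp)).trans ?_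
    rw [Real.volume_real_Ioc]
    exact max_le (le_abs_self _) (abs_nonneg _)
  have e5 : ∑ i, ∫ b in Ioc (0 : ℝ) M, (Ioc (D' i) (D i)).indicator (fun _ => H) b ≤
      H * ∑ i, |D i - D' i| := by
    rw [Finset.mul_sum]
    exact Finset.sum_le_sum fun i _ => e4 i
  change ∫ b in Ioc (0 : ℝ) M, g b ≤ _
  rw [e1, e2, e3]
  linarith

end Profile

section ProfileClose

variable {Φ : DiagIFS d A} {lo hi : ℝ} {r R : ℝ → Φ.Symb → ℝ}

theorem IsProfile.Bcoord_eq (hr : IsProfile Φ r) (hb : Φ.LyapBounds lo hi) {i : Fin d}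
    {B x : ℝ} (hx : 0 ≤ x) (h : chiInt Φ r i x = B) : Bcoord Φ r B i = x := by
  have hB : 0 ≤ B := by
    have := (hr.chiInt_sub hb i le_rfl hx).1
    rw [chiInt_zero] at this
    nlinarith [hb.lo_pos]
  obtain ⟨h0, h1⟩ := hr.Bcoord_spec hb i hB
  refine le_antisymm ?_ ((hr.le_Bcoord_iff hb i hB hx).2 h.le)
  by_contra! hlt
  have := (hr.chiInt_sub hb i hx hlt.le).1
  nlinarith [hb.lo_pos]

theorem IsProfile.abs_chiInt_sub_le (hr : IsProfile Φ r) (hR : IsProfile Φ R)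
    (hb : Φ.LyapBounds lo hi) {κ M : ℝ} {S : Set ℝ} (hS : MeasurableSet S) (hκ : 0 ≤ κ)
    (hclose : ∀ b, 0 < b → b ≤ M → b ∉ S → ∀ a, |r b a - R b a| ≤ κ) (i : Fin d) {x : ℝ}
    (hx0 : 0 ≤ x) (hx : x ≤ M) :
    |chiInt Φ r i x - chiInt Φ R i x| ≤
      Fintype.card Φ.Symb * hi * κ * M + hi * volume.real (S ∩ Ioc 0 M) := by
  have hhi := hb.hi_pos
  have i1 := hr.integrableOn_chi hb i x
  have i2 := hR.integrableOn_chi hb i x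
  have hc : 0 ≤ Fintype.card Φ.Symb * hi * κ := by positivity
  have i3 : IntegrableOn (fun _ : ℝ => Fintype.card Φ.Symb * hi * κ) (Ioc (0 : ℝ) x) :=
    integrableOn_const (by simp)
  have i4 : IntegrableOn (S.indicator fun _ : ℝ => hi) (Ioc (0 : ℝ) x) :=
    (integrableOn_const (by simp)).indicator hS
  rw [chiInt, chiInt, ← integral_sub i1 i2, ← Real.norm_eq_abs]
  refine (norm_integral_le_integral_norm _).trans ?_
  refine (setIntegral_mono_on (i1.sub i2).norm (i3.add i4) measurableSet_Ioc ?_).trans ?_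
  · intro b hbm
    rw [Pi.add_apply, Real.norm_eq_abs, Pi.sub_apply]
    have hp := hr.prob b hbm.1
    have hP := hR.prob b hbm.1
    by_cases h : b ∈ S
    · rw [Set.indicator_of_mem h, abs_le]
      constructor <;> linarith [hb.lo_le_chi i hp, hb.chi_le_hi i hp, hb.lo_le_chi i hP,
        hb.chi_le_hi i hP, hb.lo_pos]
    · rw [Set.indicator_of_notMem h, add_zero]
      exact Φ.abs_chi_sub_le hb i (hclose b hbm.1 (hbm.2.trans hx) h)
  · have a1 := integral_add i3 i4
    refine a1.le.trans (add_le_add ?_ ?_)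
    · rw [setIntegral_const, smul_eq_mul, mul_comm]
      refine mul_le_mul_of_nonneg_left ?_ hc
      simpa [hx0] using hx
    · rw [integral_indicator hS, setIntegral_const, measureReal_restrict_apply hS, smul_eq_mul,
        mul_comm]
      refine mul_le_mul_of_nonneg_left (measureReal_mono ?_ ?_) hhi.le
      · exact inter_subset_inter_right _ (Ioc_subset_Ioc_right hx)
      · exact ((measure_mono inter_subset_right).trans_lt (by simp)).ne

theorem IsProfile.abs_Bcoord_sub_le (hr : IsProfile Φ r) (hR : IsProfile Φ R)
    (hb : Φ.LyapBounds lo hi) {κ B : ℝ} (hB : 0 ≤ B) {S : Set ℝ} (hS : MeasurableSet S)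
    (hκ : 0 ≤ κ) (hclose : ∀ b, 0 < b → b ≤ B / lo → b ∉ S → ∀ a, |r b a - R b a| ≤ κ)
    (i : Fin d) :
    lo * |Bcoord Φ r B i - Bcoord Φ R B i| ≤
      Fintype.card Φ.Symb * hi * κ * (B / lo) + hi * volume.real (S ∩ Ioc 0 (B / lo)) := by
  have hlo := hb.lo_pos
  obtain ⟨h0, h1⟩ := hr.Bcoord_spec hb i hB
  obtain ⟨h0', h1'⟩ := hR.Bcoord_spec hb i hB
  rcases le_total (Bcoord Φ r B i) (Bcoord Φ R B i) with h | h
  · rw [abs_sub_comm, abs_of_nonneg (sub_nonneg.2 h)]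
    refine (hR.chiInt_sub hb i h0 h).1.trans ?_
    rw [h1']
    refine le_trans ?_ (hr.abs_chiInt_sub_le hR hb hS hκ hclose i h0 (hr.Bcoord_le hb i hB))
    rw [h1]
    exact le_abs_self _
  · rw [abs_of_nonneg (sub_nonneg.2 h)]
    refine (hr.chiInt_sub hb i h0' h).1.trans ?_
    rw [h1]
    refine le_trans ?_ (hr.abs_chiInt_sub_le hR hb hS hκ hclose i h0' (hR.Bcoord_le hb i hB))
    rw [h1', abs_sub_comm]
    exact le_abs_self _

theorem DiagIFS.LyapBounds.exists_deltaRB_close (hb : Φ.LyapBounds lo hi) {ε : ℝ} (hε : 0 < ε) :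
    ∃ κ > 0, ∀ r R : ℝ → Φ.Symb → ℝ, IsProfile Φ r → IsProfile Φ R → ∀ B > 0, ∀ S : Set ℝ,
      MeasurableSet S → volume.real (S ∩ Ioc 0 (B / lo)) ≤ κ * B →
      (∀ b, 0 < b → b ≤ B / lo → b ∉ S → ∀ a, |r b a - R b a| ≤ κ) →
      deltaRB Φ r B ≤ deltaRB Φ R B + ε := by
  obtain ⟨H, hH0, hH⟩ := Φ.exists_entropy_bound
  have hlo := hb.lo_pos
  have hhi := hb.hi_pos
  obtain ⟨κ₁, hκ₁, hmod⟩ := Φ.exists_entropy_modulus (show 0 < ε * lo / 2 by positivity)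
  set N : ℝ := (Fintype.card Φ.Symb : ℝ) with hN
  have hN0 : 0 ≤ N := by positivity
  set C : ℝ := H + H * (d * ((N * hi / lo + hi) / lo)) with hC
  have hC0 : 0 < C := by positivity
  refine ⟨min κ₁ (ε / (2 * C)), by positivity, ?_⟩
  set κ := min κ₁ (ε / (2 * C)) with hκdef
  have hκ : 0 < κ := by positivity
  have hκC : κ * C ≤ ε / 2 := by
    calc κ * C ≤ ε / (2 * C) * C := mul_le_mul_of_nonneg_right (min_le_right _ _) hC0.le
      _ = ε / 2 := by field_simp
  intro r R hr hR B hB S hS hvol hclose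
  have key := hr.thrInt_le hR (D := Bcoord Φ r B) (D' := Bcoord Φ R B) (M := B / lo)
    (ε := ε * lo / 2) (H := H) (S := S) hH hH0.le (fun i => hr.Bcoord_le hb i hB.le)
    (fun i => hR.Bcoord_le hb i hB.le) (by positivity) (by positivity) hS
    (fun b h1 h2 h3 I => hmod I _ _ (hr.prob b h1) (hR.prob b h1)
      fun a => (hclose b h1 h2 h3 a).trans (min_le_left _ _))
  have hsum : ∑ i, |Bcoord Φ r B i - Bcoord Φ R B i| ≤
      d * ((N * hi / lo + hi) / lo) * κ * B := by
    have : ∀ i ∈ Finset.univ, |Bcoord Φ r B i - Bcoord Φ R B i| ≤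
        (N * hi / lo + hi) / lo * κ * B := by
      intro i _
      have h1 := hr.abs_Bcoord_sub_le hR hb hB.le hS hκ.le hclose i
      rw [← hN] at h1
      have h2 : hi * volume.real (S ∩ Ioc 0 (B / lo)) ≤ hi * (κ * B) :=
        mul_le_mul_of_nonneg_left hvol hhi.le
      have h3 : lo * |Bcoord Φ r B i - Bcoord Φ R B i| ≤ lo * ((N * hi / lo + hi) / lo * κ * B) := by
        refine (h1.trans (add_le_add_right h2 _)).trans_eq ?_
        field_simp
      exact le_of_mul_le_mul_left h3 hlo
    refine (Finset.sum_le_sum this).trans_eq ?_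
    simp
    ring
  rw [deltaRB_eq, deltaRB_eq, inv_mul_eq_div, inv_mul_eq_div, div_add' _ _ _ hB.ne']
  refine div_le_div_of_nonneg_right ?_ hB.le
  have h4 : H * volume.real (S ∩ Ioc 0 (B / lo)) ≤ H * (κ * B) :=
    mul_le_mul_of_nonneg_left hvol hH0.le
  have h5 := mul_le_mul_of_nonneg_left hsum hH0.le
  have h6 : ε * lo / 2 * (B / lo) = ε / 2 * B := by field_simp
  have h7 : κ * C * B ≤ ε / 2 * B := mul_le_mul_of_nonneg_right hκC hB.le
  have h8 : H * (κ * B) + H * (d * ((N * hi / lo + hi) / lo) * κ * B) = κ * C * B := by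
    rw [hC]; ring
  linarith

theorem IsProfile.deltaRB_nonneg (hr : IsProfile Φ r) {B : ℝ} (hB : 0 ≤ B) :
    0 ≤ deltaRB Φ r B :=
  mul_nonneg (inv_nonneg.2 hB) (setIntegral_nonneg measurableSet_Ioi fun b hb =>
    Φ.entropy_nonneg _ (hr.prob b hb))

theorem IsProfile.thrInt_mono (hr : IsProfile Φ r) {D D' : Fin d → ℝ} (h : ∀ i, D i ≤ D' i) :
    ∫ b in Ioi (0 : ℝ), thrFun Φ r D b ≤ ∫ b in Ioi (0 : ℝ), thrFun Φ r D' b := by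
  obtain ⟨M, hM⟩ : ∃ M, ∀ i, D' i ≤ M :=
    ⟨∑ i, |D' i|, fun i => (le_abs_self _).trans
      (Finset.single_le_sum (f := fun i => |D' i|) (fun _ _ => abs_nonneg _) (Finset.mem_univ i))⟩
  rw [hr.setIntegral_thrFun hM, hr.setIntegral_thrFun fun i => (h i).trans (hM i)]
  refine setIntegral_mono_on (hr.integrableOn_thrFun _ _) (hr.integrableOn_thrFun _ _)
    measurableSet_Ioc fun b hb => Φ.entropy_mono ?_ (hr.prob b hb.1)
  exact Finset.monotone_filter_right _ fun i _ hi => hi.trans (h i)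

theorem IsProfile.mul_deltaRB_mono (hr : IsProfile Φ r) (hb : Φ.LyapBounds lo hi) {B B' : ℝ}
    (hB : 0 < B) (hBB' : B ≤ B') : B * deltaRB Φ r B ≤ B' * deltaRB Φ r B' := by
  rw [deltaRB_eq, deltaRB_eq, mul_inv_cancel_left₀ hB.ne',
    mul_inv_cancel_left₀ (hB.trans_le hBB').ne']
  exact hr.thrInt_mono fun i => hr.Bcoord_mono hb i hB.le hBB'

theorem chiInt_congr (h : ∀ b > 0, r b = R b) (i : Fin d) (x : ℝ) :
    chiInt Φ r i x = chiInt Φ R i x :=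
  setIntegral_congr_fun measurableSet_Ioc fun b hb => by simp only [h b hb.1]

theorem chiInt_comp_mul {l : ℝ} (hl : 0 < l) (h : ∀ b > 0, R b = r (l * b)) (i : Fin d)
    {x : ℝ} (hx : 0 ≤ x) : chiInt Φ R i x = l⁻¹ * chiInt Φ r i (l * x) := by
  rw [chiInt_congr (R := fun b => r (l * b)) h, chiInt, chiInt,
    ← intervalIntegral.integral_of_le hx, ← intervalIntegral.integral_of_le (by positivity)]
  rw [intervalIntegral.integral_comp_mul_left (fun b => Φ.chi i (r b)) hl.ne']
  simp

theorem IsProfile.deltaRB_comp_mul (hr : IsProfile Φ r) (hR : IsProfile Φ R)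
    (hb : Φ.LyapBounds lo hi) {l : ℝ} (hl : 0 < l) (h : ∀ b > 0, R b = r (l * b)) {B : ℝ}
    (hB : 0 < B) : deltaRB Φ R B = deltaRB Φ r (l * B) := by
  have hBc : ∀ i, Bcoord Φ R B i = l⁻¹ * Bcoord Φ r (l * B) i := by
    intro i
    obtain ⟨h0, h1⟩ := hr.Bcoord_spec hb i (show 0 ≤ l * B by positivity)
    refine hR.Bcoord_eq hb (by positivity) ?_
    rw [chiInt_comp_mul hl h i (by positivity), mul_inv_cancel_left₀ hl.ne', h1,
      inv_mul_cancel_left₀ hl.ne']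
  have hii : ∫ b in Ioi (0 : ℝ), thrFun Φ R (Bcoord Φ R B) b =
      ∫ b in Ioi (0 : ℝ), thrFun Φ r (Bcoord Φ r (l * B)) (l * b) := by
    refine setIntegral_congr_fun measurableSet_Ioi fun b hb => ?_
    simp only [thrFun, hBc, h b hb]
    congr 1
    ext i
    simp [le_inv_mul_iff₀ hl]
  rw [deltaRB_eq, deltaRB_eq, hii, integral_comp_mul_left_Ioi _ _ hl]
  simp only [mul_zero, smul_eq_mul, mul_inv]
  ring

theorem isProfile_const {p : Φ.Symb → ℝ} (hp : IsProbVec p) : IsProfile Φ fun _ => p where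
  prob _ _ := hp
  meas := measurable_const.indicator measurableSet_Ioi

theorem deltaRB_const (hb : Φ.LyapBounds lo hi) {p : Φ.Symb → ℝ} (hp : IsProbVec p) {B : ℝ}
    (hB : 0 < B) : deltaRB Φ (fun _ => p) B = deltaP Φ p := by
  have h1 := (isProfile_const hp).deltaRB_comp_mul (isProfile_const hp) hb hB
    (fun _ _ => rfl) one_pos
  rw [mul_one] at h1
  rw [← h1, deltaRB_eq, deltaP, inv_one, one_mul]
  refine setIntegral_congr_fun measurableSet_Ioi fun b _ => ?_
  have : ∀ i, Bcoord Φ (fun _ => p) 1 i = (Φ.chi i p)⁻¹ := by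
    intro i
    have hpos := hb.lo_pos.trans_le (hb.lo_le_chi i hp)
    refine (isProfile_const hp).Bcoord_eq hb (by positivity) ?_
    rw [chiInt, setIntegral_const]
    simp [hpos.le, hpos.ne']
  simp only [thrFun, this]

theorem Cycle.isProfile (c : Cycle Φ) : IsProfile Φ c.r where
  prob := c.prob
  meas := by
    have := c.cont.measurable_piecewise (g := 0) continuousOn_const measurableSet_Ioi
    rwa [Set.piecewise_eq_indicator] at this

theorem Cycle.lam_pos (c : Cycle Φ) : 0 < c.lam :=
  one_pos.trans_le c.one_le_lam

theorem Cycle.deltaRB_lam_mul (c : Cycle Φ) (hb : Φ.LyapBounds lo hi)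
    {B : ℝ} (hB : 0 < B) : deltaRB Φ c.r (c.lam * B) = deltaRB Φ c.r B :=
  (c.isProfile.deltaRB_comp_mul c.isProfile hb c.lam_pos
    (fun b hb => (c.periodic b hb).symm) hB).symm

theorem Cycle.delta_le (c : Cycle Φ) (hb : Φ.LyapBounds lo hi)
    {B : ℝ} (hB : 0 < B) : c.delta ≤ deltaRB Φ c.r B := by
  have hbdd : BddBelow (deltaRB Φ c.r '' Icc 1 c.lam) := by
    refine ⟨0, ?_⟩
    rintro _ ⟨B, hB, rfl⟩
    exact c.isProfile.deltaRB_nonneg (zero_le_one.trans hB.1)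
  rcases c.one_le_lam.eq_or_lt with h | h
  · have h1 : ∀ b > 0, c.r b = c.r (B * b) := fun b hb =>
      c.const_of_lam_eq_one h.symm b hb _ (by positivity)
    have h2 := c.isProfile.deltaRB_comp_mul c.isProfile hb hB h1 one_pos
    rw [mul_one] at h2
    rw [← h2]
    exact csInf_le hbdd ⟨1, ⟨le_rfl, h.le⟩, rfl⟩
  · obtain ⟨n, hn⟩ := exists_mem_Ico_zpow hB h
    have hz : ∀ m : ℕ, ∀ B > 0, deltaRB Φ c.r (c.lam ^ m * B) = deltaRB Φ c.r B := by
      intro m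
      induction m with
      | zero => intro B _; simp
      | succ m ih =>
        intro B hB
        rw [pow_succ', mul_assoc, c.deltaRB_lam_mul hb (by have := c.lam_pos; positivity), ih B hB]
    have hlp := c.lam_pos
    have hlz : 0 < c.lam ^ n := zpow_pos hlp n
    have hmem : B / c.lam ^ n ∈ Icc 1 c.lam := by
      rw [zpow_add_one₀ hlp.ne'] at hn
      refine ⟨(one_le_div hlz).2 hn.1, ?_⟩
      rw [div_le_iff₀ hlz, mul_comm]
      exact hn.2.le
    have hval : deltaRB Φ c.r (B / c.lam ^ n) = deltaRB Φ c.r B := by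
      obtain ⟨m, rfl | rfl⟩ := n.eq_nat_or_neg
      · rw [zpow_natCast] at *
        rw [← hz m _ (by positivity), mul_div_cancel₀ _ hlz.ne']
      · rw [zpow_neg, zpow_natCast, div_inv_eq_mul, mul_comm, hz m _ hB]
    rw [← hval]
    exact csInf_le hbdd ⟨_, hmem, rfl⟩

theorem Cycle.le_delta (c : Cycle Φ) {t : ℝ}
    (h : ∀ B ∈ Icc 1 c.lam, t ≤ deltaRB Φ c.r B) : t ≤ c.delta := by
  refine le_csInf ⟨_, 1, ⟨le_rfl, c.one_le_lam⟩, rfl⟩ ?_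
  rintro _ ⟨B, hB, rfl⟩
  exact h B hB

/-- the piecewise constant profile equal to `p k` on `(k, k + 1]` -/
noncomputable def step (p : ℕ → Φ.Symb → ℝ) (b : ℝ) : Φ.Symb → ℝ := p (⌈b⌉₊ - 1)

theorem step_apply (p : ℕ → Φ.Symb → ℝ) {k : ℕ} {b : ℝ} (hb : b ∈ Ioc (k : ℝ) (k + 1)) :
    step p b = p k := by
  have : ⌈b⌉₊ = k + 1 := by
    rw [Nat.ceil_eq_iff (by simp)]
    simpa using hb
  rw [step, this, Nat.add_sub_cancel]

theorem isProfile_step {p : ℕ → Φ.Symb → ℝ} (hp : ∀ k, IsProbVec (p k)) :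
    IsProfile Φ (step p) where
  prob _ _ := hp _
  meas := by
    refine Measurable.indicator ?_ measurableSet_Ioi
    exact (measurable_from_top (f := fun n : ℕ => p (n - 1))).comp Nat.measurable_ceil

theorem integral_Ioc_nat {g : ℝ → ℝ} {f : ℕ → ℝ}
    (h : ∀ k : ℕ, ∀ b ∈ Ioc (k : ℝ) (k + 1), g b = f k) (n : ℕ) :
    IntegrableOn g (Ioc 0 n) ∧ ∫ b in Ioc (0 : ℝ) n, g b = ∑ k ∈ Finset.range n, f k := by
  induction n with
  | zero => simp
  | succ n ih =>
    have i1 : IntegrableOn g (Ioc (n : ℝ) (n + 1)) :=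
      (integrableOn_const (C := f n) (by simp)).congr_fun (fun b hb => (h n b hb).symm)
        measurableSet_Ioc
    have e1 : ∫ b in Ioc (n : ℝ) (n + 1), g b = f n := by
      rw [setIntegral_congr_fun measurableSet_Ioc (h n), setIntegral_const]
      simp
    have hu : Ioc (0 : ℝ) n ∪ Ioc (n : ℝ) (n + 1) = Ioc 0 ((n + 1 : ℕ) : ℝ) := by
      rw [Nat.cast_add_one]
      exact Ioc_union_Ioc_eq_Ioc (by positivity) (by linarith)
    rw [← hu]
    refine ⟨ih.1.union i1, ?_⟩
    rw [setIntegral_union (Ioc_disjoint_Ioc_of_le le_rfl) measurableSet_Ioc ih.1 i1, ih.2, e1,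
      Finset.sum_range_succ]

theorem chiInt_step (p : ℕ → Φ.Symb → ℝ) (i : Fin d) (n : ℕ) :
    chiInt Φ (step p) i n = ∑ k ∈ Finset.range n, Φ.chi i (p k) :=
  (integral_Ioc_nat (fun k b hb => by rw [step_apply p hb]) n).2

theorem thrInt_step {p : ℕ → Φ.Symb → ℝ} (hp : ∀ k, IsProbVec (p k)) {N : Fin d → ℕ} {L : ℕ}
    (hN : ∀ i, N i ≤ L) :
    ∫ b in Ioi (0 : ℝ), thrFun Φ (step p) (fun i => (N i : ℝ)) b =
      ∑ k ∈ Finset.range L, Φ.entropy (Finset.univ.filter fun i => k < N i) (p k) := by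
  rw [(isProfile_step hp).setIntegral_thrFun (M := L) fun i => by exact_mod_cast hN i]
  refine (integral_Ioc_nat (fun k b hb => ?_) L).2
  rw [thrFun, step_apply p hb]
  congr 1
  ext i
  simp only [Finset.mem_filter, Finset.mem_univ, true_and]
  constructor
  · intro h
    exact_mod_cast hb.1.trans_le h
  · intro h
    refine hb.2.trans ?_
    exact_mod_cast h

end ProfileClose

section PointwiseDimension

variable {X : Type*} [MetricSpace X] [MeasurableSpace X]

theorem eventually_measure_ball_le {ν : Measure X} [IsFiniteMeasure ν] {x : X} {t : ℝ≥0}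
    (h : (t : ℝ≥0∞) < lowerPtDim ν x) :
    ∀ᶠ ρ : ℝ in 𝓝[>] 0, ν (ball x ρ) ≤ ENNReal.ofReal ρ ^ (t : ℝ) := by
  have h1 := eventually_lt_of_lt_liminf h
  filter_upwards [h1, Ioo_mem_nhdsGT (zero_lt_one' ℝ)] with ρ hρ hρ1
  have hlog : Real.log ρ < 0 := Real.log_neg hρ1.1 hρ1.2
  rw [← ENNReal.ofReal_coe_nnreal, ENNReal.ofReal_lt_ofReal_iff'] at hρ
  have h2 := hρ.1
  rw [lt_div_iff_of_neg hlog] at h2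
  rcases (ENNReal.toReal_nonneg (a := ν (ball x ρ))).eq_or_lt with h0 | h0
  · have := (ENNReal.toReal_eq_zero_iff _).1 h0.symm
    rw [this.resolve_right (measure_ne_top _ _)]
    exact zero_le
  · rw [ENNReal.ofReal_rpow_of_pos hρ1.1, ENNReal.le_ofReal_iff_toReal_le (measure_ne_top _ _)
      (Real.rpow_nonneg hρ1.1.le _), ← Real.exp_log h0, Real.rpow_def_of_pos hρ1.1, mul_comm]
    exact Real.exp_le_exp.2 h2.le

theorem measure_le_ediam_rpow [BorelSpace X] {ν : Measure X} {Y : Set X} {t : ℝ≥0} {r : ℝ}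
    (h : ∀ x ∈ Y, ∀ ρ : ℝ, 0 < ρ → ρ < r → ν (ball x ρ) ≤ ENNReal.ofReal ρ ^ (t : ℝ)) {s : Set X}
    (hs : ediam s < ENNReal.ofReal r) : ν.restrict Y s ≤ ediam s ^ (t : ℝ) := by
  refine (measure_mono subset_closure).trans ?_
  rw [Measure.restrict_apply isClosed_closure.measurableSet]
  rcases (closure s ∩ Y).eq_empty_or_nonempty with h0 | ⟨x, hxs, hxY⟩
  · rw [h0, measure_empty]; exact zero_le
  have hd : ediam s ≠ ⊤ := (hs.trans ENNReal.ofReal_lt_top).ne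
  set δ := (ediam s).toReal with hδ
  have hδr : δ < r := by
    rwa [hδ, ← ENNReal.lt_ofReal_iff_toReal_lt hd]
  have hbound : ∀ᶠ ρ : ℝ in 𝓝[>] δ, ν (closure s ∩ Y) ≤ ENNReal.ofReal ρ ^ (t : ℝ) := by
    filter_upwards [Ioo_mem_nhdsGT hδr] with ρ hρ
    have hρ0 : 0 < ρ := ENNReal.toReal_nonneg.trans_lt hρ.1
    refine (measure_mono ?_).trans (h x hxY ρ hρ0 hρ.2)
    intro y hy
    rw [mem_ball, ← ENNReal.ofReal_lt_ofReal_iff hρ0, ← edist_dist]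
    refine (edist_le_ediam_of_mem hy.1 hxs).trans_lt ?_
    rw [ediam_closure, ← ENNReal.ofReal_toReal hd]
    exact (ENNReal.ofReal_lt_ofReal_iff hρ0).2 hρ.1
  have hlim : Tendsto (fun ρ : ℝ => ENNReal.ofReal ρ ^ (t : ℝ)) (𝓝[>] δ)
      (𝓝 (ENNReal.ofReal δ ^ (t : ℝ))) :=
    ((ENNReal.continuous_rpow_const.comp ENNReal.continuous_ofReal).tendsto δ).mono_left
      nhdsWithin_le_nhds
  have := ge_of_tendsto hlim hbound
  rwa [hδ, ENNReal.ofReal_toReal hd] at this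

/-- the mass distribution principle for lower pointwise dimensions -/
theorem le_dimH_of_lt_lowerPtDim [BorelSpace X] {ν : Measure X} [IsFiniteMeasure ν] {Y : Set X}
    (hY : ν Y ≠ 0) {t : ℝ≥0} (h : ∀ x ∈ Y, (t : ℝ≥0∞) < lowerPtDim ν x) :
    (t : ℝ≥0∞) ≤ dimH Y := by
  set Z : ℕ → Set X := fun n => {x ∈ Y | ∀ ρ : ℝ, 0 < ρ → ρ < 1 / ((n : ℝ) + 1) →
    ν (ball x ρ) ≤ ENNReal.ofReal ρ ^ (t : ℝ)} with hZ
  have hYZ : Y ⊆ ⋃ n, Z n := by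
    intro x hx
    obtain ⟨u, hu, hu'⟩ := mem_nhdsGT_iff_exists_Ioo_subset.1 (eventually_measure_ball_le (h x hx))
    obtain ⟨n, hn⟩ := exists_nat_one_div_lt (show (0 : ℝ) < u from hu)
    exact mem_iUnion.2 ⟨n, hx, fun ρ h0 h1 => hu' ⟨h0, h1.trans hn⟩⟩
  obtain ⟨n, hn⟩ : ∃ n, ν (Z n) ≠ 0 := by
    by_contra! h0
    exact hY (measure_mono_null hYZ (measure_iUnion_null h0))
  have hle : ν.restrict (Z n) ≤ μH[(t : ℝ)] := by
    refine Measure.le_hausdorffMeasure _ _ (ENNReal.ofReal (1 / ((n : ℝ) + 1) / 2))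
      (ENNReal.ofReal_pos.2 (by positivity)) fun s hs =>
        measure_le_ediam_rpow (fun x hx => hx.2) (lt_of_le_of_lt hs ?_)
    rw [ENNReal.ofReal_lt_ofReal_iff (by positivity)]
    exact half_lt_self (by positivity)
  have hne : μH[(t : ℝ)] (Z n) ≠ 0 := by
    intro h0
    have := le_antisymm ((hle (Z n)).trans h0.le) (zero_le)
    rw [Measure.restrict_apply_self] at this
    exact hn this
  exact (le_dimH_of_hausdorffMeasure_ne_zero hne).trans (dimH_mono fun x hx => hx.1)

theorem ofReal_div_le_lowerPtDim {ν : Measure X} [IsFiniteMeasure ν] {x : X} {c α β : ℝ}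
    (hc : 0 < c) (hα : 0 < α) (hpos : ∀ ρ > 0, ν (ball x ρ) ≠ 0)
    (h : ∀ᶠ n : ℕ in atTop, ν (ball x (c * Real.exp (-(n * α)))) ≤
      ENNReal.ofReal (Real.exp (-(n * β)))) :
    ENNReal.ofReal (β / α) ≤ lowerPtDim ν x := by
  rcases le_or_gt β 0 with hβ | hβ
  · rw [ENNReal.ofReal_of_nonpos (div_nonpos_of_nonpos_of_nonneg hβ hα.le)]
    exact zero_le
  have hlog : Tendsto (fun ρ : ℝ => -Real.log ρ) (𝓝[>] 0) atTop :=
    tendsto_neg_atBot_atTop.comp Real.tendsto_log_nhdsGT_zero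
  have hlim : Tendsto (fun ρ : ℝ => ((Real.log c / -Real.log ρ + 1) / α - 1 / -Real.log ρ) * β)
      (𝓝[>] 0) (𝓝 (((0 + 1) / α - 0) * β)) :=
    ((((hlog.const_div_atTop _).add_const 1).div_const α).sub (hlog.const_div_atTop _)).mul_const β
  have hlim' := (ENNReal.continuous_ofReal.tendsto _).comp hlim
  have he : ((0 + 1) / α - 0) * β = β / α := by ring
  rw [he] at hlim'
  rw [← hlim'.liminf_eq]
  refine liminf_le_liminf ?_
  obtain ⟨n₀, hn₀⟩ := eventually_atTop.1 h
  have hlarge : ∀ᶠ ρ : ℝ in 𝓝[>] 0, (n₀ + 1 : ℝ) * α ≤ Real.log c + -Real.log ρ :=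
    (tendsto_const_nhds.add_atTop hlog).eventually_ge_atTop _
  filter_upwards [hlarge, Ioo_mem_nhdsGT (zero_lt_one' ℝ)] with ρ hρ hρ1
  simp only [Function.comp_apply]
  refine ENNReal.ofReal_le_ofReal ?_
  have hL : 0 < -Real.log ρ := neg_pos.2 (Real.log_neg hρ1.1 hρ1.2)
  set L := -Real.log ρ with hLdef
  set n := ⌊(Real.log c + L) / α⌋₊ with hn
  have hq : (n₀ + 1 : ℝ) ≤ (Real.log c + L) / α := (le_div_iff₀ hα).2 hρ
  have hn0 : n₀ ≤ n := Nat.le_floor (by linarith)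
  have hnle : (n : ℝ) ≤ (Real.log c + L) / α := Nat.floor_le (le_trans (by positivity) hq)
  have hnlt : (Real.log c + L) / α < n + 1 := Nat.lt_floor_add_one _
  have hρc : ρ ≤ c * Real.exp (-(n * α)) := by
    rw [← Real.log_le_log_iff hρ1.1 (by positivity), Real.log_mul hc.ne' (Real.exp_pos _).ne',
      Real.log_exp]
    rw [le_div_iff₀ hα] at hnle
    linarith
  have hm := (measure_mono (ball_subset_ball hρc)).trans (hn₀ n hn0)
  have hmpos : 0 < (ν (ball x ρ)).toReal :=
    ENNReal.toReal_pos (hpos ρ hρ1.1) (measure_ne_top _ _)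
  have hlogm : Real.log (ν (ball x ρ)).toReal ≤ -(n * β) := by
    rw [Real.log_le_iff_le_exp hmpos]
    exact ENNReal.toReal_le_of_le_ofReal (Real.exp_pos _).le hm
  have e1 : Real.log (ν (ball x ρ)).toReal / Real.log ρ =
      -Real.log (ν (ball x ρ)).toReal / L := by
    rw [hLdef, neg_div_neg_eq]
  rw [e1, le_div_iff₀ hL]
  have e2 : ((Real.log c / L + 1) / α - 1 / L) * β * L = ((Real.log c + L) / α - 1) * β := by
    field_simp
  rw [e2]
  have : ((Real.log c + L) / α - 1) * β ≤ n * β := mul_le_mul_of_nonneg_right (by linarith) hβ.le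
  linarith

end PointwiseDimension

section ProductMeasure

instance (Φ : DiagIFS d A) : DiscreteMeasurableSpace Φ.Symb := ⟨fun _ => trivial⟩

instance (Φ : DiagIFS d A) : DiscreteTopology Φ.Symb := ⟨rfl⟩

instance (Φ : DiagIFS d A) : BorelSpace Φ.Symb := ⟨by rw [borel_eq_top_of_discrete]; rfl⟩

variable {Φ : DiagIFS d A}

/-- the measure on the alphabet with density `p` -/
noncomputable def vecMeasure (p : Φ.Symb → ℝ) : Measure Φ.Symb :=
  ∑ a, ENNReal.ofReal (p a) • Measure.dirac a

theorem vecMeasure_apply {p : Φ.Symb → ℝ} (hp : IsProbVec p) (t : Set Φ.Symb) :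
    vecMeasure p t = ENNReal.ofReal (∑ a, if a ∈ t then p a else 0) := by
  rw [vecMeasure, Measure.finsetSum_apply, ENNReal.ofReal_sum_of_nonneg
    fun a _ => by split_ifs <;> simp [hp.1 a]]
  refine Finset.sum_congr rfl fun a _ => ?_
  by_cases h : a ∈ t <;> simp [h]

theorem isProbabilityMeasure_vecMeasure {p : Φ.Symb → ℝ} (hp : IsProbVec p) :
    IsProbabilityMeasure (vecMeasure p) :=
  ⟨by
    rw [vecMeasure_apply hp]
    simp only [mem_univ, if_true]
    rw [hp.2, ENNReal.ofReal_one]⟩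

theorem vecMeasure_singleton {p : Φ.Symb → ℝ} (hp : IsProbVec p) (a : Φ.Symb) :
    vecMeasure p {a} = ENNReal.ofReal (p a) := by
  rw [vecMeasure_apply hp]
  simp [-Finset.univ_eq_attach]

theorem vecMeasure_cylinder {p : Φ.Symb → ℝ} (hp : IsProbVec p) (I : Finset (Fin d))
    (a : Φ.Symb) :
    vecMeasure p {b | ∀ i ∈ I, b.1 i = a.1 i} = ENNReal.ofReal (Φ.cylMass I p a) := by
  rw [vecMeasure_apply hp, DiagIFS.cylMass]
  congr 1
  refine Finset.sum_congr rfl fun b _ => ?_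
  simp only [mem_ofPred_eq]
  congr

theorem integral_vecMeasure {p : Φ.Symb → ℝ} (hp : IsProbVec p) (f : Φ.Symb → ℝ) :
    ∫ a, f a ∂vecMeasure p = ∑ a, p a * f a := by
  rw [vecMeasure, integral_finsetSum_measure fun a _ => ?_]
  · refine Finset.sum_congr rfl fun a _ => ?_
    rw [integral_smul_measure, integral_dirac, ENNReal.toReal_ofReal (hp.1 a), smul_eq_mul]
  · exact (integrable_dirac (by simp)).smul_measure ENNReal.ofReal_ne_top

/-- the product measure on `E^ℕ` whose `k`-th factor has density `p k` -/
noncomputable def prodMeasure (p : ℕ → Φ.Symb → ℝ) (hp : ∀ k, IsProbVec (p k)) :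
    Measure (ℕ → Φ.Symb) :=
  haveI := fun k => isProbabilityMeasure_vecMeasure (hp k)
  Measure.infinitePi fun k => vecMeasure (p k)

variable {p : ℕ → Φ.Symb → ℝ} (hp : ∀ k, IsProbVec (p k))

instance : IsProbabilityMeasure (prodMeasure p hp) := by
  have := fun k => isProbabilityMeasure_vecMeasure (hp k)
  unfold prodMeasure
  infer_instance

theorem prodMeasure_pi (s : Finset ℕ) (t : ℕ → Set Φ.Symb) :
    prodMeasure p hp {ω | ∀ k ∈ s, ω k ∈ t k} = ∏ k ∈ s, vecMeasure (p k) (t k) := by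
  have := fun k => isProbabilityMeasure_vecMeasure (hp k)
  exact Measure.infinitePi_pi (fun k => vecMeasure (p k)) fun _ _ => MeasurableSet.of_discrete

theorem integral_prodMeasure_eval (k : ℕ) (f : Φ.Symb → ℝ) :
    ∫ ω, f (ω k) ∂prodMeasure p hp = ∑ a, p k a * f a := by
  have := fun k => isProbabilityMeasure_vecMeasure (hp k)
  rw [← integral_vecMeasure (hp k)]
  have h := measurePreserving_eval_infinitePi (fun k => vecMeasure (p k)) k
  rw [← h.map_eq, integral_map (measurable_pi_apply k).aemeasurable
    (measurable_of_countable f).aestronglyMeasurable]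
  rfl

theorem iIndepFun_prodMeasure (f : ℕ → Φ.Symb → ℝ) :
    ProbabilityTheory.iIndepFun (fun k ω => f k (ω k)) (prodMeasure p hp) := by
  have := fun k => isProbabilityMeasure_vecMeasure (hp k)
  exact ProbabilityTheory.iIndepFun_infinitePi fun k => measurable_of_countable (f k)

theorem prodMeasure_sum_ge_le {f : ℕ → Φ.Symb → ℝ} {K : ℝ} (hK : 0 < K)
    (hf : ∀ k a, f k a ∈ Icc 0 K) (n : ℕ) {ε : ℝ} (hε : 0 ≤ ε) :
    prodMeasure p hp {ω | ε * n ≤ ∑ k ∈ Finset.range n, (f k (ω k) - ∑ a, p k a * f k a)} ≤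
      ENNReal.ofReal (Real.exp (-(2 * ε ^ 2 / K ^ 2) * n)) := by
  have hind : ProbabilityTheory.iIndepFun
      (fun k (ω : ℕ → Φ.Symb) => f k (ω k) - ∑ a, p k a * f k a) (prodMeasure p hp) :=
    iIndepFun_prodMeasure hp fun k a => f k a - ∑ a, p k a * f k a
  have hsub : ∀ k < n, ProbabilityTheory.HasSubgaussianMGF
      (fun ω : ℕ → Φ.Symb => f k (ω k) - ∑ a, p k a * f k a) ((‖K - 0‖₊ / 2) ^ 2)
      (prodMeasure p hp) := by
    intro k _
    have := ProbabilityTheory.hasSubgaussianMGF_of_mem_Icc (μ := prodMeasure p hp)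
      (X := fun ω : ℕ → Φ.Symb => f k (ω k)) (a := 0) (b := K)
      ((measurable_of_countable (f k)).comp (measurable_pi_apply k)).aemeasurable
      (ae_of_all _ fun ω => hf k (ω k))
    rwa [integral_prodMeasure_eval hp k] at this
  have h := ProbabilityTheory.HasSubgaussianMGF.measure_sum_range_ge_le_of_iIndepFun hind hsub
    (ε := ε * n) (by positivity)
  rw [← ofReal_measureReal]
  refine ENNReal.ofReal_le_ofReal (h.trans (Real.exp_le_exp.2 (le_of_eq ?_)))
  rcases n.eq_zero_or_pos with rfl | hn
  · simp
  · have : (0 : ℝ) < n := by exact_mod_cast hn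
    simp only [sub_zero, NNReal.coe_pow, NNReal.coe_div, coe_nnnorm, Real.norm_eq_abs,
      abs_of_pos hK, NNReal.coe_ofNat]
    field_simp

theorem ae_eventually_notMem_of_exp {Ω : Type*} [MeasurableSpace Ω] {μ : Measure Ω}
    {s : ℕ → Set Ω} {C c : ℝ} (hc : 0 < c)
    (h : ∀ n : ℕ, μ (s n) ≤ ENNReal.ofReal (C * Real.exp (-c * n))) :
    ∀ᵐ ω ∂μ, ∀ᶠ n in atTop, ω ∉ s n := by
  refine ae_eventually_notMem (ne_top_of_le_ne_top ?_ (ENNReal.tsum_le_tsum h))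
  have hs : Summable fun n : ℕ => C * Real.exp (-c * n) := by
    refine Summable.mul_left _ ?_
    have := Real.summable_exp_nat_mul_iff.2 (neg_lt_zero.2 hc)
    simpa [mul_comm] using this
  exact hs.tsum_ofReal_ne_top

theorem ae_eventually_sum_lt {f : ℕ → ℕ → Φ.Symb → ℝ} {K c : ℝ} (hK : 0 < K) (hc : 0 < c)
    (hf : ∀ n k a, f n k a ∈ Icc 0 K) {L : ℕ → ℕ} (hL : ∀ n, c * n ≤ L n) {ε : ℝ} (hε : 0 < ε) :
    ∀ᵐ ω ∂prodMeasure p hp, ∀ᶠ n in atTop, ∑ k ∈ Finset.range (L n), f n k (ω k) <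
      (∑ k ∈ Finset.range (L n), ∑ a, p k a * f n k a) + ε * L n := by
  have h := ae_eventually_notMem_of_exp (μ := prodMeasure p hp) (C := 1)
    (c := 2 * ε ^ 2 / K ^ 2 * c) (s := fun n => {ω | ε * L n ≤ ∑ k ∈ Finset.range (L n),
      (f n k (ω k) - ∑ a, p k a * f n k a)}) (by positivity) fun n => by
    refine (prodMeasure_sum_ge_le hp hK (hf n) (L n) hε.le).trans ?_
    rw [one_mul]
    refine ENNReal.ofReal_le_ofReal (Real.exp_le_exp.2 ?_)
    have := mul_le_mul_of_nonneg_left (hL n) (show 0 ≤ 2 * ε ^ 2 / K ^ 2 by positivity)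
    linarith
  filter_upwards [h] with ω hω
  filter_upwards [hω] with n hn
  simp only [not_le, Finset.sum_sub_distrib] at hn
  linarith

theorem ae_eventually_lt_sum {f : ℕ → ℕ → Φ.Symb → ℝ} {K c : ℝ} (hK : 0 < K) (hc : 0 < c)
    (hf : ∀ n k a, f n k a ∈ Icc 0 K) {L : ℕ → ℕ} (hL : ∀ n, c * n ≤ L n) {ε : ℝ} (hε : 0 < ε) :
    ∀ᵐ ω ∂prodMeasure p hp, ∀ᶠ n in atTop,
      (∑ k ∈ Finset.range (L n), ∑ a, p k a * f n k a) - ε * L n <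
        ∑ k ∈ Finset.range (L n), f n k (ω k) := by
  have h := ae_eventually_sum_lt hp (f := fun n k a => K - f n k a) hK hc
    (fun n k a => ⟨sub_nonneg.2 (hf n k a).2, sub_le_self _ (hf n k a).1⟩) hL hε
  have hmean : ∀ n k, ∑ a, p k a * (K - f n k a) = K - ∑ a, p k a * f n k a := by
    intro n k
    simp only [mul_sub, Finset.sum_sub_distrib]
    rw [← Finset.sum_mul, (hp k).2, one_mul]
  filter_upwards [h] with ω hω
  filter_upwards [hω] with n hn
  simp only [hmean, Finset.sum_sub_distrib] at hn
  linarith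

end ProductMeasure

section Coding

variable {Φ : DiagIFS d A} {lo hi : ℝ}

theorem abs_slope_eq (hV : Φ.Valid) (i : Fin d) (a : Φ.Symb) :
    |Φ.slope i (a.1 i)| = Real.exp (-Φ.lyap i a) := by
  rw [DiagIFS.lyap, neg_neg, Real.exp_log (abs_pos.2 (hV.2.1 i _))]

theorem abs_prod_slope (hV : Φ.Valid) (i : Fin d) (ω : ℕ → Φ.Symb) (n : ℕ) :
    |∏ k ∈ Finset.range n, Φ.slope i ((ω k).1 i)| =
      Real.exp (-∑ k ∈ Finset.range n, Φ.lyap i (ω k)) := by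
  rw [Finset.abs_prod, ← Finset.sum_neg_distrib, Real.exp_sum]
  exact Finset.prod_congr rfl fun k _ => abs_slope_eq hV i _

theorem off_mem (hV : Φ.Valid) (i : Fin d) (a : A i) : Φ.off i a ∈ Icc (0 : ℝ) 1 := by
  have := hV.2.2.2 i a 0 (by simp)
  simpa [DiagIFS.base] using this

theorem abs_coding_term_le (hV : Φ.Valid) (hb : Φ.LyapBounds lo hi) (i : Fin d)
    (ω : ℕ → Φ.Symb) (n : ℕ) :
    |(∏ k ∈ Finset.range n, Φ.slope i ((ω k).1 i)) * Φ.off i ((ω n).1 i)| ≤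
      Real.exp (-lo) ^ n := by
  have ho := off_mem hV i ((ω n).1 i)
  rw [abs_mul, abs_prod_slope hV, abs_of_nonneg ho.1, ← Real.exp_nat_mul]
  refine (mul_le_of_le_one_right (Real.exp_pos _).le ho.2).trans (Real.exp_le_exp.2 ?_)
  have : ∑ k ∈ Finset.range n, lo ≤ ∑ k ∈ Finset.range n, Φ.lyap i (ω k) :=
    Finset.sum_le_sum fun k _ => hb.lo_le i _
  simp only [Finset.sum_const, Finset.card_range, nsmul_eq_mul] at this
  linarith

theorem summable_exp_neg_lo (hb : Φ.LyapBounds lo hi) :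
    Summable fun n : ℕ => Real.exp (-lo) ^ n :=
  summable_geometric_of_lt_one (Real.exp_pos _).le (Real.exp_lt_one_iff.2 (neg_lt_zero.2 hb.lo_pos))

theorem summable_coding (hV : Φ.Valid) (i : Fin d) (ω : ℕ → Φ.Symb) :
    Summable fun n => (∏ k ∈ Finset.range n, Φ.slope i ((ω k).1 i)) * Φ.off i ((ω n).1 i) := by
  obtain ⟨lo, hi, hb⟩ := hV.exists_lyapBounds
  exact Summable.of_norm_bounded (summable_exp_neg_lo hb) fun n => abs_coding_term_le hV hb i ω n

theorem continuous_coding (hV : Φ.Valid) : Continuous Φ.coding := by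
  obtain ⟨lo, hi, hb⟩ := hV.exists_lyapBounds
  refine continuous_pi fun i => ?_
  refine continuous_tsum (fun n => ?_) (summable_exp_neg_lo hb)
    fun n ω => abs_coding_term_le hV hb i ω n
  refine (continuous_finsetProd _ fun k _ => ?_).mul ?_
  · exact (continuous_of_discreteTopology (f := fun a : Φ.Symb => Φ.slope i (a.1 i))).comp
      (continuous_apply k)
  · exact (continuous_of_discreteTopology (f := fun a : Φ.Symb => Φ.off i (a.1 i))).comp
      (continuous_apply n)

theorem measurable_coding (hV : Φ.Valid) : Measurable Φ.coding :=
  (continuous_coding hV).measurable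

theorem coding_eq_base (hV : Φ.Valid) (i : Fin d) (ω : ℕ → Φ.Symb) :
    Φ.coding ω i = Φ.base i ((ω 0).1 i) (Φ.coding (shift ω) i) := by
  simp only [DiagIFS.coding, DiagIFS.base]
  rw [(summable_coding hV i ω).tsum_eq_zero_add, ← tsum_mul_left, add_comm]
  simp only [Finset.range_zero, Finset.prod_empty, one_mul]
  congr 1
  refine tsum_congr fun n => ?_
  rw [Finset.prod_range_succ']
  simp only [shift]
  ring

theorem partial_coding_mem (hV : Φ.Valid) (i : Fin d) (N : ℕ) : ∀ ω : ℕ → Φ.Symb,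
    ∑ n ∈ Finset.range N, (∏ k ∈ Finset.range n, Φ.slope i ((ω k).1 i)) * Φ.off i ((ω n).1 i) ∈
      Icc (0 : ℝ) 1 := by
  induction N with
  | zero => simp
  | succ N ih =>
    intro ω
    have := hV.2.2.2 i ((ω 0).1 i) _ (ih (shift ω))
    rw [Finset.sum_range_succ']
    convert this using 1
    simp only [DiagIFS.base, Finset.mul_sum]
    simp only [Finset.range_zero, Finset.prod_empty, one_mul]
    congr 1
    refine Finset.sum_congr rfl fun n _ => ?_
    rw [Finset.prod_range_succ']
    simp only [shift]
    ring

theorem coding_mem_Icc (hV : Φ.Valid) (i : Fin d) (ω : ℕ → Φ.Symb) :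
    Φ.coding ω i ∈ Icc (0 : ℝ) 1 :=
  isClosed_Icc.mem_of_tendsto (summable_coding hV i ω).hasSum.tendsto_sum_nat
    (Eventually.of_forall fun N => partial_coding_mem hV i N ω)

theorem coding_sub_of_agree (hV : Φ.Valid) (i : Fin d) (n : ℕ) : ∀ ω ω' : ℕ → Φ.Symb,
    (∀ k < n, (ω k).1 i = (ω' k).1 i) → Φ.coding ω i - Φ.coding ω' i =
      (∏ k ∈ Finset.range n, Φ.slope i ((ω k).1 i)) *
        (Φ.coding (shift^[n] ω) i - Φ.coding (shift^[n] ω') i) := by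
  induction n with
  | zero => simp
  | succ n ih =>
    intro ω ω' h
    rw [coding_eq_base hV i ω, coding_eq_base hV i ω', ← h 0 n.succ_pos]
    have := ih (shift ω) (shift ω') fun k hk => h (k + 1) (by omega)
    simp only [DiagIFS.base, Function.iterate_succ, Function.comp_apply]
    rw [add_sub_add_right_eq_sub, ← mul_sub, this, Finset.prod_range_succ']
    simp only [shift]
    ring

theorem shift_iterate_apply {α : Type*} (n : ℕ) (ω : ℕ → α) (k : ℕ) :
    (shift^[n] ω) k = ω (k + n) := by
  induction n generalizing ω with
  | zero => rfl
  | succ n ih => rw [Function.iterate_succ, Function.comp_apply, ih]; simp only [shift]; congr 1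

/-- the distance of a point of `[0,1]` to the boundary -/
noncomputable def bdist (x : ℝ) : ℝ := min x (1 - x)

theorem bdist_nonneg {x : ℝ} (hx : x ∈ Icc (0 : ℝ) 1) : 0 ≤ bdist x :=
  le_min hx.1 (sub_nonneg.2 hx.2)

theorem bdist_base (hV : Φ.Valid) (i : Fin d) (a : A i) (x : ℝ) :
    |Φ.slope i a| * bdist x ≤ bdist (Φ.base i a x) := by
  have h0 := hV.2.2.2 i a 0 (by simp)
  have h1 := hV.2.2.2 i a 1 (by simp)
  simp only [DiagIFS.base, mul_zero, zero_add, mul_one, mem_Icc] at h0 h1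
  have hx1 : bdist x ≤ x := min_le_left _ _
  have hx2 : bdist x ≤ 1 - x := min_le_right _ _
  rcases le_total 0 (Φ.slope i a) with h | h
  · rw [abs_of_nonneg h]
    have e1 := mul_le_mul_of_nonneg_left hx1 h
    have e2 := mul_le_mul_of_nonneg_left hx2 h
    refine le_min ?_ ?_ <;> simp only [DiagIFS.base] <;> nlinarith
  · rw [abs_of_nonpos h]
    have e1 := mul_le_mul_of_nonneg_left hx1 (neg_nonneg.2 h)
    have e2 := mul_le_mul_of_nonneg_left hx2 (neg_nonneg.2 h)
    refine le_min ?_ ?_ <;> simp only [DiagIFS.base] <;> nlinarith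

theorem bdist_coding_le (hV : Φ.Valid) (hb : Φ.LyapBounds lo hi) (i : Fin d) (n : ℕ) :
    ∀ ω : ℕ → Φ.Symb, Real.exp (-(hi * n)) * bdist (Φ.coding (shift^[n] ω) i) ≤
      bdist (Φ.coding ω i) := by
  induction n with
  | zero => simp
  | succ n ih =>
    intro ω
    rw [coding_eq_base hV i ω]
    refine le_trans ?_ (bdist_base hV i _ _)
    rw [abs_slope_eq hV, Function.iterate_succ, Function.comp_apply]
    have h1 := ih (shift ω)
    have h2 : Real.exp (-hi) ≤ Real.exp (-Φ.lyap i (ω 0)) :=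
      Real.exp_le_exp.2 (neg_le_neg (hb.le_hi i _))
    have h3 : Real.exp (-(hi * ((n + 1 : ℕ) : ℝ))) = Real.exp (-hi) * Real.exp (-(hi * n)) := by
      rw [← Real.exp_add]; congr 1; push_cast; ring
    rw [h3, mul_assoc]
    exact mul_le_mul h2 h1 (mul_nonneg (Real.exp_pos _).le
      (bdist_nonneg (coding_mem_Icc hV i _))) (Real.exp_pos _).le

theorem isOpen_base_image (hV : Φ.Valid) (i : Fin d) (a : A i) :
    IsOpen (Φ.base i a '' Ioo (0 : ℝ) 1) := by
  have hs := hV.2.1 i a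
  have : Φ.base i a '' Ioo (0 : ℝ) 1 =
      (fun y => (y - Φ.off i a) / Φ.slope i a) ⁻¹' Ioo (0 : ℝ) 1 := by
    ext y
    constructor
    · rintro ⟨x, hx, rfl⟩
      simpa [DiagIFS.base, hs] using hx
    · intro hy
      refine ⟨_, hy, ?_⟩
      simp only [DiagIFS.base]
      field_simp
      ring
  rw [this]
  exact isOpen_Ioo.preimage (by fun_prop)

/-- two points in boxes with disjoint interiors are at least as far apart as the first one is
from the boundary of its box -/
theorem le_abs_base_sub_base (hV : Φ.Valid) {i : Fin d} {a b : A i}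
    (h : Disjoint (Φ.base i a '' Ioo (0 : ℝ) 1) (Φ.base i b '' Ioo (0 : ℝ) 1)) (x : ℝ) {x' : ℝ}
    (hx' : x' ∈ Icc (0 : ℝ) 1) :
    |Φ.slope i a| * bdist x ≤ |Φ.base i a x - Φ.base i b x'| := by
  have hs := hV.2.1 i a
  have hcont : Continuous (Φ.base i b) := by unfold DiagIFS.base; fun_prop
  have hcl : Φ.base i b x' ∈ closure (Φ.base i b '' Ioo (0 : ℝ) 1) := by
    refine image_closure_subset_closure_image hcont ⟨x', ?_, rfl⟩
    rwa [closure_Ioo zero_ne_one]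
  set z := (Φ.base i b x' - Φ.off i a) / Φ.slope i a with hz
  have hbz : Φ.base i a z = Φ.base i b x' := by
    rw [hz]; simp only [DiagIFS.base]; field_simp; ring
  have hznot : z ∉ Ioo (0 : ℝ) 1 := fun hmem =>
    (h.closure_right (isOpen_base_image hV i a)).le_bot ⟨⟨z, hmem, hbz⟩, hcl⟩
  rw [← hbz]
  have : Φ.base i a x - Φ.base i a z = Φ.slope i a * (x - z) := by
    simp only [DiagIFS.base]; ring
  rw [this, abs_mul]
  refine mul_le_mul_of_nonneg_left ?_ (abs_nonneg _)
  rcases le_or_gt z 0 with h0 | h0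
  · exact (min_le_left _ _).trans ((by linarith : x ≤ x - z).trans (le_abs_self _))
  · have h1 : 1 ≤ z := by
      by_contra! h1
      exact hznot ⟨h0, h1⟩
    refine (min_le_right _ _).trans ((by linarith : 1 - x ≤ -(x - z)).trans (neg_le_abs _))

theorem not_disjoint_of_common_endpoint (hV : Φ.Valid) {i : Fin d} {a b : A i} {e x x' : ℝ}
    (he : e = 0 ∨ e = 1) (hx : x ∈ Icc (0 : ℝ) 1) (hx' : x' ∈ Icc (0 : ℝ) 1)
    (ha : Φ.base i a x = e) (hb : Φ.base i b x' = e) :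
    ¬ Disjoint (Φ.base i a '' Ioo (0 : ℝ) 1) (Φ.base i b '' Ioo (0 : ℝ) 1) := by
  intro hd
  have hmid : ∀ c : A i, 0 < bdist (Φ.base i c (1 / 2)) := fun c => by
    refine lt_of_lt_of_le ?_ (bdist_base hV i c _)
    refine mul_pos (abs_pos.2 (hV.2.1 i c)) ?_
    norm_num [bdist]
  have h1 : ∀ c : A i, 0 < Φ.base i c (1 / 2) ∧ Φ.base i c (1 / 2) < 1 := fun c => by
    have := hmid c
    rw [bdist, lt_min_iff] at this
    exact ⟨this.1, by linarith⟩
  set v := Φ.base i a (1 / 2) - e with hv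
  set w := Φ.base i b (1 / 2) - e with hw
  have hpos : 0 < v / (v + w) ∧ 0 < w / (v + w) := by
    have ha1 := h1 a
    have hb1 := h1 b
    rcases he with rfl | rfl
    · have hv0 : 0 < v := by linarith
      have hw0 : 0 < w := by linarith
      constructor <;> positivity
    · have hv0 : v < 0 := by linarith
      have hw0 : w < 0 := by linarith
      exact ⟨div_pos_of_neg_of_neg hv0 (by linarith), div_pos_of_neg_of_neg hw0 (by linarith)⟩
  have hne : v + w ≠ 0 := fun h0 => by simp [h0] at hpos
  have hsum : v / (v + w) + w / (v + w) = 1 := by rw [← add_div, div_self hne]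
  have hmem : ∀ t u : ℝ, 0 < t → t < 1 → u ∈ Icc (0 : ℝ) 1 → u + t * (1 / 2 - u) ∈ Ioo (0 : ℝ) 1 := by
    intro t u h0 h1 hu
    constructor <;> nlinarith [hu.1, hu.2]
  rw [Set.disjoint_left] at hd
  refine @hd (e + v * w / (v + w)) ⟨_, hmem (w / (v + w)) x hpos.2 (by linarith) hx, ?_⟩
    ⟨_, hmem (v / (v + w)) x' hpos.1 (by linarith) hx', ?_⟩
  · have : Φ.base i a (x + w / (v + w) * (1 / 2 - x)) =
        Φ.base i a x + w / (v + w) * (Φ.base i a (1 / 2) - Φ.base i a x) := by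
      simp only [DiagIFS.base]; ring
    rw [this, ha, ← hv]; ring
  · have : Φ.base i b (x' + v / (v + w) * (1 / 2 - x')) =
        Φ.base i b x' + v / (v + w) * (Φ.base i b (1 / 2) - Φ.base i b x') := by
      simp only [DiagIFS.base]; ring
    rw [this, hb, ← hw]; ring

/-- if coordinate `i` has two boxes with disjoint interiors, some composition of two base maps
sends `[0,1]` into its interior -/
theorem exists_interior_word (hV : Φ.Valid) {i : Fin d} {a b : Φ.Symb}
    (h : Disjoint (Φ.base i (a.1 i) '' Ioo (0 : ℝ) 1) (Φ.base i (b.1 i) '' Ioo (0 : ℝ) 1)) :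
    ∃ a₁ a₂ : Φ.Symb, ∃ c > 0, ∀ x ∈ Icc (0 : ℝ) 1,
      c ≤ bdist (Φ.base i (a₁.1 i) (Φ.base i (a₂.1 i) x)) := by
  have hg : ∀ e : ℝ, e = 0 ∨ e = 1 → ∃ g : Φ.Symb, ∀ x ∈ Icc (0 : ℝ) 1,
      Φ.base i (g.1 i) x ≠ e := by
    intro e he
    by_contra! hcon
    obtain ⟨x, hx, hxe⟩ := hcon a
    obtain ⟨x', hx', hxe'⟩ := hcon b
    exact not_disjoint_of_common_endpoint hV he hx hx' hxe hxe' h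
  have hend : ∀ g : Φ.Symb, ∀ x ∈ Icc (0 : ℝ) 1, Φ.base i (g.1 i) x = 1 → x = 0 ∨ x = 1 := by
    intro g x hx hx1
    by_contra! hcon
    have h1 : 0 < bdist x :=
      lt_min (hx.1.lt_of_ne hcon.1.symm) (sub_pos.2 (hx.2.lt_of_ne hcon.2))
    have h2 := lt_of_lt_of_le (mul_pos (abs_pos.2 (hV.2.1 i (g.1 i))) h1) (bdist_base hV i (g.1 i) x)
    rw [hx1, bdist, lt_min_iff] at h2
    linarith
  obtain ⟨a₁, ha₁⟩ := hg 0 (Or.inl rfl)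
  have key : ∃ a₂ : Φ.Symb, ∀ x ∈ Icc (0 : ℝ) 1,
      Φ.base i (a₁.1 i) (Φ.base i (a₂.1 i) x) ≠ 1 := by
    by_cases ht : ∃ e ∈ Icc (0 : ℝ) 1, Φ.base i (a₁.1 i) e = 1
    · obtain ⟨e, he, he1⟩ := ht
      obtain ⟨a₂, ha₂⟩ := hg e (hend a₁ e he he1)
      refine ⟨a₂, fun x hx hx1 => ha₂ x hx ?_⟩
      have : Φ.slope i (a₁.1 i) * (Φ.base i (a₂.1 i) x - e) = 0 := by
        have h3 := hx1.trans he1.symm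
        rw [DiagIFS.base, DiagIFS.base.eq_1 Φ i (a₁.1 i) e] at h3
        linarith
      have := (mul_eq_zero.1 this).resolve_left (hV.2.1 i _)
      linarith
    · push Not at ht
      exact ⟨a₁, fun x hx => ht _ (hV.2.2.2 i _ x hx)⟩
  obtain ⟨a₂, ha₂⟩ := key
  have hcont : ContinuousOn (fun x => bdist (Φ.base i (a₁.1 i) (Φ.base i (a₂.1 i) x)))
      (Icc (0 : ℝ) 1) := by
    unfold bdist DiagIFS.base
    fun_prop
  obtain ⟨x₀, hx₀, hmin⟩ := isCompact_Icc.exists_isMinOn (nonempty_Icc.2 zero_le_one) hcont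
  refine ⟨a₁, a₂, _, ?_, fun x hx => hmin hx⟩
  have hm := hV.2.2.2 i (a₁.1 i) _ (hV.2.2.2 i (a₂.1 i) _ hx₀)
  refine lt_min (hm.1.lt_of_ne ?_) (sub_pos.2 (hm.2.lt_of_ne (ha₂ x₀ hx₀)))
  exact (ha₁ _ (hV.2.2.2 i (a₂.1 i) _ hx₀)).symm

end Coding

section Boundary

variable {Φ : DiagIFS d A} {lo hi : ℝ} {p : ℕ → Φ.Symb → ℝ} (hp : ∀ k, IsProbVec (p k))

theorem iIndepFun_eval_prodMeasure :
    ProbabilityTheory.iIndepFun (fun k (ω : ℕ → Φ.Symb) => ω k) (prodMeasure p hp) := by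
  have := fun k => isProbabilityMeasure_vecMeasure (hp k)
  exact ProbabilityTheory.iIndepFun_infinitePi (X := fun _ a => a) fun k => measurable_id

theorem prodMeasure_no_block_le {η : ℝ} (hη : 0 < η) (hpη : ∀ k a, η ≤ p k a) (a₁ a₂ : Φ.Symb)
    (l m : ℕ) :
    prodMeasure p hp {ω | ∀ j < m, ¬ (ω (l + 2 * j) = a₁ ∧ ω (l + 2 * j + 1) = a₂)} ≤
      ENNReal.ofReal ((1 - η ^ 2) ^ m) := by
  have hη1 : 0 ≤ 1 - η ^ 2 := by
    have h1 : p 0 a₁ ≤ 1 := by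
      rw [← (hp 0).2]
      exact Finset.single_le_sum (fun a _ => (hp 0).1 a) (Finset.mem_univ a₁)
    nlinarith [hpη 0 a₁]
  induction m with
  | zero => simp
  | succ m ih =>
    have hindep := ProbabilityTheory.iIndepFun.indepFun_finset (Finset.Ico l (l + 2 * m))
      (Finset.Ico (l + 2 * m) (l + 2 * m + 2)) (Finset.Ico_disjoint_Ico_consecutive _ _ _)
      (iIndepFun_eval_prodMeasure hp) fun k => measurable_pi_apply k
    have h0 : l + 2 * m ∈ Finset.Ico (l + 2 * m) (l + 2 * m + 2) := by simp
    have h1 : l + 2 * m + 1 ∈ Finset.Ico (l + 2 * m) (l + 2 * m + 2) := by simp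
    have hj : ∀ j < m, l + 2 * j ∈ Finset.Ico l (l + 2 * m) := fun j hj => by
      simp only [Finset.mem_Ico]; omega
    have hj' : ∀ j < m, l + 2 * j + 1 ∈ Finset.Ico l (l + 2 * m) := fun j hj => by
      simp only [Finset.mem_Ico]; omega
    have hmul := hindep.measure_inter_preimage_eq_mul
      {v | ∀ j, ∀ h : j < m, ¬ (v ⟨_, hj j h⟩ = a₁ ∧ v ⟨_, hj' j h⟩ = a₂)}
      {v | ¬ (v ⟨_, h0⟩ = a₁ ∧ v ⟨_, h1⟩ = a₂)} (Set.toFinite _).measurableSet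
      (Set.toFinite _).measurableSet
    have hset : {ω : ℕ → Φ.Symb | ∀ j < m + 1, ¬ (ω (l + 2 * j) = a₁ ∧ ω (l + 2 * j + 1) = a₂)} =
        {ω | ∀ j < m, ¬ (ω (l + 2 * j) = a₁ ∧ ω (l + 2 * j + 1) = a₂)} ∩
          {ω | ¬ (ω (l + 2 * m) = a₁ ∧ ω (l + 2 * m + 1) = a₂)} := by
      ext ω
      simp only [mem_ofPred_eq, mem_inter_iff, Nat.forall_lt_succ_right]
    have hblock : prodMeasure p hp {ω | ¬ (ω (l + 2 * m) = a₁ ∧ ω (l + 2 * m + 1) = a₂)} ≤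
        ENNReal.ofReal (1 - η ^ 2) := by
      have hm : MeasurableSet {ω : ℕ → Φ.Symb | ω (l + 2 * m) = a₁ ∧ ω (l + 2 * m + 1) = a₂} :=
        ((measurableSet_singleton a₁).preimage
          (measurable_pi_apply (X := fun _ : ℕ => Φ.Symb) (l + 2 * m))).inter
          ((measurableSet_singleton a₂).preimage
            (measurable_pi_apply (X := fun _ : ℕ => Φ.Symb) (l + 2 * m + 1)))
      have hc : {ω : ℕ → Φ.Symb | ¬ (ω (l + 2 * m) = a₁ ∧ ω (l + 2 * m + 1) = a₂)} =
        {ω | ω (l + 2 * m) = a₁ ∧ ω (l + 2 * m + 1) = a₂}ᶜ := rfl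
      rw [hc, prob_compl_eq_one_sub hm, ENNReal.ofReal_sub _ (by positivity), ENNReal.ofReal_one]
      refine tsub_le_tsub_left ?_ _
      have h2 := prodMeasure_pi hp {l + 2 * m, l + 2 * m + 1}
        fun k => if k = l + 2 * m then {a₁} else {a₂}
      rw [Finset.prod_pair (by omega), if_pos rfl, if_neg (by omega), vecMeasure_singleton (hp _),
        vecMeasure_singleton (hp _), ← ENNReal.ofReal_mul ((hp _).1 _)] at h2
      have h3 : {ω : ℕ → Φ.Symb | ω (l + 2 * m) = a₁ ∧ ω (l + 2 * m + 1) = a₂} =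
          {ω | ∀ k ∈ ({l + 2 * m, l + 2 * m + 1} : Finset ℕ), ω k ∈
            (if k = l + 2 * m then {a₁} else {a₂} : Set Φ.Symb)} := by
        ext ω
        simp
      rw [h3, h2]
      refine ENNReal.ofReal_le_ofReal ?_
      rw [sq]
      exact mul_le_mul (hpη _ _) (hpη _ _) hη.le ((hp _).1 _)
    rw [hset, pow_succ, ENNReal.ofReal_mul (pow_nonneg hη1 m)]
    exact (le_of_eq hmul).trans (mul_le_mul' ih hblock)

theorem le_bdist_of_block (hV : Φ.Valid) (hb : Φ.LyapBounds lo hi) {i : Fin d} {a₁ a₂ : Φ.Symb}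
    {c : ℝ} (hc : ∀ x ∈ Icc (0 : ℝ) 1, c ≤ bdist (Φ.base i (a₁.1 i) (Φ.base i (a₂.1 i) x)))
    {ω : ℕ → Φ.Symb} {l n : ℕ} (h1 : ω (l + n) = a₁) (h2 : ω (l + n + 1) = a₂) :
    Real.exp (-(hi * n)) * c ≤ bdist (Φ.coding (shift^[l] ω) i) := by
  refine le_trans ?_ (bdist_coding_le hV hb i n _)
  rw [← Function.iterate_add_apply, add_comm n l]
  refine mul_le_mul_of_nonneg_left ?_ (Real.exp_pos _).le
  rw [coding_eq_base hV, coding_eq_base hV]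
  have e0 : (shift^[l + n] ω) 0 = a₁ := by rw [shift_iterate_apply, zero_add, h1]
  have e1 : shift (shift^[l + n] ω) 0 = a₂ := by
    rw [shift, shift_iterate_apply, zero_add, add_comm, h2]
  rw [e0, e1]
  exact hc _ (coding_mem_Icc hV i _)

/-- under a product measure with densities bounded below, the shifted codings approach the
boundary subexponentially slowly -/
theorem ae_exists_le_bdist (hV : Φ.Valid) {η : ℝ} (hη : 0 < η) (hpη : ∀ k a, η ≤ p k a)
    {i : Fin d} {a b : Φ.Symb}
    (h : Disjoint (Φ.base i (a.1 i) '' Ioo (0 : ℝ) 1) (Φ.base i (b.1 i) '' Ioo (0 : ℝ) 1))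
    {ε : ℝ} (hε : 0 < ε) :
    ∀ᵐ ω ∂prodMeasure p hp, ∃ c > 0, ∀ l : ℕ,
      c * Real.exp (-(ε * l)) ≤ bdist (Φ.coding (shift^[l] ω) i) := by
  obtain ⟨lo, hi, hb⟩ := hV.exists_lyapBounds
  have hhi := hb.hi_pos
  obtain ⟨a₁, a₂, c, hc, hblock⟩ := exists_interior_word hV h
  set θ := ε / (2 * hi) with hθ
  have hθ0 : 0 < θ := by positivity
  have hθε : hi * (2 * θ) = ε := by rw [hθ]; field_simp
  have hη1 : 0 ≤ 1 - η ^ 2 := by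
    have h1 : p 0 a₁ ≤ 1 := by
      rw [← (hp 0).2]
      exact Finset.single_le_sum (fun a _ => (hp 0).1 a) (Finset.mem_univ a₁)
    nlinarith [hpη 0 a₁]
  have hae := ae_eventually_notMem_of_exp (μ := prodMeasure p hp) (C := Real.exp (η ^ 2))
    (c := η ^ 2 * θ) (by positivity) (s := fun l : ℕ => {ω | ∀ j < ⌊θ * l⌋₊,
      ¬ (ω (l + 2 * j) = a₁ ∧ ω (l + 2 * j + 1) = a₂)}) fun l => by
    refine (prodMeasure_no_block_le hp hη hpη a₁ a₂ l _).trans (ENNReal.ofReal_le_ofReal ?_)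
    have h1 : 1 - η ^ 2 ≤ Real.exp (-η ^ 2) := by linarith [Real.add_one_le_exp (-η ^ 2)]
    refine (pow_le_pow_left₀ hη1 h1 _).trans ?_
    rw [← Real.exp_nat_mul, ← Real.exp_add]
    refine Real.exp_le_exp.2 ?_
    have h2 := Nat.lt_floor_add_one (θ * l)
    nlinarith [sq_pos_of_pos hη]
  filter_upwards [hae] with ω hω
  obtain ⟨l₀, hl₀⟩ := eventually_atTop.1 hω
  have hlarge : ∀ l ≥ l₀, c * Real.exp (-(ε * l)) ≤ bdist (Φ.coding (shift^[l] ω) i) := by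
    intro l hl
    have := hl₀ l hl
    push Not at this
    obtain ⟨j, hj, h1, h2⟩ := this
    refine le_trans ?_ (le_bdist_of_block hV hb hblock h1 h2)
    rw [mul_comm]
    refine mul_le_mul_of_nonneg_right (Real.exp_le_exp.2 ?_) hc.le
    have h3 : (j : ℝ) ≤ θ * l := (Nat.le_floor_iff (by positivity)).1 hj.le
    push_cast
    nlinarith
  refine ⟨c * Real.exp (-(hi * l₀ + ε * l₀)), by positivity, fun l => ?_⟩
  rcases le_total l₀ l with hl | hl
  · refine le_trans ?_ (hlarge l hl)
    refine mul_le_mul_of_nonneg_right (mul_le_of_le_one_right hc.le ?_) (Real.exp_pos _).le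
    exact Real.exp_le_one_iff.2 (neg_nonpos.2 (by positivity))
  · refine le_trans ?_ (bdist_coding_le hV hb i (l₀ - l) _)
    rw [← Function.iterate_add_apply, Nat.sub_add_cancel hl]
    refine le_trans ?_ (mul_le_mul_of_nonneg_left (hlarge l₀ le_rfl) (Real.exp_pos _).le)
    rw [mul_left_comm, mul_assoc, ← Real.exp_add, ← Real.exp_add]
    refine mul_le_mul_of_nonneg_left (Real.exp_le_exp.2 ?_) hc.le
    have : ((l₀ - l : ℕ) : ℝ) ≤ l₀ := by exact_mod_cast Nat.sub_le _ _
    have h5 : 0 ≤ ε * l := by positivity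
    nlinarith

end Boundary

section LowerBound

variable {Φ : DiagIFS d A} {lo hi : ℝ} {p : ℕ → Φ.Symb → ℝ} (hp : ∀ k, IsProbVec (p k))

/-- the last integer time at which coordinate `i` is visible at scale `exp (-n)` -/
noncomputable def cutoff (Φ : DiagIFS d A) (p : ℕ → Φ.Symb → ℝ) (n : ℕ) (i : Fin d) : ℕ :=
  ⌊Bcoord Φ (step p) n i⌋₊

include hp in
theorem lt_cutoff_iff (hb : Φ.LyapBounds lo hi) (n : ℕ) (i : Fin d) (l : ℕ) :
    l < cutoff Φ p n i ↔ ∑ k ∈ Finset.range (l + 1), Φ.chi i (p k) ≤ n := by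
  have hr := isProfile_step hp
  rw [cutoff, Nat.lt_iff_add_one_le, Nat.le_floor_iff (hr.Bcoord_spec hb i n.cast_nonneg).1,
    hr.le_Bcoord_iff hb i n.cast_nonneg (Nat.cast_nonneg _), chiInt_step]

include hp in
theorem sum_chi_cutoff_le (hb : Φ.LyapBounds lo hi) (n : ℕ) (i : Fin d) :
    ∑ k ∈ Finset.range (cutoff Φ p n i), Φ.chi i (p k) ≤ n := by
  rcases Nat.eq_zero_or_pos (cutoff Φ p n i) with h | h
  · simp [h]
  · have := (lt_cutoff_iff hp hb n i (cutoff Φ p n i - 1)).1 (by omega)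
    rwa [Nat.sub_add_cancel h] at this

include hp in
theorem cutoff_le (hb : Φ.LyapBounds lo hi) (n : ℕ) (i : Fin d) :
    (cutoff Φ p n i : ℝ) ≤ n / lo :=
  (Nat.floor_le ((isProfile_step hp).Bcoord_spec hb i n.cast_nonneg).1).trans
    ((isProfile_step hp).Bcoord_le hb i n.cast_nonneg)

include hp in
theorem tendsto_cutoff (hb : Φ.LyapBounds lo hi) (i : Fin d) :
    Tendsto (fun n => cutoff Φ p n i) atTop atTop := by
  refine tendsto_atTop.2 fun m => ?_
  filter_upwards [eventually_ge_atTop ⌈∑ k ∈ Finset.range (m + 1), Φ.chi i (p k)⌉₊] with n hn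
  exact ((lt_cutoff_iff hp hb n i m).2 ((Nat.le_ceil _).trans (by exact_mod_cast hn))).le

include hp in
theorem goodIdx_cutoff (hb : Φ.LyapBounds lo hi)
    (hGood : ∀ p : Φ.Symb → ℝ, IsProbVec p → Φ.GoodVec p) {n : ℕ} (hn : 0 < n) (l : ℕ) :
    Φ.GoodIdx (Finset.univ.filter fun i => l < cutoff Φ p n i) := by
  have hl : (0 : ℝ) < l + 1 := by positivity
  set q : Φ.Symb → ℝ := fun a => (∑ k ∈ Finset.range (l + 1), p k a) / (l + 1) with hq
  have hqp : IsProbVec q := by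
    refine ⟨fun a => div_nonneg (Finset.sum_nonneg fun k _ => (hp k).1 a) hl.le, ?_⟩
    rw [hq, ← Finset.sum_div, Finset.sum_comm, Finset.sum_congr rfl fun k _ => (hp k).2]
    simp only [Finset.sum_const, Finset.card_range, nsmul_eq_mul, mul_one]
    push_cast
    exact div_self hl.ne'
  have hchi : ∀ i, Φ.chi i q = (∑ k ∈ Finset.range (l + 1), Φ.chi i (p k)) / (l + 1) := by
    intro i
    simp only [Φ.chi_eq_sum, hq]
    rw [Finset.sum_comm, Finset.sum_div]
    refine Finset.sum_congr rfl fun a _ => ?_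
    rw [div_mul_eq_mul_div, Finset.sum_mul]
  have h := hGood q hqp (n / (l + 1)) (div_pos (by exact_mod_cast hn) hl)
  convert h using 3 with i
  rw [lt_cutoff_iff hp hb, hchi, div_le_div_iff_of_pos_right hl]

/-- two sequences that are distinguishable at scale `exp (-n)` have codings separated, up to the
distance of a shifted coding to the boundary, by the size of the approximate cube -/
theorem exists_le_abs_coding_sub (hV : Φ.Valid) {N : Fin d → ℕ}
    (hN : ∀ l, Φ.GoodIdx (Finset.univ.filter fun i => l < N i)) {ω ω' : ℕ → Φ.Symb}
    (h : ∃ l i, l < N i ∧ (ω l).1 i ≠ (ω' l).1 i) :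
    ∃ l i, l < N i ∧ (∃ a b : Φ.Symb, Disjoint (Φ.base i (a.1 i) '' Ioo (0 : ℝ) 1)
        (Φ.base i (b.1 i) '' Ioo (0 : ℝ) 1)) ∧
      Real.exp (-∑ k ∈ Finset.range (N i), Φ.lyap i (ω k)) *
        bdist (Φ.coding (shift^[l + 1] ω) i) ≤ |Φ.coding ω i - Φ.coding ω' i| := by
  set l := Nat.find h with hl
  obtain ⟨i₀, hi₀, hne⟩ := Nat.find_spec h
  obtain ⟨i, hi, hdisj⟩ := hN l (ω l).1 (ω l).2 (ω' l).1 (ω' l).2 ⟨i₀, Finset.mem_filter.2 ⟨Finset.mem_univ _, hi₀⟩, hne⟩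
  have hi : l < N i := by simpa using hi
  refine ⟨l, i, hi, ⟨_, _, hdisj⟩, ?_⟩
  have hagree : ∀ k < l, (ω k).1 i = (ω' k).1 i := fun k hk => by
    by_contra hcon
    exact Nat.find_min h hk ⟨i, hk.trans hi, hcon⟩
  have h0 : ∀ ω : ℕ → Φ.Symb, (shift^[l] ω) 0 = ω l := fun ω => by
    rw [shift_iterate_apply, zero_add]
  rw [coding_sub_of_agree hV i l ω ω' hagree, abs_mul, abs_prod_slope hV]
  have h1 := le_abs_base_sub_base hV hdisj (Φ.coding (shift^[l + 1] ω) i)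
    (coding_mem_Icc hV i (shift^[l + 1] ω'))
  have h2 : ∀ ω : ℕ → Φ.Symb, Φ.coding (shift^[l] ω) i =
      Φ.base i ((ω l).1 i) (Φ.coding (shift^[l + 1] ω) i) := fun ω => by
    rw [coding_eq_base hV, h0, Function.iterate_succ_apply']
  rw [h2 ω, h2 ω']
  refine le_trans ?_ (mul_le_mul_of_nonneg_left h1 (Real.exp_pos _).le)
  rw [abs_slope_eq hV, ← mul_assoc, ← Real.exp_add]
  refine mul_le_mul_of_nonneg_right (Real.exp_le_exp.2 ?_) (bdist_nonneg (coding_mem_Icc hV i _))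
  rw [← neg_add, neg_le_neg_iff, ← Finset.sum_range_succ]
  exact Finset.sum_le_sum_of_subset_of_nonneg (Finset.range_mono hi)
    fun k _ _ => (hV.lyap_pos i _).le

theorem prodMeasure_approxCube {η : ℝ} (hη : 0 < η) (hpη : ∀ k a, η ≤ p k a) {N : Fin d → ℕ} {L : ℕ}
    (ω : ℕ → Φ.Symb) :
    prodMeasure p hp {ω' | ∀ k < L, ∀ i, k < N i → (ω' k).1 i = (ω k).1 i} =
      ENNReal.ofReal (Real.exp (-∑ k ∈ Finset.range L,
        -Real.log (Φ.cylMass (Finset.univ.filter fun i => k < N i) (p k) (ω k)))) := by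
  have h := prodMeasure_pi hp (Finset.range L) fun k =>
    {b | ∀ i ∈ Finset.univ.filter fun i => k < N i, b.1 i = (ω k).1 i}
  have hset : {ω' : ℕ → Φ.Symb | ∀ k < L, ∀ i, k < N i → (ω' k).1 i = (ω k).1 i} =
      {ω' | ∀ k ∈ Finset.range L, ω' k ∈ {b : Φ.Symb | ∀ i ∈ Finset.univ.filter fun i => k < N i,
        b.1 i = (ω k).1 i}} := by
    ext ω'
    simp
  rw [hset, h]
  simp only [vecMeasure_cylinder (hp _)]
  rw [← ENNReal.ofReal_prod_of_nonneg fun k _ => Φ.cylMass_nonneg _ (hp k) _,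
    Finset.sum_neg_distrib, neg_neg, Real.exp_sum]
  refine congrArg _ (Finset.prod_congr rfl fun k _ => (Real.exp_log ?_).symm)
  exact hη.trans_le ((hpη k _).trans (Φ.le_cylMass _ (hp k) _))

include hp in
theorem mul_deltaRB_le_sum_entropy (hb : Φ.LyapBounds lo hi) {H : ℝ}
    (hH : ∀ I (p : Φ.Symb → ℝ), IsProbVec p → Φ.entropy I p ≤ H) (hH0 : 0 ≤ H) {n L : ℕ}
    (hn : 0 < n) (hL : n / lo ≤ L) :
    n * deltaRB Φ (step p) n ≤ (∑ k ∈ Finset.range L,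
      Φ.entropy (Finset.univ.filter fun i => k < cutoff Φ p n i) (p k)) + H * d := by
  have hr := isProfile_step hp
  have hN : ∀ i, cutoff Φ p n i ≤ L := fun i => by
    exact_mod_cast (cutoff_le hp hb n i).trans hL
  have hn' : (n : ℝ) ≠ 0 := by exact_mod_cast hn.ne'
  rw [deltaRB_eq, mul_inv_cancel_left₀ hn', ← thrInt_step hp hN]
  have h := hr.thrInt_le (D := Bcoord Φ (step p) n) (D' := fun i => (cutoff Φ p n i : ℝ)) (M := L)
    (ε := 0) (S := ∅) hr hH hH0 (fun i => (hr.Bcoord_le hb i n.cast_nonneg).trans hL)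
    (fun i => by exact_mod_cast hN i) L.cast_nonneg le_rfl MeasurableSet.empty (by simp)
  have h2 : ∑ i, |Bcoord Φ (step p) n i - (cutoff Φ p n i : ℝ)| ≤ d := by
    have : ∀ i ∈ Finset.univ, |Bcoord Φ (step p) n i - (cutoff Φ p n i : ℝ)| ≤ 1 := fun i _ => by
      have h3 := Nat.floor_le (hr.Bcoord_spec hb i n.cast_nonneg).1
      have h4 := Nat.lt_floor_add_one (Bcoord Φ (step p) n i)
      rw [cutoff, abs_le]
      constructor <;> linarith
    simpa using Finset.sum_le_card_nsmul _ _ _ this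
  simp only [zero_mul, empty_inter, measureReal_empty, mul_zero, add_zero] at h
  exact h.trans (add_le_add_right (mul_le_mul_of_nonneg_left h2 hH0) _)

end LowerBound

section PointwiseDimension

variable {Φ : DiagIFS d A} {p : ℕ → Φ.Symb → ℝ} (hp : ∀ k, IsProbVec (p k))

theorem ae_preimage_ball_subset (hV : Φ.Valid)
    (hGood : ∀ p : Φ.Symb → ℝ, IsProbVec p → Φ.GoodVec p) {η : ℝ} (hη : 0 < η)
    (hpη : ∀ k a, η ≤ p k a) {ε : ℝ} (hε : 0 < ε) :
    ∀ᵐ ω ∂prodMeasure p hp, ∃ c > 0, ∀ᶠ n : ℕ in atTop,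
      Φ.coding ⁻¹' ball (Φ.coding ω) (c * Real.exp (-(n * (1 + ε)))) ⊆
        {ω' | ∀ l i, l < cutoff Φ p n i → (ω' l).1 i = (ω l).1 i} := by
  obtain ⟨lo, hi, hb⟩ := hV.exists_lyapBounds
  have hlo := hb.lo_pos
  set ε₁ := ε * lo / 2 with hε₁
  have hε₁0 : 0 < ε₁ := by positivity
  have hbd : ∀ᵐ ω ∂prodMeasure p hp, ∀ i : Fin d, (∃ a b : Φ.Symb,
      Disjoint (Φ.base i (a.1 i) '' Ioo (0 : ℝ) 1) (Φ.base i (b.1 i) '' Ioo (0 : ℝ) 1)) →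
      ∃ c > 0, ∀ l : ℕ, c * Real.exp (-(ε₁ * l)) ≤ bdist (Φ.coding (shift^[l] ω) i) := by
    refine ae_all_iff.2 fun i => ?_
    by_cases h : ∃ a b : Φ.Symb, Disjoint (Φ.base i (a.1 i) '' Ioo (0 : ℝ) 1)
      (Φ.base i (b.1 i) '' Ioo (0 : ℝ) 1)
    · obtain ⟨a, b, hab⟩ := h
      filter_upwards [ae_exists_le_bdist hp hV hη hpη hab hε₁0] with ω hω _ using hω
    · exact Eventually.of_forall fun ω h' => absurd h' h
  have hsum : ∀ᵐ ω ∂prodMeasure p hp, ∀ i : Fin d, ∀ᶠ m : ℕ in atTop,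
      ∑ k ∈ Finset.range m, Φ.lyap i (ω k) <
        (∑ k ∈ Finset.range m, Φ.chi i (p k)) + ε₁ * m := by
    refine ae_all_iff.2 fun i => ?_
    have := ae_eventually_sum_lt hp (f := fun _ _ a => Φ.lyap i a) (K := hi) (c := 1) hb.hi_pos
      one_pos (fun _ _ a => ⟨(hV.lyap_pos i a).le, hb.le_hi i a⟩) (L := fun n => n)
      (fun n => by simp) hε₁0
    simpa only [Φ.chi_eq_sum] using this
  filter_upwards [hbd, hsum] with ω h1 h2
  have hc : ∃ c > 0, ∀ i : Fin d, (∃ a b : Φ.Symb, Disjoint (Φ.base i (a.1 i) '' Ioo (0 : ℝ) 1)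
      (Φ.base i (b.1 i) '' Ioo (0 : ℝ) 1)) → ∀ l : ℕ,
      c * Real.exp (-(ε₁ * l)) ≤ bdist (Φ.coding (shift^[l] ω) i) := by
    have : ∀ i : Fin d, ∃ c > 0, (∃ a b : Φ.Symb, Disjoint (Φ.base i (a.1 i) '' Ioo (0 : ℝ) 1)
      (Φ.base i (b.1 i) '' Ioo (0 : ℝ) 1)) → ∀ l : ℕ,
      c * Real.exp (-(ε₁ * l)) ≤ bdist (Φ.coding (shift^[l] ω) i) := fun i => by
      by_cases h : ∃ a b : Φ.Symb, Disjoint (Φ.base i (a.1 i) '' Ioo (0 : ℝ) 1)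
        (Φ.base i (b.1 i) '' Ioo (0 : ℝ) 1)
      · obtain ⟨c, hc, hc'⟩ := h1 i h
        exact ⟨c, hc, fun _ => hc'⟩
      · exact ⟨1, one_pos, fun h' => absurd h' h⟩
    choose c hc hc' using this
    rcases isEmpty_or_nonempty (Fin d) with hd | hd
    · exact ⟨1, one_pos, fun i => hd.elim i⟩
    · obtain ⟨i₀, -, hi₀⟩ := Finset.exists_min_image Finset.univ c Finset.univ_nonempty
      refine ⟨c i₀, hc i₀, fun i h l => le_trans ?_ (hc' i h l)⟩
      exact mul_le_mul_of_nonneg_right (hi₀ i (Finset.mem_univ i)) (Real.exp_pos _).le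
  obtain ⟨c, hc0, hc⟩ := hc
  refine ⟨c, hc0, ?_⟩
  have h3 : ∀ᶠ n : ℕ in atTop, ∀ i, ∑ k ∈ Finset.range (cutoff Φ p n i), Φ.lyap i (ω k) <
      (∑ k ∈ Finset.range (cutoff Φ p n i), Φ.chi i (p k)) + ε₁ * (cutoff Φ p n i : ℕ) :=
    eventually_all.2 fun i => (tendsto_cutoff hp hb i).eventually (h2 i)
  filter_upwards [h3, eventually_gt_atTop 0] with n hn hn0 ω' hω'
  by_contra hcon
  simp only [mem_ofPred_eq] at hcon
  push Not at hcon
  obtain ⟨l₀, i₀, hl₀, hne⟩ := hcon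
  obtain ⟨l, i, hl, hact, hle⟩ := exists_le_abs_coding_sub hV
    (goodIdx_cutoff hp hb hGood hn0) ⟨l₀, i₀, hl₀, Ne.symm hne⟩
  have h4 : |Φ.coding ω i - Φ.coding ω' i| < c * Real.exp (-(n * (1 + ε))) := by
    rw [abs_sub_comm, ← Real.dist_eq]
    exact (dist_le_pi_dist _ _ i).trans_lt hω'
  have h5 := hc i hact (l + 1)
  have h6 := sum_chi_cutoff_le hp hb n i
  have h7 := cutoff_le hp hb n i
  have h8 : ε₁ * (cutoff Φ p n i : ℕ) ≤ n * ε / 2 := by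
    calc ε₁ * (cutoff Φ p n i : ℕ) ≤ ε₁ * (n / lo) := mul_le_mul_of_nonneg_left h7 hε₁0.le
      _ = n * ε / 2 := by rw [hε₁]; field_simp
  have h9 : ε₁ * ((l + 1 : ℕ) : ℝ) ≤ n * ε / 2 :=
    (mul_le_mul_of_nonneg_left (by exact_mod_cast hl) hε₁0.le).trans h8
  refine absurd (h4.trans_le' hle) (not_lt.2 ?_)
  refine le_trans ?_ (mul_le_mul_of_nonneg_left h5 (Real.exp_pos _).le)
  rw [mul_left_comm, ← Real.exp_add]
  refine mul_le_mul_of_nonneg_left (Real.exp_le_exp.2 ?_) hc0.le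
  have := hn i
  nlinarith

/-- lower bound for the pointwise dimension of the coded product measure with slowly varying
densities `p k` -/
theorem le_lowerPtDim_prodMeasure (hV : Φ.Valid)
    (hGood : ∀ p : Φ.Symb → ℝ, IsProbVec p → Φ.GoodVec p) {η : ℝ} (hη : 0 < η)
    (hpη : ∀ k a, η ≤ p k a) {s : ℝ}
    (hs : ∀ ε > 0, ∀ᶠ n : ℕ in atTop, s - ε ≤ deltaRB Φ (step p) n) :
    ∀ᵐ ω ∂prodMeasure p hp,
      ENNReal.ofReal s ≤ lowerPtDim ((prodMeasure p hp).map Φ.coding) (Φ.coding ω) := by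
  obtain ⟨lo, hi, hb⟩ := hV.exists_lyapBounds
  have hlo := hb.lo_pos
  obtain ⟨H, hH0, hH⟩ := Φ.exists_entropy_bound
  have hmeas := measurable_coding hV
  have : IsProbabilityMeasure ((prodMeasure p hp).map Φ.coding) :=
    Measure.isProbabilityMeasure_map hmeas.aemeasurable
  have hsupp : ∀ᵐ ω ∂prodMeasure p hp, ∀ ρ > 0,
      (prodMeasure p hp).map Φ.coding (ball (Φ.coding ω) ρ) ≠ 0 := by
    refine ae_of_ae_map hmeas.aemeasurable (p := fun x => ∀ ρ > 0,
      (prodMeasure p hp).map Φ.coding (ball x ρ) ≠ 0) ?_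
    filter_upwards [Measure.support_mem_ae (μ := (prodMeasure p hp).map Φ.coding)] with x hx ρ hρ
    exact ((Measure.mem_support_iff_forall x).1 hx _ (ball_mem_nhds x hρ)).ne'
  have key : ∀ m : ℕ, ∀ᵐ ω ∂prodMeasure p hp,
      ENNReal.ofReal ((s - (1 / ((m : ℝ) + 1)) * (3 + 1 / lo)) / (1 + 1 / ((m : ℝ) + 1))) ≤
        lowerPtDim ((prodMeasure p hp).map Φ.coding) (Φ.coding ω) := by
    intro m
    have hε : 0 < 1 / ((m : ℝ) + 1) := by positivity
    set ε := 1 / ((m : ℝ) + 1)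
    have hη1 : η ≤ 1 := by
      obtain ⟨a, ha⟩ := hV.1
      refine (hpη 0 ⟨a, ha⟩).trans ?_
      rw [← (hp 0).2]
      exact Finset.single_le_sum (fun a _ => (hp 0).1 a) (Finset.mem_univ _)
    have hlog : Real.log η ≤ 0 := Real.log_nonpos hη.le hη1
    have hent := ae_eventually_lt_sum hp (K := 1 - Real.log η) (c := 1 / lo)
      (f := fun n k a => -Real.log (Φ.cylMass (Finset.univ.filter fun i => k < cutoff Φ p n i)
        (p k) a)) (by linarith) (by positivity) (fun n k a => ?_)
      (L := fun n => ⌈(n : ℝ) / lo⌉₊) (fun n => by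
        rw [one_div_mul_eq_div]; exact Nat.le_ceil _) hε
    · filter_upwards [ae_preimage_ball_subset hp hV hGood hη hpη hε, hent, hsupp] with ω h1 h2 h3
      obtain ⟨c, hc0, hc⟩ := h1
      refine ofReal_div_le_lowerPtDim hc0 (by positivity) h3 ?_
      have hbig : ∀ᶠ n : ℕ in atTop, ε + H * d ≤ ε * n :=
        (tendsto_natCast_atTop_atTop.const_mul_atTop hε).eventually_ge_atTop _
      filter_upwards [hc, h2, hs ε hε, eventually_gt_atTop 0, hbig] with n hn1 hn2 hn3 hn0 hn4
      rw [Measure.map_apply hmeas measurableSet_ball]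
      refine (measure_mono hn1).trans ?_
      have hsub : {ω' : ℕ → Φ.Symb | ∀ l i, l < cutoff Φ p n i → (ω' l).1 i = (ω l).1 i} ⊆
          {ω' | ∀ k < ⌈(n : ℝ) / lo⌉₊, ∀ i, k < cutoff Φ p n i → (ω' k).1 i = (ω k).1 i} :=
        fun ω' h k _ i hk => h k i hk
      refine (measure_mono hsub).trans ?_
      rw [prodMeasure_approxCube hp hη hpη]
      refine ENNReal.ofReal_le_ofReal (Real.exp_le_exp.2 (neg_le_neg ?_))
      refine le_trans ?_ hn2.le
      have h4 := mul_deltaRB_le_sum_entropy hp hb hH hH0.le hn0 (Nat.le_ceil ((n : ℝ) / lo))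
      have h5 : ((⌈(n : ℝ) / lo⌉₊ : ℕ) : ℝ) ≤ n / lo + 1 := (Nat.ceil_lt_add_one (by positivity)).le
      have h6 : (n : ℝ) * (s - ε) ≤ n * deltaRB Φ (step p) n :=
        mul_le_mul_of_nonneg_left hn3 n.cast_nonneg
      have h7 : ∀ k, ∑ a, p k a * -Real.log (Φ.cylMass
          (Finset.univ.filter fun i => k < cutoff Φ p n i) (p k) a) =
          Φ.entropy (Finset.univ.filter fun i => k < cutoff Φ p n i) (p k) := fun k => by
        simp [DiagIFS.entropy, Finset.sum_neg_distrib]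
      simp only [h7]
      have h8 : ε * ((⌈(n : ℝ) / lo⌉₊ : ℕ) : ℝ) ≤ n * (ε * (1 / lo)) + ε := by
        refine (mul_le_mul_of_nonneg_left h5 hε.le).trans (le_of_eq ?_)
        field_simp
      nlinarith
    · have h1 := (hpη k a).trans (Φ.le_cylMass
        (Finset.univ.filter fun i => k < cutoff Φ p n i) (hp k) a)
      constructor
      · exact neg_nonneg.2 (Real.log_nonpos (hη.le.trans h1) (Φ.cylMass_le_one _ (hp k) a))
      · have := Real.log_le_log hη h1
        linarith
  filter_upwards [ae_all_iff.2 key] with ω hω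
  have hlim : Tendsto (fun m : ℕ => ENNReal.ofReal ((s - (1 / ((m : ℝ) + 1)) * (3 + 1 / lo)) /
      (1 + 1 / ((m : ℝ) + 1)))) atTop (𝓝 (ENNReal.ofReal s)) := by
    have h0 : Tendsto (fun m : ℕ => 1 / ((m : ℝ) + 1)) atTop (𝓝 0) :=
      tendsto_one_div_add_atTop_nhds_zero_nat
    refine ENNReal.tendsto_ofReal ?_
    have := (tendsto_const_nhds (x := s)).sub (h0.mul_const (3 + 1 / lo)) |>.div
      ((tendsto_const_nhds (x := (1 : ℝ))).add h0) (by norm_num)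
    simpa [Pi.div_def] using this
  exact le_of_tendsto' hlim hω

end PointwiseDimension

section Perturbation

variable {Φ : DiagIFS d A} {lo hi : ℝ}

theorem Cycle.apply_lam_pow_mul (c : Cycle Φ) (n : ℕ) {b : ℝ} (hb : 0 < b) :
    c.r (c.lam ^ n * b) = c.r b := by
  induction n with
  | zero => simp
  | succ n ih =>
    rw [pow_succ', mul_assoc, c.periodic _ (mul_pos (pow_pos c.lam_pos n) hb), ih]

/-- a cycle varies slowly at large times -/
theorem Cycle.exists_close_ceil (c : Cycle Φ) {κ : ℝ} (hκ : 0 < κ) :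
    ∃ K > 0, ∀ b ≥ K, ∀ a, |c.r b a - c.r (⌈b⌉₊ : ℕ) a| ≤ κ := by
  rcases c.one_le_lam.eq_or_lt with h1 | h1
  · refine ⟨1, one_pos, fun b hb a => ?_⟩
    have hb0 : 0 < b := one_pos.trans_le hb
    rw [c.const_of_lam_eq_one h1.symm b hb0 (⌈b⌉₊ : ℕ) (hb0.trans_le (Nat.le_ceil b)), sub_self,
      abs_zero]
    exact hκ.le
  have hlam := c.lam_pos
  have huc : UniformContinuousOn c.r (Icc 1 (2 * c.lam)) :=
    isCompact_Icc.uniformContinuousOn_of_continuous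
      (c.cont.mono fun b hb => one_pos.trans_le hb.1)
  obtain ⟨δ, hδ, huc⟩ := Metric.uniformContinuousOn_iff.1 huc κ hκ
  refine ⟨max 1 (2 * c.lam / δ), by positivity, fun b hb a => ?_⟩
  have hb1 : 1 ≤ b := (le_max_left _ _).trans hb
  have hb2 : 2 * c.lam / δ ≤ b := (le_max_right _ _).trans hb
  obtain ⟨n, hn1, hn2⟩ := exists_nat_pow_near hb1 h1
  have hpow : 0 < c.lam ^ n := pow_pos hlam n
  have hceil := Nat.le_ceil b
  have hceil' := Nat.ceil_lt_add_one (zero_le_one.trans hb1)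
  have hr : ∀ x > 0, c.r x = c.r (x / c.lam ^ n) := fun x hx => by
    rw [← c.apply_lam_pow_mul n (div_pos hx hpow), mul_div_cancel₀ _ hpow.ne']
  rw [hr b (by linarith), hr (⌈b⌉₊ : ℝ) (by linarith)]
  have e1 : 1 ≤ b / c.lam ^ n := by rwa [one_le_div hpow]
  have e2 : b / c.lam ^ n ≤ c.lam := by rw [div_le_iff₀ hpow, ← pow_succ']; exact hn2.le
  have e3 : b / c.lam ^ n ≤ (⌈b⌉₊ : ℝ) / c.lam ^ n := div_le_div_of_nonneg_right hceil hpow.le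
  have e4 : (⌈b⌉₊ : ℝ) / c.lam ^ n ≤ 2 * (b / c.lam ^ n) := by
    rw [← mul_div_assoc]
    exact div_le_div_of_nonneg_right (by linarith) hpow.le
  have hdist : dist (b / c.lam ^ n) ((⌈b⌉₊ : ℝ) / c.lam ^ n) < δ := by
    rw [Real.dist_eq, ← sub_div, abs_div, abs_of_pos hpow, div_lt_iff₀ hpow, abs_sub_comm,
      abs_of_nonneg (by linarith)]
    rw [div_le_iff₀ hδ] at hb2
    rw [pow_succ'] at hn2
    have : 2 * c.lam < δ * c.lam ^ n * c.lam := by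
      refine hb2.trans_lt ?_
      rw [mul_comm b, mul_assoc]
      exact mul_lt_mul_of_pos_left (by linarith) hδ
    nlinarith
  have := huc _ ⟨e1, by linarith⟩ _ ⟨e1.trans e3, by linarith⟩ hdist
  exact (dist_le_pi_dist _ _ a).trans this.le

/-- the convex combination of `p` with the uniform vector -/
noncomputable def perturb (η : ℝ) (p : Φ.Symb → ℝ) (a : Φ.Symb) : ℝ :=
  (1 - η) * p a + η / Fintype.card Φ.Symb

theorem isProbVec_perturb (hV : Φ.Valid) {η : ℝ} (h0 : 0 ≤ η) (h1 : η ≤ 1) {p : Φ.Symb → ℝ}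
    (hp : IsProbVec p) : IsProbVec (perturb η p) := by
  have : Nonempty Φ.Symb := hV.1.to_subtype
  refine ⟨fun a => add_nonneg (mul_nonneg (by linarith) (hp.1 a)) (by positivity), ?_⟩
  simp only [perturb]
  rw [Finset.sum_add_distrib, ← Finset.mul_sum, hp.2, Finset.sum_const, Finset.card_univ,
    nsmul_eq_mul, mul_div_cancel₀ _ (by exact_mod_cast Fintype.card_ne_zero)]
  ring

theorem div_card_le_perturb {η : ℝ} (h1 : η ≤ 1) {p : Φ.Symb → ℝ}
    (hp : IsProbVec p) (a : Φ.Symb) : η / Fintype.card Φ.Symb ≤ perturb η p a :=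
  le_add_of_nonneg_left (mul_nonneg (by linarith) (hp.1 a))

theorem IsProbVec.le_one {α : Type*} [Fintype α] {p : α → ℝ} (hp : IsProbVec p) (a : α) :
    p a ≤ 1 := by
  rw [← hp.2]
  exact Finset.single_le_sum (fun a _ => hp.1 a) (Finset.mem_univ a)

theorem abs_sub_perturb_le (hV : Φ.Valid) {η : ℝ} (h0 : 0 ≤ η) {p : Φ.Symb → ℝ}
    (hp : IsProbVec p) (a : Φ.Symb) : |p a - perturb η p a| ≤ η := by
  have : Nonempty Φ.Symb := hV.1.to_subtype
  have h2 : (1 : ℝ) ≤ Fintype.card Φ.Symb := by exact_mod_cast Fintype.card_pos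
  have h3 : η / Fintype.card Φ.Symb ≤ η := div_le_self h0 h2
  have h4 : 0 ≤ η / Fintype.card Φ.Symb := by positivity
  have h5 := mul_nonneg h0 (hp.1 a)
  have h6 := mul_le_mul_of_nonneg_left (hp.le_one a) h0
  rw [perturb, abs_le]
  constructor <;> nlinarith

theorem Cycle.ofReal_delta_le_dimH (hV : Φ.Valid)
    (hGood : ∀ p : Φ.Symb → ℝ, IsProbVec p → Φ.GoodVec p) (c : Cycle Φ) :
    ENNReal.ofReal c.delta ≤ dimH Φ.limitSet := by
  obtain ⟨lo, hi, hb⟩ := hV.exists_lyapBounds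
  have hmeas := measurable_coding hV
  have key : ∀ ε > 0, ENNReal.ofReal (c.delta - ε) ≤ dimH Φ.limitSet := by
    intro ε hε
    obtain ⟨κ, hκ, hclose⟩ := hb.exists_deltaRB_close hε
    obtain ⟨K, hK, hceil⟩ := c.exists_close_ceil (half_pos hκ)
    set η := min (κ / 2) 1 with hη
    have hη0 : 0 < η := by positivity
    have hη1 : η ≤ 1 := min_le_right _ _
    set p : ℕ → Φ.Symb → ℝ := fun k => perturb η (c.r ((k + 1 : ℕ) : ℝ)) with hp_def
    have hrp : ∀ k : ℕ, IsProbVec (c.r ((k + 1 : ℕ) : ℝ)) := fun k =>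
      c.prob _ (by exact_mod_cast k.succ_pos)
    have hp : ∀ k, IsProbVec (p k) := fun k => isProbVec_perturb hV hη0.le hη1 (hrp k)
    have : Nonempty Φ.Symb := hV.1.to_subtype
    have hcard : (0 : ℝ) < Fintype.card Φ.Symb := by exact_mod_cast Fintype.card_pos
    have hae := le_lowerPtDim_prodMeasure hp hV hGood (η := η / Fintype.card Φ.Symb)
      (s := c.delta - ε) (by positivity) (fun k a => div_card_le_perturb hη1 (hrp k) a)
      fun ε' hε' => by
        filter_upwards [eventually_ge_atTop (max 1 ⌈K / κ⌉₊)] with n hn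
        have hn1 : 1 ≤ n := (le_max_left _ _).trans hn
        have hnK : K / κ ≤ n :=
          (Nat.le_ceil _).trans (by exact_mod_cast (le_max_right _ _).trans hn)
        rw [div_le_iff₀ hκ] at hnK
        have hn0 : (0 : ℝ) < n := by exact_mod_cast hn1
        have := hclose c.r (step p) c.isProfile (isProfile_step hp) n hn0 (Ioc 0 K)
          measurableSet_Ioc (by
            calc volume.real (Ioc 0 K ∩ Ioc 0 (n / lo)) ≤ volume.real (Ioc 0 K) :=
                  measureReal_mono inter_subset_left measure_Ioc_lt_top.ne
              _ = K := by simp [hK.le]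
              _ ≤ κ * n := by linarith) fun b hb0 _ hbS a => by
            have hbK : K ≤ b := by
              by_contra! hcon
              exact hbS ⟨hb0, hcon.le⟩
            have hs : step p b = perturb η (c.r (⌈b⌉₊ : ℕ)) := by
              rw [step, hp_def]
              simp only
              rw [Nat.sub_add_cancel (Nat.one_le_ceil_iff.2 hb0)]
            have h1 := hceil b hbK a
            have h2 := abs_sub_perturb_le hV hη0.le
              (c.prob (⌈b⌉₊ : ℕ) (hb0.trans_le (Nat.le_ceil b))) a
            rw [hs]
            refine (abs_sub_le _ (c.r (⌈b⌉₊ : ℕ) a) _).trans ?_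
            have : η ≤ κ / 2 := min_le_left _ _
            linarith
        have := c.delta_le hb hn0
        linarith
    have hfin : IsProbabilityMeasure ((prodMeasure p hp).map Φ.coding) :=
      Measure.isProbabilityMeasure_map hmeas.aemeasurable
    refine ENNReal.le_of_forall_nnreal_lt fun t ht => ?_
    set X := {ω : ℕ → Φ.Symb | ENNReal.ofReal (c.delta - ε) ≤
      lowerPtDim ((prodMeasure p hp).map Φ.coding) (Φ.coding ω)} with hX
    refine (le_dimH_of_lt_lowerPtDim (ν := (prodMeasure p hp).map Φ.coding) (Y := Φ.coding '' X)
      ?_ ?_).trans (dimH_mono (image_subset_range _ _))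
    · have h1 : prodMeasure p hp X = 1 := by
        rw [← measure_univ (μ := prodMeasure p hp)]
        exact measure_congr (eventuallyEq_univ.2 hae)
      have h2 := Measure.le_map_apply_image hmeas.aemeasurable (μ := prodMeasure p hp) X
      rw [h1] at h2
      exact (one_pos.trans_le h2).ne'
    · rintro _ ⟨ω, hω, rfl⟩
      exact ht.trans_le hω
  have hlim : Tendsto (fun m : ℕ => ENNReal.ofReal (c.delta - 1 / ((m : ℝ) + 1))) atTop
      (𝓝 (ENNReal.ofReal c.delta)) := by
    refine ENNReal.tendsto_ofReal ?_
    simpa using (tendsto_const_nhds (x := c.delta)).sub tendsto_one_div_add_atTop_nhds_zero_nat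
  exact le_of_tendsto' hlim fun m => key _ (by positivity)

theorem map_shift_prodMeasure_const {q : Φ.Symb → ℝ} (hq : IsProbVec q) :
    Measure.map shift (prodMeasure (fun _ => q) fun _ => hq) =
      prodMeasure (fun _ => q) fun _ => hq := by
  have := isProbabilityMeasure_vecMeasure hq
  have hshift : Measurable (shift : (ℕ → Φ.Symb) → ℕ → Φ.Symb) :=
    measurable_pi_lambda _ fun k => measurable_pi_apply (k + 1)
  refine Measure.eq_infinitePi (fun _ => vecMeasure q) fun s t ht => ?_
  rw [Measure.map_apply hshift (MeasurableSet.pi s.countable_toSet fun i _ => ht i)]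
  have h := prodMeasure_pi (fun _ => hq) (s.map ⟨Nat.succ, Nat.succ_injective⟩)
    fun k => t (k - 1)
  rw [Finset.prod_map] at h
  refine Eq.trans (congrArg _ ?_) h
  ext ω
  simp [shift, Set.mem_pi]

theorem ofReal_deltaP_le_dynDim (hV : Φ.Valid)
    (hGood : ∀ p : Φ.Symb → ℝ, IsProbVec p → Φ.GoodVec p) {p : Φ.Symb → ℝ} (hp : IsProbVec p) :
    ENNReal.ofReal (deltaP Φ p) ≤ Φ.dynDim := by
  obtain ⟨lo, hi, hb⟩ := hV.exists_lyapBounds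
  have hmeas := measurable_coding hV
  have key : ∀ ε > 0, ENNReal.ofReal (deltaP Φ p - ε) ≤ Φ.dynDim := by
    intro ε hε
    obtain ⟨κ, hκ, hclose⟩ := hb.exists_deltaRB_close hε
    set η := min κ 1 with hη
    have hη0 : 0 < η := by positivity
    have hη1 : η ≤ 1 := min_le_right _ _
    have hq := isProbVec_perturb hV hη0.le hη1 hp
    have : Nonempty Φ.Symb := hV.1.to_subtype
    have hcard : (0 : ℝ) < Fintype.card Φ.Symb := by exact_mod_cast Fintype.card_pos
    have hpq : deltaP Φ p ≤ deltaP Φ (perturb η p) + ε := by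
      rw [← deltaRB_const hb hp one_pos, ← deltaRB_const hb hq one_pos]
      exact hclose _ _ (isProfile_const hp) (isProfile_const hq) 1 one_pos ∅ MeasurableSet.empty
        (by simp [hκ.le]) fun b _ _ _ a =>
          (abs_sub_perturb_le hV hη0.le hp a).trans (min_le_left _ _)
    have hae := le_lowerPtDim_prodMeasure (fun _ => hq) hV hGood (η := η / Fintype.card Φ.Symb)
      (s := deltaP Φ p - ε) (by positivity) (fun _ a => div_card_le_perturb hη1 hp a)
      fun ε' hε' => by
        filter_upwards [eventually_gt_atTop 0] with n hn
        have : deltaRB Φ (step fun _ => perturb η p) n = deltaP Φ (perturb η p) :=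
          deltaRB_const hb hq (by exact_mod_cast hn)
        rw [this]
        linarith
    refine le_trans ?_ (le_sSup (a := measDim ((prodMeasure _ fun _ => hq).map Φ.coding))
      ⟨prodMeasure _ fun _ => hq, inferInstance, map_shift_prodMeasure_const hq, rfl⟩)
    rw [measDim, essSup_eq_sInf]
    refine le_sInf fun t ht => ?_
    have h1 : ∀ᵐ x ∂(prodMeasure _ fun _ => hq).map Φ.coding,
        lowerPtDim ((prodMeasure _ fun _ => hq).map Φ.coding) x ≤ t := by
      rw [ae_iff]
      simp only [not_le]
      exact ht
    obtain ⟨ω, h2, h3⟩ := (hae.and (ae_of_ae_map hmeas.aemeasurable h1)).exists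
    exact h2.trans h3
  have hlim : Tendsto (fun m : ℕ => ENNReal.ofReal (deltaP Φ p - 1 / ((m : ℝ) + 1))) atTop
      (𝓝 (ENNReal.ofReal (deltaP Φ p))) := by
    refine ENNReal.tendsto_ofReal ?_
    simpa using (tendsto_const_nhds (x := deltaP Φ p)).sub
      tendsto_one_div_add_atTop_nhds_zero_nat
  exact le_of_tendsto' hlim fun m => key _ (by positivity)

end Perturbation

section Covering

variable {X : Type*} [EMetricSpace X] [MeasurableSpace X] [BorelSpace X]

theorem dimH_le_of_frequently_mem {Z : Set X} {N : ℕ → ℕ} {U : ∀ n, Fin (N n) → Set X} {s : ℝ≥0}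
    (hU : ∀ n j, ediam (U n j) ≤ ENNReal.ofReal (Real.exp (-n)))
    (hZ : ∀ x ∈ Z, ∃ᶠ n in atTop, ∃ j, x ∈ U n j)
    (hsum : Summable fun n => (N n : ℝ) * Real.exp (-(s * n))) : dimH Z ≤ s := by
  refine dimH_le_of_hausdorffMeasure_ne_top (ne_of_lt ?_)
  have hterm : ∀ n, ∑ j, ediam (U n j) ^ (s : ℝ) ≤
      ENNReal.ofReal ((N n : ℝ) * Real.exp (-(s * n))) := fun n => by
    calc ∑ j, ediam (U n j) ^ (s : ℝ)
        ≤ ∑ _j : Fin (N n), ENNReal.ofReal (Real.exp (-(s * n))) := by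
          refine Finset.sum_le_sum fun j _ => ?_
          refine (ENNReal.rpow_le_rpow (hU n j) s.coe_nonneg).trans ?_
          rw [ENNReal.ofReal_rpow_of_pos (Real.exp_pos _), ← Real.exp_mul]
          exact ENNReal.ofReal_le_ofReal (le_of_eq (by ring_nf))
      _ = _ := by
          rw [Finset.sum_const, Finset.card_univ, Fintype.card_fin, nsmul_eq_mul,
            ENNReal.ofReal_mul (Nat.cast_nonneg _), ENNReal.ofReal_natCast]
  have hfin : ∑' n, ENNReal.ofReal ((N n : ℝ) * Real.exp (-(s * n))) < ⊤ :=
    hsum.tsum_ofReal_lt_top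
  have hr : Tendsto (fun n : ℕ => ENNReal.ofReal (Real.exp (-n))) atTop (𝓝 0) := by
    rw [← ENNReal.ofReal_zero]
    exact ENNReal.tendsto_ofReal (Real.tendsto_exp_neg_atTop_nhds_zero.comp
      tendsto_natCast_atTop_atTop)
  have := Measure.hausdorffMeasure_le_liminf_tsum (ι := fun n : ℕ => Σ m : ℕ, Fin (N (m + n)))
    (s : ℝ) Z (fun n : ℕ => ENNReal.ofReal (Real.exp (-n))) hr (fun n p => U (p.1 + n) p.2)
    (Eventually.of_forall fun n p => (hU _ _).trans (ENNReal.ofReal_le_ofReal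
      (Real.exp_le_exp.2 (by push_cast; linarith [Nat.cast_nonneg (α := ℝ) p.1]))))
    (Eventually.of_forall fun n x hx => by
      obtain ⟨m, ⟨j, hj⟩, hm⟩ := ((hZ x hx).and_eventually (eventually_ge_atTop n)).exists
      obtain ⟨k, rfl⟩ := Nat.exists_eq_add_of_le' hm
      exact mem_iUnion.2 ⟨⟨k, j⟩, hj⟩)
  refine (this.trans (liminf_le_of_frequently_le' (Frequently.of_forall fun n => ?_))).trans_lt hfin
  rw [ENNReal.tsum_sigma fun m (j : Fin (N (m + n))) => ediam (U (m + n) j) ^ (s : ℝ)]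
  simp only [tsum_fintype]
  refine (ENNReal.tsum_le_tsum fun m => hterm _).trans ?_
  exact ENNReal.tsum_comp_le_tsum_of_injective (add_left_injective n)
    fun k => ENNReal.ofReal ((N k : ℝ) * Real.exp (-(s * k)))

theorem dimH_le_of_eventually_cover {Z : Set X} {Y : ℕ → Set X} {σ : ℝ} (hσ : 0 ≤ σ)
    (hY : ∀ x ∈ Z, ∃ᶠ n in atTop, x ∈ Y n)
    (hcov : ∀ᶠ n : ℕ in atTop, ∃ m : ℕ, ∃ U : Fin m → Set X, (m : ℝ) ≤ Real.exp (σ * n) ∧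
      Y n ⊆ ⋃ j, U j ∧ ∀ j, ediam (U j) ≤ ENNReal.ofReal (Real.exp (-n))) :
    dimH Z ≤ ENNReal.ofReal σ := by
  have hcov' : ∀ n : ℕ, ∃ m : ℕ, ∃ U : Fin m → Set X, (m : ℝ) ≤ Real.exp (σ * n) ∧
      ((∃ m : ℕ, ∃ U : Fin m → Set X, (m : ℝ) ≤ Real.exp (σ * n) ∧
      Y n ⊆ ⋃ j, U j ∧ ∀ j, ediam (U j) ≤ ENNReal.ofReal (Real.exp (-n))) → Y n ⊆ ⋃ j, U j) ∧
      ∀ j, ediam (U j) ≤ ENNReal.ofReal (Real.exp (-n)) := fun n => by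
    by_cases h : ∃ m : ℕ, ∃ U : Fin m → Set X, (m : ℝ) ≤ Real.exp (σ * n) ∧
      Y n ⊆ ⋃ j, U j ∧ ∀ j, ediam (U j) ≤ ENNReal.ofReal (Real.exp (-n))
    · obtain ⟨m, U, h1, h2, h3⟩ := h
      exact ⟨m, U, h1, fun _ => h2, h3⟩
    · exact ⟨0, Fin.elim0, by simpa using (Real.exp_pos _).le, fun h' => absurd h' h,
        fun j => j.elim0⟩
  choose N U h1 h2 h3 using hcov'
  have key : ∀ s : ℝ≥0, σ < s → dimH Z ≤ s := fun s hs => by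
    refine dimH_le_of_frequently_mem h3 (fun x hx => ?_) ?_
    · refine ((hY x hx).and_eventually hcov).mono fun n hn => ?_
      exact mem_iUnion.1 (h2 n hn.2 hn.1)
    · refine Summable.of_nonneg_of_le (fun n => by positivity) (fun n => ?_)
        (summable_geometric_of_lt_one (Real.exp_pos (σ - s)).le
          (Real.exp_lt_one_iff.2 (sub_neg.2 hs)))
      calc (N n : ℝ) * Real.exp (-(s * n)) ≤ Real.exp (σ * n) * Real.exp (-(s * n)) :=
            mul_le_mul_of_nonneg_right (h1 n) (Real.exp_pos _).le
        _ = Real.exp (σ - s) ^ n := by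
            rw [← Real.exp_add, ← Real.exp_nat_mul]
            ring_nf
  refine le_of_forall_gt_imp_ge_of_dense fun t ht => ?_
  obtain ⟨s, hs1, hs2⟩ := ENNReal.lt_iff_exists_nnreal_btwn.1 ht
  refine (key s ?_).trans hs2.le
  rwa [ENNReal.ofReal_lt_coe_iff hσ] at hs1

end Covering

section Window

variable {T : ℕ → ℕ}

/-- the index `w` of the window `[T w, T (w + 1))` containing `k` -/
def win (T : ℕ → ℕ) (k : ℕ) : ℕ := Nat.findGreatest (fun w => T w ≤ k) k

theorem win_le (h0 : T 0 = 0) (k : ℕ) : T (win T k) ≤ k :=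
  Nat.findGreatest_spec (P := fun w => T w ≤ k) (Nat.zero_le k) (by simp [h0])

theorem win_lt_iff (hT : StrictMono T) (h0 : T 0 = 0) {k w : ℕ} : win T k < w ↔ k < T w := by
  constructor
  · intro h
    by_contra! hk
    exact Nat.findGreatest_is_greatest h ((hT.le_apply).trans hk) hk
  · exact fun h => hT.lt_iff_lt.1 ((win_le h0 k).trans_lt h)

theorem win_eq (hT : StrictMono T) (h0 : T 0 = 0) {k w : ℕ} (h1 : T w ≤ k) (h2 : k < T (w + 1)) :
    win T k = w :=
  le_antisymm (Nat.lt_succ_iff.1 ((win_lt_iff hT h0).2 h2))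
    (not_lt.1 fun h => absurd ((win_lt_iff hT h0).1 h) (not_lt.2 h1))

variable {Φ : DiagIFS d A}

/-- the empirical frequencies of the symbols of `ω` on the window `[T w, T (w + 1))` -/
noncomputable def freq (T : ℕ → ℕ) (ω : ℕ → Φ.Symb) (w : ℕ) (a : Φ.Symb) : ℝ :=
  ((Finset.Ico (T w) (T (w + 1))).filter fun k => ω k = a).card / ((T (w + 1) : ℝ) - T w)

/-- the sequence of vectors equal to the empirical frequencies on each window -/
noncomputable def empFreq (T : ℕ → ℕ) (ω : ℕ → Φ.Symb) (k : ℕ) : Φ.Symb → ℝ :=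
  freq T ω (win T k)

theorem window_pos (hT : StrictMono T) (w : ℕ) : (0 : ℝ) < (T (w + 1) : ℝ) - T w :=
  sub_pos.2 (by exact_mod_cast hT w.lt_succ_self)

theorem mul_sum_freq (hT : StrictMono T) (ω : ℕ → Φ.Symb) (w : ℕ) (g : Φ.Symb → ℝ) :
    ((T (w + 1) : ℝ) - T w) * ∑ a, freq T ω w a * g a =
      ∑ k ∈ Finset.Ico (T w) (T (w + 1)), g (ω k) := by
  rw [Finset.mul_sum, ← Finset.sum_fiberwise (Finset.Ico (T w) (T (w + 1))) ω]
  refine Finset.sum_congr rfl fun a _ => ?_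
  rw [freq, ← mul_assoc, mul_div_cancel₀ _ (window_pos hT w).ne', ← nsmul_eq_mul,
    ← Finset.sum_const]
  exact Finset.sum_congr rfl fun k hk => by rw [(Finset.mem_filter.1 hk).2]

theorem isProbVec_freq (hT : StrictMono T) (ω : ℕ → Φ.Symb) (w : ℕ) :
    IsProbVec (freq T ω w) := by
  refine ⟨fun a => div_nonneg (Nat.cast_nonneg _) (window_pos hT w).le, ?_⟩
  have h := mul_sum_freq hT ω w fun _ => 1
  simp only [mul_one, Finset.sum_const, Nat.card_Ico, nsmul_eq_mul] at h
  rw [Nat.cast_sub (hT w.lt_succ_self).le] at h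
  exact mul_left_cancel₀ (window_pos hT w).ne' (h.trans (mul_one _).symm)

theorem isProbVec_empFreq (hT : StrictMono T) (ω : ℕ → Φ.Symb) (k : ℕ) :
    IsProbVec (empFreq T ω k) :=
  isProbVec_freq hT ω _

theorem sum_empFreq (hT : StrictMono T) (h0 : T 0 = 0) (ω : ℕ → Φ.Symb) (V : ℕ)
    (g : ℕ → Φ.Symb → ℝ) :
    ∑ k ∈ Finset.range (T V), g (win T k) (ω k) =
      ∑ k ∈ Finset.range (T V), ∑ a, empFreq T ω k a * g (win T k) a := by
  induction V with
  | zero => simp [h0]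
  | succ V ih =>
    have hle : T V ≤ T (V + 1) := (hT V.lt_succ_self).le
    rw [← Finset.sum_range_add_sum_Ico _ hle, ← Finset.sum_range_add_sum_Ico _ hle, ih]
    congr 1
    have hw : ∀ k ∈ Finset.Ico (T V) (T (V + 1)), win T k = V := fun k hk =>
      win_eq hT h0 (Finset.mem_Ico.1 hk).1 (Finset.mem_Ico.1 hk).2
    have h1 : ∑ k ∈ Finset.Ico (T V) (T (V + 1)), g (win T k) (ω k) =
        ∑ k ∈ Finset.Ico (T V) (T (V + 1)), g V (ω k) :=
      Finset.sum_congr rfl fun k hk => by rw [hw k hk]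
    have h2 : ∑ k ∈ Finset.Ico (T V) (T (V + 1)), ∑ a, empFreq T ω k a * g (win T k) a =
        ∑ k ∈ Finset.Ico (T V) (T (V + 1)), ∑ a, freq T ω V a * g V a :=
      Finset.sum_congr rfl fun k hk => by rw [empFreq, hw k hk]
    rw [h1, h2, ← mul_sum_freq hT, Finset.sum_const, Nat.card_Ico, nsmul_eq_mul,
      Nat.cast_sub hle]

theorem empFreq_pos (hT : StrictMono T) (h0 : T 0 = 0) (ω : ℕ → Φ.Symb) (k : ℕ) :
    0 < empFreq T ω k (ω k) := by
  refine div_pos (Nat.cast_pos.2 (Finset.card_pos.2 ⟨k, ?_⟩)) (window_pos hT _)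
  exact Finset.mem_filter.2 ⟨Finset.mem_Ico.2 ⟨win_le h0 k,
    (win_lt_iff hT h0).1 (Nat.lt_succ_self _)⟩, rfl⟩

theorem ncard_words_le {p : ℕ → Φ.Symb → ℝ} (hp : ∀ k, IsProbVec (p k))
    (I : ℕ → Finset (Fin d)) (L : ℕ) {G : ℝ} {S : Set (ℕ → Φ.Symb)}
    (h : ∀ ω ∈ S, Real.exp (-G) ≤ ∏ k ∈ Finset.range L, Φ.cylMass (I k) (p k) (ω k)) :
    (((fun (ω : ℕ → Φ.Symb) (k : Fin L) => Φ.proj (I k) (ω k)) '' S).ncard : ℝ) ≤ Real.exp G := by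
  set F := ((fun (ω : ℕ → Φ.Symb) (k : Fin L) => Φ.proj (I k) (ω k)) '' S).toFinset with hF
  have h1 : (F.card : ℝ) * Real.exp (-G) ≤ 1 := by
    calc (F.card : ℝ) * Real.exp (-G) = ∑ _c ∈ F, Real.exp (-G) := by simp
      _ ≤ ∑ c ∈ F, ∏ k : Fin L, Φ.projMass (I k) (p k) (c k) := by
          refine Finset.sum_le_sum fun c hc => ?_
          obtain ⟨ω, hω, rfl⟩ := mem_toFinset.1 hc
          refine (h ω hω).trans (le_of_eq ?_)
          rw [← Fin.prod_univ_eq_prod_range fun k => Φ.cylMass (I k) (p k) (ω k)]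
          simp only [DiagIFS.cylMass_eq]
      _ ≤ ∑ c : Fin L → ∀ i, Option (A i), ∏ k : Fin L, Φ.projMass (I k) (p k) (c k) :=
          Finset.sum_le_univ_sum_of_nonneg fun c =>
            Finset.prod_nonneg fun k _ => Φ.projMass_nonneg _ (hp k) _
      _ = ∏ k : Fin L, ∑ c, Φ.projMass (I k) (p k) c := by
          rw [Finset.prod_univ_sum, Fintype.piFinset_univ]
      _ = 1 := Finset.prod_eq_one fun k _ => Φ.sum_projMass _ (hp k)
  rw [Set.ncard_eq_toFinset_card']
  rwa [Real.exp_neg, ← div_eq_mul_inv, div_le_one (Real.exp_pos _)] at h1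

end Window

section Counting

theorem ncard_image_prodMk_le {Ω K W : Type*} [Fintype K] [Finite W] (key : Ω → K)
    (word : Ω → W) (Y : Set Ω) {C : ℝ}
    (h : ∀ κ, ((word '' {ω ∈ Y | key ω = κ}).ncard : ℝ) ≤ C) :
    (((fun ω => (key ω, word ω)) '' Y).ncard : ℝ) ≤ Fintype.card K * C := by
  have := Fintype.ofFinite W
  set F := ((fun ω => (key ω, word ω)) '' Y).toFinset with hF
  rw [Set.ncard_eq_toFinset_card', ← hF,
    Finset.card_eq_sum_card_fiberwise (f := Prod.fst) (t := Finset.univ) (by simp), Nat.cast_sum]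
  refine (Finset.sum_le_card_nsmul _ _ C fun κ _ => ?_).trans_eq (by simp)
  refine le_trans ?_ (h κ)
  rw [Set.ncard_eq_toFinset_card', Nat.cast_le]
  refine Finset.card_le_card_of_injOn Prod.snd ?_ ?_
  · intro x hx
    simp only [hF, Finset.coe_filter, mem_ofPred_eq, mem_toFinset] at hx
    obtain ⟨⟨ω, hω, rfl⟩, hκ⟩ := hx
    simp only [Finset.mem_coe, mem_toFinset]
    exact ⟨ω, ⟨hω, hκ⟩, rfl⟩
  · intro x hx y hy hxy
    simp only [Finset.coe_filter, mem_ofPred_eq] at hx hy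
    exact Prod.ext (hx.2.trans hy.2.symm) hxy

variable {Φ : DiagIFS d A} {lo hi : ℝ} {T : ℕ → ℕ}

/-- the index of the first window endpoint beyond the threshold of coordinate `i` -/
noncomputable def thr (T : ℕ → ℕ) (ω : ℕ → Φ.Symb) (n : ℕ) (i : Fin d) : ℕ :=
  sInf {w : ℕ | Bcoord Φ (step (empFreq T ω)) n i ≤ T w}

theorem thr_spec (hb : Φ.LyapBounds lo hi) (hT : StrictMono T) (h0 : T 0 = 0)
    (ω : ℕ → Φ.Symb) {n V : ℕ} (hVn : n / lo ≤ T V) {g : ℝ} (hg : 0 ≤ g)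
    (hgap : ∀ w, (T w : ℝ) ≤ n / lo → (T (w + 1) : ℝ) - T w ≤ g) (i : Fin d) :
    Bcoord Φ (step (empFreq T ω)) n i ≤ T (thr T ω n i) ∧
      (T (thr T ω n i) : ℝ) - Bcoord Φ (step (empFreq T ω)) n i ≤ g ∧ thr T ω n i ≤ V := by
  have hr := isProfile_step (isProbVec_empFreq hT ω)
  have hle := hr.Bcoord_le hb i n.cast_nonneg
  have hmem : V ∈ {w : ℕ | Bcoord Φ (step (empFreq T ω)) n i ≤ T w} := hle.trans hVn
  refine ⟨Nat.sInf_mem ⟨V, hmem⟩, ?_, Nat.sInf_le hmem⟩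
  have hpos := (hr.Bcoord_spec hb i n.cast_nonneg).1
  rcases Nat.eq_zero_or_pos (thr T ω n i) with h | h
  · rw [h, h0]
    push_cast
    linarith
  · obtain ⟨w, hw⟩ := Nat.exists_eq_succ_of_ne_zero h.ne'
    have h1 : w ∉ {w : ℕ | Bcoord Φ (step (empFreq T ω)) n i ≤ T w} :=
      Nat.notMem_of_lt_sInf (show w < thr T ω n i by omega)
    have h2 : (T w : ℝ) < Bcoord Φ (step (empFreq T ω)) n i := not_le.1 h1
    have h3 := hgap w (h2.le.trans hle)
    rw [hw, Nat.succ_eq_add_one]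
    linarith

theorem le_sum_lyap_thr (hb : Φ.LyapBounds lo hi) (hT : StrictMono T) (h0 : T 0 = 0)
    (ω : ℕ → Φ.Symb) {n : ℕ} {i : Fin d}
    (h : Bcoord Φ (step (empFreq T ω)) n i ≤ T (thr T ω n i)) :
    (n : ℝ) ≤ ∑ k ∈ Finset.range (T (thr T ω n i)), Φ.lyap i (ω k) := by
  have hr := isProfile_step (isProbVec_empFreq hT ω)
  have h1 := hr.Bcoord_spec hb i n.cast_nonneg
  have h2 := (hr.chiInt_sub hb i h1.1 h).1
  rw [h1.2, chiInt_step] at h2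
  rw [sum_empFreq hT h0 ω _ fun _ => Φ.lyap i]
  simp only [DiagIFS.chi_eq_sum] at h2
  have := mul_nonneg hb.lo_pos.le (sub_nonneg.2 h)
  linarith

theorem abs_coding_sub_le_of_agree (hV : Φ.Valid) {i : Fin d} {n N : ℕ} {ω ω' : ℕ → Φ.Symb}
    (h : ∀ k < N, (ω k).1 i = (ω' k).1 i)
    (hN : (n : ℝ) ≤ ∑ k ∈ Finset.range N, Φ.lyap i (ω k)) :
    |Φ.coding ω i - Φ.coding ω' i| ≤ Real.exp (-n) := by
  rw [coding_sub_of_agree hV i N ω ω' h, abs_mul, abs_prod_slope hV]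
  have h1 := coding_mem_Icc hV i (shift^[N] ω)
  have h2 := coding_mem_Icc hV i (shift^[N] ω')
  have h3 : |Φ.coding (shift^[N] ω) i - Φ.coding (shift^[N] ω') i| ≤ 1 :=
    abs_le.2 ⟨by linarith [h1.1, h2.2], by linarith [h1.2, h2.1]⟩
  exact (mul_le_of_le_one_right (Real.exp_pos _).le h3).trans (Real.exp_le_exp.2 (neg_le_neg hN))

theorem exp_le_prod_cylMass (hb : Φ.LyapBounds lo hi) (hT : StrictMono T) (h0 : T 0 = 0) {H : ℝ}
    (hH : ∀ I (p : Φ.Symb → ℝ), IsProbVec p → Φ.entropy I p ≤ H) (hH0 : 0 ≤ H)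
    (ω : ℕ → Φ.Symb) {n V : ℕ} (hn : 0 < n) (hVn : n / lo ≤ T V) {g s : ℝ} (hg : 0 ≤ g)
    (hgap : ∀ w, (T w : ℝ) ≤ n / lo → (T (w + 1) : ℝ) - T w ≤ g)
    (hs : deltaRB Φ (step (empFreq T ω)) n ≤ s) :
    Real.exp (-(n * s + H * (d * g))) ≤ ∏ k ∈ Finset.range (T V),
      Φ.cylMass (Finset.univ.filter fun i => k < T (thr T ω n i)) (empFreq T ω k) (ω k) := by
  have hp := isProbVec_empFreq hT ω
  have hr := isProfile_step hp
  have hthr := thr_spec hb hT h0 ω hVn hg hgap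
  set I : ℕ → Finset (Fin d) := fun k => Finset.univ.filter fun i => k < T (thr T ω n i) with hI
  set J : ℕ → Finset (Fin d) := fun w => Finset.univ.filter fun i => w < thr T ω n i with hJ
  have hIJ : ∀ k, I k = J (win T k) := fun k => by
    simp only [hI, hJ, win_lt_iff hT h0]
  have hpos : ∀ k, 0 < Φ.cylMass (I k) (empFreq T ω k) (ω k) := fun k =>
    (empFreq_pos hT h0 ω k).trans_le (Φ.le_cylMass _ (hp k) _)
  rw [← Real.exp_log (Finset.prod_pos fun k _ => hpos k), Real.exp_le_exp,
    Real.log_prod fun k _ => (hpos k).ne']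
  have h1 : ∑ k ∈ Finset.range (T V), Real.log (Φ.cylMass (I k) (empFreq T ω k) (ω k)) =
      -∑ k ∈ Finset.range (T V), Φ.entropy (I k) (empFreq T ω k) := by
    have := sum_empFreq hT h0 ω V fun w a => Real.log (Φ.cylMass (J w) (freq T ω w) a)
    simp only [← hIJ] at this
    rw [← Finset.sum_neg_distrib]
    refine this.trans (Finset.sum_congr rfl fun k _ => ?_)
    rw [DiagIFS.entropy, neg_neg]
    rfl
  have h2 := thrInt_step hp (N := fun i => T (thr T ω n i)) (L := T V)
    fun i => hT.monotone (hthr i).2.2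
  have h3 := hr.thrInt_le hr (D := fun i => (T (thr T ω n i) : ℝ))
    (D' := Bcoord Φ (step (empFreq T ω)) n) (M := T V) (ε := 0) (H := H) (S := ∅) hH hH0
    (fun i => by exact_mod_cast hT.monotone (hthr i).2.2)
    (fun i => (hr.Bcoord_le hb i n.cast_nonneg).trans hVn) (Nat.cast_nonneg _) le_rfl
    MeasurableSet.empty (by simp)
  have h4 : ∑ i, |(T (thr T ω n i) : ℝ) - Bcoord Φ (step (empFreq T ω)) n i| ≤ d * g := by
    refine (Finset.sum_le_card_nsmul _ _ g fun i _ => ?_).trans_eq (by simp)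
    rw [abs_of_nonneg (sub_nonneg.2 (hthr i).1)]
    exact (hthr i).2.1
  have hn0 : (0 : ℝ) < n := by exact_mod_cast hn
  have h5 : ∫ b in Ioi (0 : ℝ), thrFun Φ (step (empFreq T ω))
      (Bcoord Φ (step (empFreq T ω)) n) b ≤ n * s := by
    rw [deltaRB_eq, inv_mul_le_iff₀ hn0] at hs
    exact hs
  have h6 := mul_le_mul_of_nonneg_left h4 hH0
  simp only [zero_mul, empty_inter, measureReal_empty, mul_zero, add_zero] at h3
  rw [h1, neg_le_neg_iff, ← h2]
  linarith

theorem exists_cover_of_deltaRB_le (hV : Φ.Valid) (hb : Φ.LyapBounds lo hi) (hT : StrictMono T)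
    (h0 : T 0 = 0) {H : ℝ}
    (hH : ∀ I (p : Φ.Symb → ℝ), IsProbVec p → Φ.entropy I p ≤ H) (hH0 : 0 ≤ H)
    {n V : ℕ} (hn : 0 < n) (hVn : n / lo ≤ T V) {g s : ℝ} (hg : 0 ≤ g)
    (hgap : ∀ w, (T w : ℝ) ≤ n / lo → (T (w + 1) : ℝ) - T w ≤ g) :
    ∃ m : ℕ, ∃ U : Fin m → Set (Fin d → ℝ),
      (m : ℝ) ≤ ((T V : ℝ) + 1) ^ (Fintype.card Φ.Symb * V + d) *
        Real.exp (n * s + H * (d * g)) ∧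
      Φ.coding '' {ω | deltaRB Φ (step (empFreq T ω)) n ≤ s} ⊆ ⋃ j, U j ∧
      ∀ j, ediam (U j) ≤ ENNReal.ofReal (Real.exp (-n)) := by
  set Y := {ω : ℕ → Φ.Symb | deltaRB Φ (step (empFreq T ω)) n ≤ s} with hY
  set cnt : (ℕ → Φ.Symb) → ℕ → Φ.Symb → ℕ := fun ω w a =>
    ((Finset.Ico (T w) (T (w + 1))).filter fun k => ω k = a).card with hcnt
  have hcnt_le : ∀ ω, ∀ w < V, ∀ a, cnt ω w a < T V + 1 := fun ω w hw a => by
    have h1 := Finset.card_filter_le (Finset.Ico (T w) (T (w + 1))) fun k => ω k = a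
    rw [Nat.card_Ico] at h1
    have h2 := hT.monotone (Nat.succ_le_of_lt hw)
    simp only [hcnt, Nat.succ_eq_add_one] at h2 ⊢
    omega
  have hthr := fun ω => thr_spec hb hT h0 ω hVn hg hgap
  have hthr_le : ∀ ω i, thr T ω n i < T V + 1 := fun ω i =>
    Nat.lt_succ_of_le ((hthr ω i).2.2.trans hT.le_apply)
  set key : (ℕ → Φ.Symb) → (Fin V → Φ.Symb → Fin (T V + 1)) × (Fin d → Fin (T V + 1)) :=
    fun ω => (fun w a => ⟨cnt ω w a, hcnt_le ω w w.2 a⟩, fun i => ⟨thr T ω n i, hthr_le ω i⟩)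
    with hkey
  set word : (ℕ → Φ.Symb) → Fin (T V) → ∀ i, Option (A i) := fun ω k =>
    Φ.proj (Finset.univ.filter fun i => (k : ℕ) < T (thr T ω n i)) (ω k) with hword
  have hkey_thr : ∀ ω ω', key ω = key ω' → thr T ω n = thr T ω' n := fun ω ω' h => by
    have := congrArg Prod.snd h
    funext i
    simpa [hkey] using congrFun this i
  have hkey_freq : ∀ ω ω', key ω = key ω' → ∀ k < T V, empFreq T ω k = empFreq T ω' k :=
    fun ω ω' h k hk => by
      have := congrArg Prod.fst h
      have hw : win T k < V := (win_lt_iff hT h0).2 hk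
      funext a
      have h1 : cnt ω (win T k) a = cnt ω' (win T k) a := by
        simpa [hkey] using congrFun (congrFun this ⟨win T k, hw⟩) a
      simp only [empFreq, freq]
      simp only [hcnt] at h1
      rw [h1]
  have hcard := ncard_image_prodMk_le key word Y (C := Real.exp (n * s + H * (d * g)))
    fun κ => by
      by_cases hne : ∃ ω₀ ∈ Y, key ω₀ = κ
      · obtain ⟨ω₀, hω₀, rfl⟩ := hne
        have h1 := ncard_words_le (isProbVec_empFreq hT ω₀)
          (fun k => Finset.univ.filter fun i => k < T (thr T ω₀ n i)) (T V)
          (G := n * s + H * (d * g)) (S := {ω ∈ Y | key ω = key ω₀}) fun ω hω => by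
            refine (exp_le_prod_cylMass hb hT h0 hH hH0 ω hn hVn hg hgap hω.1).trans_eq ?_
            refine Finset.prod_congr rfl fun k hk => ?_
            rw [hkey_thr _ _ hω.2, hkey_freq _ _ hω.2 k (Finset.mem_range.1 hk)]
        rwa [image_congr fun ω (hω : ω ∈ {ω ∈ Y | key ω = key ω₀}) =>
          show word ω = fun k : Fin (T V) =>
            Φ.proj (Finset.univ.filter fun i => (k : ℕ) < T (thr T ω₀ n i)) (ω k) by
          simp only [hword, hkey_thr _ _ hω.2]]
      · have : {ω ∈ Y | key ω = κ} = ∅ := by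
          ext ω
          simp only [mem_ofPred_eq, mem_empty_iff_false, iff_false]
          exact fun h => hne ⟨ω, h⟩
        rw [this, image_empty, ncard_empty, Nat.cast_zero]
        exact (Real.exp_pos _).le
  set G := (fun ω => (key ω, word ω)) '' Y with hG
  have hGf : G.Finite := toFinite G
  have e : Fin G.ncard ≃ G := (Finite.equivFinOfCardEq rfl).symm
  refine ⟨G.ncard, fun j => Φ.coding '' {ω ∈ Y | (key ω, word ω) = (e j).1}, ?_, ?_, ?_⟩
  · refine hcard.trans_eq ?_
    congr 1
    simp only [Fintype.card_prod, Fintype.card_pi, Fintype.card_fin, Finset.prod_const,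
      Finset.card_univ, ← pow_mul]
    push_cast
    rw [pow_add]
  · rintro _ ⟨ω, hω, rfl⟩
    refine mem_iUnion.2 ⟨e.symm ⟨_, ω, hω, rfl⟩, ω, ⟨hω, ?_⟩, rfl⟩
    rw [Equiv.apply_symm_apply]
  · intro j
    refine ediam_le ?_
    rintro _ ⟨ω, ⟨hω, h1⟩, rfl⟩ _ ⟨ω', ⟨hω', h2⟩, rfl⟩
    obtain ⟨h3, h4⟩ := Prod.mk.inj (h1.trans h2.symm)
    rw [edist_dist]
    refine ENNReal.ofReal_le_ofReal ((dist_pi_le_iff (Real.exp_pos _).le).2 fun i => ?_)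
    rw [Real.dist_eq]
    refine abs_coding_sub_le_of_agree hV (N := T (thr T ω n i)) (fun k hk => ?_)
      (le_sum_lyap_thr hb hT h0 ω (hthr ω i).1)
    have hkV : k < T V := hk.trans_le (hT.monotone (hthr ω i).2.2)
    have h5 := congrFun h4 ⟨k, hkV⟩
    simp only [hword, hkey_thr _ _ h3] at h5
    rw [DiagIFS.proj_eq_iff] at h5
    exact h5 i (Finset.mem_filter.2 ⟨Finset.mem_univ _, by rw [← hkey_thr _ _ h3]; exact hk⟩)

end Counting

section DyadicWindows

/-- window endpoints that are linearly spaced between consecutive dyadic multiples of `M` -/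
def dyWin (M : ℕ) : ℕ → ℕ
  | 0 => 0
  | w + 1 => 2 ^ (w / M) * (M + w % M)

theorem dyWin_zero (M : ℕ) : dyWin M 0 = 0 := rfl

theorem dyWin_succ (M w : ℕ) : dyWin M (w + 1) = 2 ^ (w / M) * (M + w % M) := rfl

theorem dyWin_add_two {M : ℕ} (hM : 0 < M) (w : ℕ) :
    dyWin M (w + 2) = dyWin M (w + 1) + 2 ^ (w / M) := by
  rw [show w + 2 = w + 1 + 1 from rfl, dyWin_succ, dyWin_succ]
  by_cases h : w % M + 1 = M
  · have hw : w + 1 = M * (w / M + 1) := by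
      rw [mul_add, mul_one]
      conv_rhs => rw [← h]
      have := Nat.div_add_mod w M
      rw [h]
      omega
    have h1 : (w + 1) / M = w / M + 1 := by rw [hw, Nat.mul_div_cancel_left _ hM]
    have h2 : (w + 1) % M = 0 := by rw [hw, Nat.mul_mod_right]
    rw [h1, h2, pow_succ, add_zero, mul_assoc, ← mul_add_one]
    congr 1
    omega
  · have hlt : w % M + 1 < M := lt_of_le_of_ne (Nat.mod_lt _ hM) h
    have hw : w + 1 = w % M + 1 + M * (w / M) := by
      have := Nat.div_add_mod w M
      omega
    have h1 : (w + 1) / M = w / M := by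
      rw [hw, Nat.add_mul_div_left _ _ hM, Nat.div_eq_of_lt hlt, zero_add]
    have h2 : (w + 1) % M = w % M + 1 := by
      rw [hw, Nat.add_mul_mod_self_left, Nat.mod_eq_of_lt hlt]
    rw [h1, h2, ← add_assoc, mul_add_one]

theorem dyWin_strictMono {M : ℕ} (hM : 0 < M) : StrictMono (dyWin M) := by
  refine strictMono_nat_of_lt_succ fun w => ?_
  rcases w with _ | w
  · simpa [dyWin] using hM
  · rw [dyWin_add_two hM]
    exact Nat.lt_add_of_pos_right (by positivity)

theorem dyWin_add {M : ℕ} (hM : 0 < M) (w k : ℕ) :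
    dyWin M (w + 1 + k * M) = 2 ^ k * dyWin M (w + 1) := by
  rw [show w + 1 + k * M = w + k * M + 1 by ring, dyWin_succ, dyWin_succ,
    Nat.add_mul_div_right _ _ hM, Nat.add_mul_mod_self_right, pow_add, mul_comm (2 ^ (w / M)),
    mul_assoc]

theorem dyWin_mul_add_one {M : ℕ} (hM : 0 < M) (k : ℕ) : dyWin M (k * M + 1) = 2 ^ k * M := by
  have := dyWin_add hM 0 k
  rw [show 0 + 1 + k * M = k * M + 1 by ring] at this
  rw [this]
  simp [dyWin]

theorem dyWin_gap {M : ℕ} (hM : 0 < M) (w : ℕ) :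
    (dyWin M (w + 1) : ℝ) - dyWin M w ≤ M + (dyWin M w : ℝ) / M := by
  have hM0 : (0 : ℝ) < M := by exact_mod_cast hM
  rcases w with _ | w
  · simp [dyWin]
  · rw [dyWin_add_two hM, dyWin_succ]
    push_cast
    have h1 : (0 : ℝ) < 2 ^ (w / M) := by positivity
    have h2 : (2 : ℝ) ^ (w / M) ≤ 2 ^ (w / M) * (M + (w % M : ℕ)) / M := by
      rw [le_div_iff₀ hM0]
      exact mul_le_mul_of_nonneg_left (le_add_of_nonneg_right (Nat.cast_nonneg _)) h1.le
    linarith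

theorem exists_dyWin_bounds {M : ℕ} (hM : 0 < M) {lo : ℝ} (hlo : 0 < lo) (e c : ℕ) {ε : ℝ}
    (hε : 0 < ε) : ∃ V : ℕ → ℕ, (∀ n : ℕ, 0 < n → n / lo ≤ dyWin M (V n)) ∧
      ∀ᶠ n : ℕ in atTop, ((dyWin M (V n) : ℝ) + 1) ^ (e * V n + c) ≤ Real.exp (ε * n) := by
  obtain ⟨K, hK⟩ := pow_unbounded_of_one_lt (2 / lo) (one_lt_two : (1 : ℝ) < 2)
  have hV : ∀ n, dyWin M ((Nat.log 2 n + K) * M + 1) = 2 ^ (Nat.log 2 n + K) * M :=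
    fun n => dyWin_mul_add_one hM _
  have hM1 : (1 : ℝ) ≤ M := by exact_mod_cast hM
  refine ⟨fun n => (Nat.log 2 n + K) * M + 1, fun n hn => ?_, ?_⟩
  · rw [hV]
    push_cast
    have h1 : (n : ℝ) < 2 ^ Nat.log 2 n * 2 := by
      exact_mod_cast Nat.lt_pow_succ_log_self one_lt_two n
    have h2 : (n : ℝ) / lo ≤ 2 ^ Nat.log 2 n * 2 ^ K := by
      calc (n : ℝ) / lo ≤ 2 ^ Nat.log 2 n * 2 / lo := div_le_div_of_nonneg_right h1.le hlo.le
        _ = 2 ^ Nat.log 2 n * (2 / lo) := mul_div_assoc _ _ _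
        _ ≤ _ := mul_le_mul_of_nonneg_left hK.le (by positivity)
    rw [pow_add]
    exact h2.trans (le_mul_of_one_le_right (by positivity) hM1)
  · set C : ℝ := max (Real.log (2 * (2 ^ K * M))) 1 with hC
    set C' : ℝ := max (e * ((1 / Real.log 2 + K) * M + 1) + c) 1 with hC'
    have hC1 : 1 ≤ C := le_max_right _ _
    have hC1' : 1 ≤ C' := le_max_right _ _
    have hlo2 := (Real.isLittleO_pow_log_id_atTop (n := 2)).def
      (show (0 : ℝ) < ε / (4 * C * C') by positivity)
    have hlog := Real.tendsto_log_atTop.comp (tendsto_natCast_atTop_atTop (R := ℝ))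
    filter_upwards [tendsto_natCast_atTop_atTop.eventually hlo2, hlog.eventually_ge_atTop 1,
      eventually_ge_atTop 1] with n h1 h2 h3
    simp only [Function.comp_apply] at h2
    have hn1 : (1 : ℝ) ≤ n := by exact_mod_cast h3
    simp only [id, Real.norm_eq_abs, abs_pow, sq_abs, Nat.abs_cast] at h1
    rw [hV]
    push_cast
    have hpow : (2 : ℝ) ^ Nat.log 2 n ≤ n := by
      exact_mod_cast Nat.pow_log_le_self 2 (by omega)
    have hbase : (2 : ℝ) ^ (Nat.log 2 n + K) * M + 1 ≤ 2 * (2 ^ K * M) * n := by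
      have h5 : (2 : ℝ) ^ (Nat.log 2 n + K) * M ≤ 2 ^ K * M * n := by
        rw [pow_add, mul_assoc, mul_comm _ (n : ℝ)]
        exact mul_le_mul_of_nonneg_right hpow (by positivity)
      have h6 : (1 : ℝ) ≤ 2 ^ K * M * n :=
        one_le_mul_of_one_le_of_one_le
          (one_le_mul_of_one_le_of_one_le (one_le_pow₀ one_le_two) hM1) hn1
      linarith
    have hlogb : Real.log (2 ^ (Nat.log 2 n + K) * M + 1) ≤ 2 * C * Real.log n := by
      refine (Real.log_le_log (by positivity) hbase).trans ?_
      rw [Real.log_mul (by positivity) (by positivity)]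
      have : Real.log (2 * (2 ^ K * M)) ≤ C := le_max_left _ _
      nlinarith
    have hexp : ((e * ((Nat.log 2 n + K) * M + 1) + c : ℕ) : ℝ) ≤ C' * Real.log n := by
      push_cast
      have h5 : (Nat.log 2 n : ℝ) ≤ 1 / Real.log 2 * Real.log n := by
        rw [one_div, inv_mul_eq_div]
        exact Real.natLog_le_logb n 2
      have h6 : ((Nat.log 2 n : ℝ) + K) ≤ (1 / Real.log 2 + K) * Real.log n := by
        rw [add_mul]
        exact add_le_add h5 (le_mul_of_one_le_right (Nat.cast_nonneg _) h2)
      have h7 : ((Nat.log 2 n : ℝ) + K) * M + 1 ≤ ((1 / Real.log 2 + K) * M + 1) * Real.log n := by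
        have := mul_le_mul_of_nonneg_right h6 (Nat.cast_nonneg (α := ℝ) M)
        nlinarith
      have h8 := mul_le_mul_of_nonneg_left h7 (Nat.cast_nonneg (α := ℝ) e)
      have h9 : (c : ℝ) ≤ c * Real.log n := le_mul_of_one_le_right (Nat.cast_nonneg _) h2
      calc (e : ℝ) * (((Nat.log 2 n : ℝ) + K) * M + 1) + c
          ≤ (e * ((1 / Real.log 2 + K) * M + 1) + c) * Real.log n := by
            rw [add_mul (e * _ : ℝ), mul_assoc (e : ℝ)]
            exact add_le_add h8 h9
        _ ≤ C' * Real.log n := mul_le_mul_of_nonneg_right (le_max_left _ _) (by linarith)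
    rw [← Real.exp_log (show (0 : ℝ) < 2 ^ (Nat.log 2 n + K) * M + 1 by positivity),
      ← Real.exp_nat_mul, Real.exp_le_exp]
    calc _ ≤ C' * Real.log n * (2 * C * Real.log n) :=
          mul_le_mul hexp hlogb (Real.log_nonneg (by
            have : (0 : ℝ) ≤ 2 ^ (Nat.log 2 n + K) * M := by positivity
            linarith)) (by positivity)
      _ = 2 * C * C' * Real.log n ^ 2 := by ring
      _ ≤ 2 * C * C' * (ε / (4 * C * C') * n) := mul_le_mul_of_nonneg_left h1 (by positivity)
      _ = ε * n / 2 := by field_simp; ring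
      _ ≤ ε * n := half_le_self (by positivity)

variable {Φ : DiagIFS d A} {lo hi : ℝ}

theorem dimH_image_coding_le (hV : Φ.Valid) (hb : Φ.LyapBounds lo hi) {H : ℝ}
    (hH : ∀ I (p : Φ.Symb → ℝ), IsProbVec p → Φ.entropy I p ≤ H) (hH0 : 0 ≤ H)
    {M : ℕ} (hM : 0 < M) {s : ℝ} (hs : 0 ≤ s) {X : Set (ℕ → Φ.Symb)}
    (hX : ∀ ω ∈ X, ∃ᶠ n : ℕ in atTop, deltaRB Φ (step (empFreq (dyWin M) ω)) n ≤ s) :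
    dimH (Φ.coding '' X) ≤ ENNReal.ofReal (s + H * d / lo / M) := by
  have hM0 : (0 : ℝ) < M := by exact_mod_cast hM
  have hlo := hb.lo_pos
  set σ := s + H * d / lo / M with hσ
  have hσ0 : 0 ≤ σ := by positivity
  have key : ∀ ε > 0, dimH (Φ.coding '' X) ≤ ENNReal.ofReal (σ + ε) := by
    intro ε hε
    obtain ⟨V, hV1, hV2⟩ := exists_dyWin_bounds hM hlo (Fintype.card Φ.Symb) d (half_pos hε)
    refine dimH_le_of_eventually_cover
      (Y := fun n => Φ.coding '' {ω | deltaRB Φ (step (empFreq (dyWin M) ω)) n ≤ s})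
      (by positivity) ?_ ?_
    · rintro _ ⟨ω, hω, rfl⟩
      exact (hX ω hω).mono fun n hn => ⟨ω, hn, rfl⟩
    · have hlarge : ∀ᶠ n : ℕ in atTop, H * d * M ≤ ε / 2 * n :=
        (tendsto_natCast_atTop_atTop.const_mul_atTop (half_pos hε)).eventually_ge_atTop _
      filter_upwards [hV2, hlarge, eventually_gt_atTop 0] with n h1 h2 h3
      obtain ⟨m, U, hm, hU1, hU2⟩ := exists_cover_of_deltaRB_le hV hb (dyWin_strictMono hM)
        (dyWin_zero M) hH hH0 h3 (hV1 n h3) (g := M + n / lo / M) (s := s) (by positivity)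
        fun w hw => (dyWin_gap hM w).trans (by gcongr)
      refine ⟨m, U, hm.trans ?_, hU1, hU2⟩
      refine (mul_le_mul_of_nonneg_right h1 (Real.exp_pos _).le).trans ?_
      rw [← Real.exp_add, Real.exp_le_exp]
      have : H * (d * (M + n / lo / M)) = H * d * M + H * d / lo / M * n := by
        field_simp
      rw [this, hσ]
      nlinarith
  have hlim : Tendsto (fun m : ℕ => ENNReal.ofReal (σ + 1 / ((m : ℝ) + 1))) atTop
      (𝓝 (ENNReal.ofReal σ)) := by
    refine ENNReal.tendsto_ofReal ?_
    simpa using (tendsto_const_nhds (x := σ)).add tendsto_one_div_add_atTop_nhds_zero_nat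
  exact ge_of_tendsto' hlim fun m => key _ (by positivity)

end DyadicWindows

section Smoothing

variable {Φ : DiagIFS d A} {lo hi : ℝ} {R : ℝ → Φ.Symb → ℝ}

/-- the average of the profile `R` over `((1 - η) b, b]` -/
noncomputable def leftAvg (R : ℝ → Φ.Symb → ℝ) (η b : ℝ) (a : Φ.Symb) : ℝ :=
  η⁻¹ * ∫ t in (1 - η)..1, (Ioi (0 : ℝ)).indicator R (t * b) a

theorem IsProfile.measurable_apply (hR : IsProfile Φ R) (a : Φ.Symb) :
    Measurable fun x => (Ioi (0 : ℝ)).indicator R x a :=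
  (measurable_pi_apply (X := fun _ : Φ.Symb => ℝ) a).comp hR.meas

theorem IsProfile.indicator_nonneg (hR : IsProfile Φ R) (x : ℝ) (a : Φ.Symb) :
    0 ≤ (Ioi (0 : ℝ)).indicator R x a := by
  by_cases hx : x ∈ Ioi (0 : ℝ)
  · rw [Set.indicator_of_mem hx]; exact (hR.prob x hx).1 a
  · rw [Set.indicator_of_notMem hx]; simp

theorem IsProfile.indicator_le_one (hR : IsProfile Φ R) (x : ℝ) (a : Φ.Symb) :
    (Ioi (0 : ℝ)).indicator R x a ≤ 1 := by
  by_cases hx : x ∈ Ioi (0 : ℝ)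
  · rw [Set.indicator_of_mem hx]; exact (hR.prob x hx).le_one a
  · rw [Set.indicator_of_notMem hx]; simp

theorem IsProfile.intervalIntegrable_apply (hR : IsProfile Φ R) (a : Φ.Symb) (c x y : ℝ) :
    IntervalIntegrable (fun t => (Ioi (0 : ℝ)).indicator R (t * c) a) volume x y := by
  refine (intervalIntegrable_const (c := (1 : ℝ))).mono_fun
    ((hR.measurable_apply a).comp (measurable_id.mul_const c)).aestronglyMeasurable
    (Eventually.of_forall fun t => ?_)
  change ‖(Ioi (0 : ℝ)).indicator R (t * c) a‖ ≤ ‖(1 : ℝ)‖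
  rw [Real.norm_eq_abs, abs_of_nonneg (hR.indicator_nonneg _ a), norm_one]
  exact hR.indicator_le_one _ a

theorem IsProfile.isProbVec_leftAvg (hR : IsProfile Φ R) {η : ℝ} (h0 : 0 < η) (h1 : η < 1)
    {b : ℝ} (hb : 0 < b) : IsProbVec (leftAvg R η b) := by
  refine ⟨fun a => mul_nonneg (inv_nonneg.2 h0.le)
    (intervalIntegral.integral_nonneg (by linarith) fun t _ => hR.indicator_nonneg _ a), ?_⟩
  simp only [leftAvg]
  rw [← Finset.mul_sum, ← intervalIntegral.integral_finsetSum
    fun a _ => hR.intervalIntegrable_apply a b _ _]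
  have : ∫ t in (1 - η)..1, ∑ a, (Ioi (0 : ℝ)).indicator R (t * b) a = ∫ t in (1 - η)..1, (1 : ℝ) := by
    refine intervalIntegral.integral_congr fun t ht => ?_
    rw [uIcc_of_le (by linarith)] at ht
    have htb : t * b ∈ Ioi (0 : ℝ) := mul_pos (by linarith [ht.1]) hb
    simp only [Set.indicator_of_mem htb]
    exact (hR.prob _ htb).2
  rw [this, intervalIntegral.integral_const, smul_eq_mul, mul_one, sub_sub_cancel,
    inv_mul_cancel₀ h0.ne']

theorem IsProfile.continuousOn_leftAvg (hR : IsProfile Φ R) (η : ℝ) :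
    ContinuousOn (leftAvg R η) (Ioi 0) := by
  refine continuousOn_pi.2 fun a => ?_
  have hii : ∀ x y, IntervalIntegrable (fun x => (Ioi (0 : ℝ)).indicator R x a) volume x y := by
    intro x y
    simpa using hR.intervalIntegrable_apply a 1 x y
  have hF := intervalIntegral.continuous_primitive hii 0
  set F : ℝ → ℝ := fun y => ∫ x in (0 : ℝ)..y, (Ioi (0 : ℝ)).indicator R x a with hFdef
  have heq : ∀ b ∈ Ioi (0 : ℝ), leftAvg R η b a = η⁻¹ * (b⁻¹ * (F b - F ((1 - η) * b))) := by
    intro b hb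
    rw [leftAvg, intervalIntegral.integral_comp_mul_right
      (fun x => (Ioi (0 : ℝ)).indicator R x a) (ne_of_gt hb), smul_eq_mul, one_mul,
      intervalIntegral.integral_interval_sub_left (hii _ _) (hii _ _)]
  refine ContinuousOn.congr ?_ heq
  refine continuousOn_const.mul (ContinuousOn.mul (continuousOn_inv₀.mono fun b hb => ne_of_gt hb) ?_)
  exact (hF.sub (hF.comp (continuous_const.mul continuous_id))).continuousOn

theorem leftAvg_mul {Λ : ℝ} (hΛ : 0 < Λ) (hper : ∀ b > 0, R (Λ * b) = R b) (η : ℝ) {b : ℝ} :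
    leftAvg R η (Λ * b) = leftAvg R η b := by
  have key : ∀ x, (Ioi (0 : ℝ)).indicator R (Λ * x) = (Ioi (0 : ℝ)).indicator R x := by
    intro x
    by_cases hx : 0 < x
    · rw [Set.indicator_of_mem (show Λ * x ∈ Ioi (0 : ℝ) from mul_pos hΛ hx),
        Set.indicator_of_mem (show x ∈ Ioi (0 : ℝ) from hx), hper x hx]
    · rw [Set.indicator_of_notMem, Set.indicator_of_notMem]
      · exact hx
      · exact fun h => hx (pos_of_mul_pos_right (h : 0 < Λ * x) hΛ.le)
  funext a
  simp only [leftAvg]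
  congr 2
  funext t
  rw [mul_left_comm, key]

theorem leftAvg_eq_of_const {η b : ℝ} (h0 : 0 < η) (h1 : η < 1) (hb : 0 < b)
    (h : ∀ x ∈ Ioc ((1 - η) * b) b, R x = R b) : leftAvg R η b = R b := by
  funext a
  have : ∫ t in (1 - η)..1, (Ioi (0 : ℝ)).indicator R (t * b) a = ∫ t in (1 - η)..1, R b a := by
    rw [intervalIntegral.integral_of_le (by linarith), intervalIntegral.integral_of_le (by linarith)]
    refine setIntegral_congr_fun measurableSet_Ioc fun t ht => ?_
    have htb : t * b ∈ Ioi (0 : ℝ) := mul_pos (by linarith [ht.1]) hb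
    simp only [Set.indicator_of_mem htb]
    rw [h _ ⟨by nlinarith [ht.1], by nlinarith [ht.2]⟩]
  rw [leftAvg, this, intervalIntegral.integral_const, smul_eq_mul, sub_sub_cancel,
    inv_mul_cancel_left₀ h0.ne']

/-- a periodic, left-locally constant profile is close to a cycle outside a small set -/
theorem IsProfile.exists_cycle_close (hR : IsProfile Φ R) {Λ : ℝ} (hΛ : 1 < Λ)
    (hper : ∀ b > 0, R (Λ * b) = R b) (hleft : ∀ b > 0, ∃ c < b, ∀ x ∈ Ioc c b, R x = R b)
    {κ : ℝ} (hκ : 0 < κ) (L : ℝ) :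
    ∃ c : Cycle Φ, c.lam = Λ ∧ ∃ S, MeasurableSet S ∧ volume.real (S ∩ Ioc 0 L) ≤ κ ∧
      ∀ b, 0 < b → b ≤ L → b ∉ S → ∀ a, |c.r b a - R b a| ≤ κ := by
  set η : ℕ → ℝ := fun m => ((m : ℝ) + 2)⁻¹ with hη
  have hη0 : ∀ m, 0 < η m := fun m => by positivity
  have hη1 : ∀ m, η m < 1 := fun m => inv_lt_one_of_one_lt₀ (by have := m.cast_nonneg (α := ℝ); linarith)
  have hηt : Tendsto η atTop (𝓝 0) :=
    tendsto_inv_atTop_zero.comp (tendsto_atTop_add_const_right _ _ tendsto_natCast_atTop_atTop)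
  let c : ℕ → Cycle Φ := fun m =>
    { lam := Λ
      one_le_lam := hΛ.le
      r := leftAvg R (η m)
      prob := fun b hb => hR.isProbVec_leftAvg (hη0 m) (hη1 m) hb
      cont := hR.continuousOn_leftAvg _
      periodic := fun b hb => leftAvg_mul (one_pos.trans hΛ) hper _
      const_of_lam_eq_one := fun h => absurd h hΛ.ne' }
  have hev : ∀ b > 0, ∀ᶠ m in atTop, leftAvg R (η m) b = R b := by
    intro b hb
    obtain ⟨x, hxb, hx⟩ := hleft b hb
    have : Tendsto (fun m => (1 - η m) * b) atTop (𝓝 ((1 - 0) * b)) :=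
      (tendsto_const_nhds.sub hηt).mul_const b
    rw [sub_zero, one_mul] at this
    filter_upwards [this.eventually_const_lt hxb] with m hm
    exact leftAvg_eq_of_const (hη0 m) (hη1 m) hb fun y hy => hx y ⟨hm.trans hy.1, hy.2⟩
  set μ : Measure ℝ := volume.restrict (Ioc 0 L) with hμ
  have hind : ∀ m, MeasurableSet {b : ℝ | κ < ‖(Ioi (0:ℝ)).indicator (leftAvg R (η m)) b - (Ioi (0:ℝ)).indicator R b‖} := by
    intro m
    exact measurableSet_lt measurable_const (((c m).isProfile.meas.sub hR.meas).norm)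
  have hae : ∀ᵐ b ∂μ, Tendsto (fun m => (Ioi (0:ℝ)).indicator (leftAvg R (η m)) b) atTop
      (𝓝 ((Ioi (0:ℝ)).indicator R b)) := by
    refine Eventually.of_forall fun b => ?_
    by_cases hb : b ∈ Ioi (0 : ℝ)
    · simp only [Set.indicator_of_mem hb]
      exact tendsto_const_nhds.congr' ((hev b hb).mono fun m hm => hm.symm)
    · simp only [Set.indicator_of_notMem hb]
      exact tendsto_const_nhds
  have hmeas := tendstoInMeasure_of_tendsto_ae
    (fun m => (c m).isProfile.meas.aestronglyMeasurable) hae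
  rw [tendstoInMeasure_iff_norm] at hmeas
  obtain ⟨m, hm⟩ := ((hmeas κ hκ).eventually_lt_const
    (ENNReal.ofReal_pos.2 hκ)).exists
  refine ⟨c m, rfl, _, hind m, ?_, ?_⟩
  · rw [Measure.real, ← Measure.restrict_apply (hind m)]
    refine ENNReal.toReal_le_of_le_ofReal hκ.le ((measure_mono ?_).trans hm.le)
    exact fun b hb => le_of_lt (α := ℝ) hb
  · intro b hb hbL hbS a
    have hb' : b ∈ Ioi (0 : ℝ) := hb
    simp only [mem_ofPred_eq, not_lt, Set.indicator_of_mem hb'] at hbS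
    exact (norm_le_pi_norm ((leftAvg R (η m)) b - R b) a).trans hbS

end Smoothing

section Folding

variable {Φ : DiagIFS d A} {lo hi : ℝ} {R : ℝ → Φ.Symb → ℝ} {a Λ : ℝ}

/-- the exponent `z` with `b / Λ ^ z ∈ (a, Λ a]` -/
noncomputable def foldExp (a Λ b : ℝ) : ℤ := ⌈Real.logb Λ (b / a)⌉ - 1

/-- the representative of `b` modulo multiplication by `Λ` in `(a, Λ a]` -/
noncomputable def fold (a Λ b : ℝ) : ℝ := b / Λ ^ foldExp a Λ b

theorem foldExp_eq_iff (ha : 0 < a) (hΛ : 1 < Λ) {b : ℝ} (hb : 0 < b) {z : ℤ} :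
    foldExp a Λ b = z ↔ a * Λ ^ z < b ∧ b ≤ a * Λ ^ (z + 1) := by
  have hba : 0 < b / a := div_pos hb ha
  have hΛ0 : 0 < Λ := one_pos.trans hΛ
  rw [foldExp, sub_eq_iff_eq_add, Int.ceil_eq_iff, Real.lt_logb_iff_rpow_lt hΛ hba,
    Real.logb_le_iff_le_rpow hΛ hba, Real.rpow_intCast,
    show (((z + 1 : ℤ) : ℝ) - 1) = (z : ℝ) by push_cast; ring, Real.rpow_intCast,
    lt_div_iff₀ ha, div_le_iff₀ ha, mul_comm a, mul_comm a]

theorem fold_mem (ha : 0 < a) (hΛ : 1 < Λ) {b : ℝ} (hb : 0 < b) : fold a Λ b ∈ Ioc a (Λ * a) := by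
  have hz : 0 < Λ ^ foldExp a Λ b := zpow_pos (one_pos.trans hΛ) _
  obtain ⟨h1, h2⟩ := (foldExp_eq_iff ha hΛ hb).1 rfl
  rw [zpow_add_one₀ (one_pos.trans hΛ).ne'] at h2
  refine ⟨(lt_div_iff₀ hz).2 h1, (div_le_iff₀ hz).2 (h2.trans_eq (by ring))⟩

theorem fold_mul (ha : 0 < a) (hΛ : 1 < Λ) {b : ℝ} (hb : 0 < b) :
    fold a Λ (Λ * b) = fold a Λ b := by
  have hΛ0 : 0 < Λ := one_pos.trans hΛ
  have h : foldExp a Λ (Λ * b) = foldExp a Λ b + 1 := by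
    obtain ⟨h1, h2⟩ := (foldExp_eq_iff ha hΛ hb).1 rfl
    rw [foldExp_eq_iff ha hΛ (mul_pos hΛ0 hb), zpow_add_one₀ hΛ0.ne' (_ + 1),
      zpow_add_one₀ hΛ0.ne']
    rw [zpow_add_one₀ hΛ0.ne'] at h2
    constructor <;> nlinarith
  rw [fold, fold, h, zpow_add_one₀ hΛ0.ne', mul_comm Λ, mul_div_mul_right _ _ hΛ0.ne']

theorem measurable_fold (a Λ : ℝ) : Measurable (fold a Λ) := by
  refine measurable_id.div ((measurable_from_top (f := fun z : ℤ => Λ ^ z)).comp ?_)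
  exact (measurable_from_top (f := fun z : ℤ => z - 1)).comp
    (Int.measurable_ceil.comp (Real.measurable_log.comp (measurable_id.div_const a) |>.div_const _))

/-- points above `a` are obtained from their representatives by multiplying with `Λ` -/
theorem exists_eq_fold_mul (ha : 0 < a) (hΛ : 1 < Λ) {b : ℝ} (hb : a < b) :
    ∃ n : ℕ, b = fold a Λ b * Λ ^ n := by
  have hΛ0 : 0 < Λ := one_pos.trans hΛ
  have hm := fold_mem ha hΛ (ha.trans hb)
  have hbz : b = fold a Λ b * Λ ^ foldExp a Λ b :=
    (div_mul_cancel₀ b (zpow_pos hΛ0 _).ne').symm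
  have hz : 0 ≤ foldExp a Λ b := by
    by_contra! hz
    have h1 : Λ ^ foldExp a Λ b ≤ Λ ^ (-1 : ℤ) := zpow_le_zpow_right₀ hΛ.le (by omega)
    rw [zpow_neg_one] at h1
    have h2 : fold a Λ b * Λ ^ foldExp a Λ b ≤ Λ * a * Λ⁻¹ :=
      mul_le_mul hm.2 h1 (zpow_pos hΛ0 _).le (by positivity)
    rw [← hbz, mul_comm Λ, mul_inv_cancel_right₀ hΛ0.ne'] at h2
    exact absurd h2 (not_le.2 hb)
  refine ⟨(foldExp a Λ b).toNat, ?_⟩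
  rw [← zpow_natCast, Int.toNat_of_nonneg hz]
  exact hbz

theorem IsProfile.comp_fold (hR : IsProfile Φ R) (ha : 0 < a) (hΛ : 1 < Λ) :
    IsProfile Φ fun b => R (fold a Λ b) where
  prob b hb := hR.prob _ (ha.trans (fold_mem ha hΛ hb).1)
  meas := by
    have : (Ioi (0 : ℝ)).indicator (fun b => R (fold a Λ b)) =
        (Ioi (0 : ℝ)).indicator fun b => (Ioi (0 : ℝ)).indicator R (fold a Λ b) := by
      refine Set.indicator_congr fun b hb => ?_
      rw [Set.indicator_of_mem (show fold a Λ b ∈ Ioi (0 : ℝ) from ha.trans (fold_mem ha hΛ hb).1)]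
    rw [this]
    exact (hR.meas.comp (measurable_fold a Λ)).indicator measurableSet_Ioi

theorem exists_comp_fold_const (ha : 0 < a) (hΛ : 1 < Λ)
    (hleft : ∀ b > 0, ∃ c < b, ∀ x ∈ Ioc c b, R x = R b) {b : ℝ} (hb : 0 < b) :
    ∃ c < b, ∀ x ∈ Ioc c b, R (fold a Λ x) = R (fold a Λ b) := by
  have hΛ0 : 0 < Λ := one_pos.trans hΛ
  have hz : 0 < Λ ^ foldExp a Λ b := zpow_pos hΛ0 _
  obtain ⟨c, hc, h⟩ := hleft (fold a Λ b) (ha.trans (fold_mem ha hΛ hb).1)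
  obtain ⟨h1, h2⟩ := (foldExp_eq_iff ha hΛ hb).1 rfl
  refine ⟨max (a * Λ ^ foldExp a Λ b) (c * Λ ^ foldExp a Λ b),
    max_lt h1 ((lt_div_iff₀ hz).1 hc), fun x hx => ?_⟩
  have hx1 := (le_max_left _ _).trans_lt hx.1
  have hx2 := (le_max_right _ _).trans_lt hx.1
  have hx0 : 0 < x := (by positivity : 0 < a * Λ ^ foldExp a Λ b).trans hx1
  have he : foldExp a Λ x = foldExp a Λ b :=
    (foldExp_eq_iff ha hΛ hx0).2 ⟨hx1, hx.2.trans h2⟩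
  refine h _ ⟨?_, ?_⟩
  · rw [fold, he]; exact (lt_div_iff₀ hz).2 hx2
  · rw [fold, he]; exact div_le_div_of_nonneg_right hx.2 hz.le

/-- rescaling the time of a cycle -/
def Cycle.rescale (c : Cycle Φ) {l : ℝ} (hl : 0 < l) : Cycle Φ where
  lam := c.lam
  one_le_lam := c.one_le_lam
  r b := c.r (l * b)
  prob b hb := c.prob _ (mul_pos hl hb)
  cont := c.cont.comp (continuous_const.mul continuous_id).continuousOn fun _ hb => mul_pos hl hb
  periodic b hb := by rw [mul_left_comm]; exact c.periodic _ (mul_pos hl hb)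
  const_of_lam_eq_one h b hb b' hb' := c.const_of_lam_eq_one h _ (mul_pos hl hb) _ (mul_pos hl hb')

theorem Cycle.le_delta_rescale (c : Cycle Φ) (hb : Φ.LyapBounds lo hi) {l : ℝ} (hl : 0 < l) {t : ℝ}
    (h : ∀ B, l ≤ B → B ≤ c.lam * l → t ≤ deltaRB Φ c.r B) : t ≤ (c.rescale hl).delta := by
  refine Cycle.le_delta _ fun B hB => ?_
  rw [c.isProfile.deltaRB_comp_mul (c.rescale hl).isProfile hb hl (fun _ _ => rfl)
    (one_pos.trans_le hB.1)]
  refine h _ ?_ ?_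
  · nlinarith [hB.1]
  · rw [mul_comm]
    exact mul_le_mul_of_nonneg_right hB.2 hl.le

/-- a profile which is almost periodic on a long time interval gives rise to a cycle -/
theorem DiagIFS.LyapBounds.exists_cycle_of_fold_close (hb : Φ.LyapBounds lo hi) {ε : ℝ}
    (hε : 0 < ε) :
    ∃ κ > 0, ∀ R : ℝ → Φ.Symb → ℝ, IsProfile Φ R →
      (∀ b > 0, ∃ c < b, ∀ x ∈ Ioc c b, R x = R b) → ∀ a > 0, ∀ Λ > 1, ∀ t : ℝ,
      (∀ b, a < b → b ≤ 2 / (κ * lo) * (Λ * a) → ∀ e, |R b e - R (fold a Λ b) e| ≤ κ / 2) →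
      (∀ B, 2 * a / κ ≤ B → t ≤ deltaRB Φ R B) → ∃ c : Cycle Φ, t - ε ≤ c.delta := by
  obtain ⟨κ, hκ, hclose⟩ := hb.exists_deltaRB_close hε
  have hlo := hb.lo_pos
  refine ⟨κ, hκ, fun R hR hleft a ha Λ hΛ t hfold ht => ?_⟩
  have hΛ0 : 0 < Λ := one_pos.trans hΛ
  set L := 2 / (κ * lo) * (Λ * a) with hL
  have hκ' : 0 < min (κ / 2) a := lt_min (by positivity) ha
  obtain ⟨c, hlam, S, hSm, hSv, hS⟩ := (hR.comp_fold ha hΛ).exists_cycle_close hΛ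
    (fun b hb => by rw [fold_mul ha hΛ hb])
    (fun b hb => exists_comp_fold_const ha hΛ hleft hb) hκ' L
  have hl : 0 < 2 * a / κ := by positivity
  refine ⟨c.rescale hl, c.le_delta_rescale hb hl fun B hB1 hB2 => ?_⟩
  have hB0 := hl.trans_le hB1
  rw [hlam] at hB2
  have hBL : B / lo ≤ L := by
    rw [div_le_iff₀ hlo]
    refine hB2.trans_eq ?_
    rw [hL]
    field_simp
  have := hclose R c.r hR c.isProfile B hB0 (Ioc 0 a ∪ S) (measurableSet_Ioc.union hSm) ?_ ?_
  · linarith [ht B hB1]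
  · have h1 : volume.real ((Ioc 0 a ∪ S) ∩ Ioc 0 (B / lo)) ≤
        volume.real (Ioc 0 a ∪ (S ∩ Ioc 0 L)) := by
      refine measureReal_mono ?_ ?_
      · rintro x ⟨hx | hx, hx'⟩
        · exact Or.inl hx
        · exact Or.inr ⟨hx, hx'.1, hx'.2.trans hBL⟩
      · exact measure_ne_top_of_subset
          (union_subset_union_right _ inter_subset_right : _ ⊆ Ioc 0 a ∪ Ioc 0 L)
          (ne_of_lt ((measure_union_le _ _).trans_lt (by simp)))
    have h2 := measureReal_union_le (μ := volume) (Ioc 0 a) (S ∩ Ioc 0 L)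
    have h3 : volume.real (Ioc 0 a) = a := by simp [ha.le]
    have h4 : 2 * a ≤ κ * B := by rwa [div_le_iff₀' hκ] at hB1
    linarith [min_le_right (κ / 2) a]
  · intro b hb0 hbB hbS e
    have hab : a < b := by
      by_contra! h
      exact hbS (Or.inl ⟨hb0, h⟩)
    have h1 := hfold b hab (hbB.trans hBL) e
    have h2 := hS b hb0 (hbB.trans hBL) (fun h => hbS (Or.inr h)) e
    rw [abs_sub_comm] at h2
    have h3 := abs_sub_le (R b e) (R (fold a Λ b) e) (c.r b e)
    linarith [min_le_left (κ / 2) a]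

end Folding

section Extraction

variable {Φ : DiagIFS d A} {lo hi : ℝ} {R : ℝ → Φ.Symb → ℝ}

theorem step_empFreq {T : ℕ → ℕ} (hT : StrictMono T) (h0 : T 0 = 0) (ω : ℕ → Φ.Symb) {w : ℕ}
    {b : ℝ} (h1 : (T w : ℝ) < b) (h2 : b ≤ T (w + 1)) :
    step (empFreq T ω) b = freq T ω w := by
  have hb0 : 0 ≤ b := (Nat.cast_nonneg _).trans h1.le
  have h3 : T w < ⌈b⌉₊ := Nat.lt_ceil.2 h1
  have h4 : ⌈b⌉₊ ≤ T (w + 1) := Nat.ceil_le.2 h2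
  rw [step, empFreq, win_eq hT h0 (w := w) (by omega) (by omega)]

theorem step_left_const (p : ℕ → Φ.Symb → ℝ) {b : ℝ} (hb : 0 < b) :
    ∃ c < b, ∀ x ∈ Ioc c b, step p x = step p b := by
  have h := Nat.ceil_pos.2 hb
  have hcast : ((⌈b⌉₊ - 1 : ℕ) : ℝ) = (⌈b⌉₊ : ℝ) - 1 := by
    rw [Nat.cast_sub h]; simp
  have h1 : ((⌈b⌉₊ - 1 : ℕ) : ℝ) < b := by
    rw [hcast]; linarith [Nat.ceil_lt_add_one hb.le]
  refine ⟨_, h1, fun x hx => ?_⟩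
  rw [step_apply p (b := x) ⟨hx.1, ?_⟩, step]
  rw [hcast, sub_add_cancel]
  exact hx.2.trans (Nat.le_ceil b)

theorem exists_mem_window {T : ℕ → ℕ} (hT : StrictMono T) (h0 : T 0 = 0) {b : ℝ} (hb : 0 < b) :
    ∃ w, (T w : ℝ) < b ∧ b ≤ T (w + 1) := by
  have h := Nat.ceil_pos.2 hb
  refine ⟨win T (⌈b⌉₊ - 1), ?_, ?_⟩
  · rw [← Nat.lt_ceil]
    have := win_le h0 (⌈b⌉₊ - 1)
    omega
  · rw [← Nat.ceil_le]
    have := (win_lt_iff hT h0 (k := ⌈b⌉₊ - 1)).1 (Nat.lt_succ_self _)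
    simp only [Nat.succ_eq_add_one] at this
    omega

theorem IsProfile.sub_le_deltaRB (hR : IsProfile Φ R) (hb : Φ.LyapBounds lo hi) {t ε : ℝ}
    (ht : 0 ≤ t) (hε : 0 < ε) {N : ℕ} (h : ∀ n ≥ N, t ≤ deltaRB Φ R n) {B : ℝ}
    (hB : max (t / ε) (N + 1) ≤ B) : t - ε ≤ deltaRB Φ R B := by
  have h1 := (le_max_left _ _).trans hB
  have h2 := (le_max_right _ _).trans hB
  have hN0 : (0 : ℝ) ≤ N := N.cast_nonneg
  have hB0 : 0 < B := by linarith
  have hf : N + 1 ≤ ⌊B⌋₊ := Nat.le_floor (by exact_mod_cast h2)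
  have hf0 : (0 : ℝ) < ⌊B⌋₊ := by exact_mod_cast (show 0 < ⌊B⌋₊ by omega)
  have h3 := hR.mul_deltaRB_mono hb hf0 (Nat.floor_le hB0.le)
  have h4 := h ⌊B⌋₊ (by omega)
  have h5 := Nat.lt_floor_add_one B
  rw [div_le_iff₀ hε] at h1
  have h6 : t * (B - 1) ≤ B * deltaRB Φ R B := by
    refine le_trans ?_ h3
    rw [mul_comm]
    exact mul_le_mul (by linarith) h4 ht hf0.le
  refine le_of_mul_le_mul_left ?_ hB0
  nlinarith

/-- the discretization of a probability vector -/
noncomputable def colour (Q : ℕ) (p : Φ.Symb → ℝ) (e : Φ.Symb) : Fin (Q + 1) :=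
  Fin.ofNat (Q + 1) ⌊Q * p e⌋₊

theorem abs_sub_le_of_colour_eq {Q : ℕ} (hQ : 0 < Q) {p q : Φ.Symb → ℝ} (hp : IsProbVec p)
    (hq : IsProbVec q) (h : colour Q p = colour Q q) (e : Φ.Symb) : |p e - q e| ≤ 1 / Q := by
  have hQ0 : (0 : ℝ) < Q := by exact_mod_cast hQ
  have hlt : ∀ p : Φ.Symb → ℝ, IsProbVec p → ⌊Q * p e⌋₊ < Q + 1 := fun p hp => by
    refine Nat.lt_succ_of_le (Nat.floor_le_of_le ?_)
    exact mul_le_of_le_one_right hQ0.le (hp.le_one e)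
  have h1 := congrArg Fin.val (congrFun h e)
  simp only [colour, Fin.ofNat, Nat.mod_eq_of_lt (hlt p hp), Nat.mod_eq_of_lt (hlt q hq)] at h1
  have p1 := Nat.floor_le (mul_nonneg hQ0.le (hp.1 e))
  have p2 := Nat.lt_floor_add_one (Q * p e)
  have q1 := Nat.floor_le (mul_nonneg hQ0.le (hq.1 e))
  have q2 := Nat.lt_floor_add_one (Q * q e)
  rw [h1] at p1 p2
  rw [le_div_iff₀ hQ0, ← Nat.abs_cast Q, ← abs_mul, abs_le]
  constructor <;> linarith

/-- the empirical frequencies on dyadic windows are recurrent up to a discretization -/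
theorem exists_recurrent_colour {M : ℕ} (hM : 0 < M) (ω : ℕ → Φ.Symb) (Q S k₀ : ℕ) :
    ∃ k₁ ≥ k₀, ∃ m > 0, ∀ b : ℝ, ((2 ^ k₁ * M : ℕ) : ℝ) < b → b ≤ 2 ^ S * ((2 ^ k₁ * M : ℕ) : ℝ) →
      colour Q (step (empFreq (dyWin M) ω) (2 ^ m * b)) =
        colour Q (step (empFreq (dyWin M) ω) b) := by
  have hT := dyWin_strictMono hM
  set u : ℕ → Fin (S * M) → Φ.Symb → Fin (Q + 1) := fun k j =>
    colour Q (freq (dyWin M) ω (1 + j + (k₀ + k) * M)) with hu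
  obtain ⟨x, y, hxy, he⟩ : ∃ x y, x < y ∧ u x = u y := by
    obtain ⟨x, y, hxy, he⟩ := Finite.exists_ne_map_eq_of_infinite u
    rcases hxy.lt_or_gt with h | h
    · exact ⟨x, y, h, he⟩
    · exact ⟨y, x, h, he.symm⟩
  refine ⟨k₀ + x, Nat.le_add_right _ _, y - x, by omega, fun b h1 h2 => ?_⟩
  have hb : 0 < b := (Nat.cast_nonneg _).trans_lt h1
  obtain ⟨w, hw1, hw2⟩ := exists_mem_window hT rfl hb
  have e1 : dyWin M ((k₀ + x) * M + 1) < dyWin M (w + 1) := by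
    rw [dyWin_mul_add_one hM]
    exact_mod_cast h1.trans_le hw2
  have e2 : dyWin M w < dyWin M ((k₀ + x + S) * M + 1) := by
    rw [dyWin_mul_add_one hM, pow_add]
    have := hw1.trans_le h2
    have h3 : dyWin M w < 2 ^ S * (2 ^ (k₀ + x) * M) := by exact_mod_cast this
    exact h3.trans_eq (by ring)
  rw [hT.lt_iff_lt] at e1 e2
  obtain ⟨j, rfl⟩ : ∃ j, w = 1 + j + (k₀ + x) * M := ⟨w - 1 - (k₀ + x) * M, by omega⟩
  have hj : j < S * M := by
    rw [add_mul _ S M] at e2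
    omega
  have hmul : ∀ v, dyWin M (1 + v + (k₀ + y) * M) = 2 ^ (y - x) * dyWin M (1 + v + (k₀ + x) * M) := by
    intro v
    rw [show 1 + v + (k₀ + y) * M = (v + (k₀ + x) * M) + 1 + (y - x) * M by
      obtain ⟨z, rfl⟩ := Nat.exists_eq_add_of_lt hxy
      rw [show x + z + 1 - x = z + 1 by omega]; ring, dyWin_add hM]
    congr 2
    ring
  have hpow : (0 : ℝ) < 2 ^ (y - x) := by positivity
  rw [step_empFreq hT rfl ω hw1 hw2, step_empFreq hT rfl ω (w := 1 + j + (k₀ + y) * M)]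
  · exact (congrFun he ⟨j, hj⟩).symm
  · rw [hmul, Nat.cast_mul, Nat.cast_pow, Nat.cast_ofNat]
    exact mul_lt_mul_of_pos_left hw1 hpow
  · have h5 := hmul (j + 1)
    rw [show 1 + (j + 1) + (k₀ + y) * M = 1 + j + (k₀ + y) * M + 1 by ring,
      show 1 + (j + 1) + (k₀ + x) * M = 1 + j + (k₀ + x) * M + 1 by ring] at h5
    rw [h5, Nat.cast_mul, Nat.cast_pow, Nat.cast_ofNat]
    exact mul_le_mul_of_nonneg_left hw2 hpow.le

/-- if `δ(r, n)` stays above `t` along the empirical frequencies of some word, then there is a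
cycle with `δ` almost equal to `t` -/
theorem exists_cycle_of_eventually_lt (hb : Φ.LyapBounds lo hi) {M : ℕ} (hM : 0 < M)
    (ω : ℕ → Φ.Symb) {t : ℝ} (ht : 0 ≤ t)
    (h : ∀ᶠ n : ℕ in atTop, t < deltaRB Φ (step (empFreq (dyWin M) ω)) n) {ε : ℝ} (hε : 0 < ε) :
    ∃ c : Cycle Φ, t - ε ≤ c.delta := by
  have hlo := hb.lo_pos
  have hT := dyWin_strictMono hM
  obtain ⟨κ, hκ, hκc⟩ := hb.exists_cycle_of_fold_close (half_pos hε)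
  obtain ⟨N, hN⟩ := eventually_atTop.1 h
  have hprob : ∀ b, IsProbVec (step (empFreq (dyWin M) ω) b) := fun b => isProbVec_empFreq hT ω _
  have hR : IsProfile Φ (step (empFreq (dyWin M) ω)) := isProfile_step (isProbVec_empFreq hT ω)
  obtain ⟨S, hS⟩ := pow_unbounded_of_one_lt (2 / (κ * lo)) (one_lt_two (α := ℝ))
  obtain ⟨Q, hQ⟩ := exists_nat_gt (2 / κ)
  have hQ0 : (0 : ℝ) < Q := (by positivity : 0 < 2 / κ).trans hQ
  have hQκ : 1 / (Q : ℝ) ≤ κ / 2 := by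
    rw [div_lt_iff₀ hκ] at hQ
    rw [div_le_iff₀ hQ0]
    linarith
  obtain ⟨k₀, hk₀⟩ := pow_unbounded_of_one_lt (κ / 2 * max (t / (ε / 2)) (N + 1)) (one_lt_two (α := ℝ))
  obtain ⟨k₁, hk₁, m, hm, hcol⟩ := exists_recurrent_colour hM ω Q S k₀
  set a : ℝ := ((2 ^ k₁ * M : ℕ) : ℝ) with ha_def
  have ha : 0 < a := by positivity
  have hΛ : (1 : ℝ) < 2 ^ m := one_lt_pow₀ one_lt_two hm.ne'
  have hkey : ∀ n : ℕ, ∀ x, a < x → x * (2 ^ m) ^ n ≤ 2 ^ S * (2 ^ m * a) →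
      colour Q (step (empFreq (dyWin M) ω) (x * (2 ^ m) ^ n)) =
        colour Q (step (empFreq (dyWin M) ω) x) := by
    intro n
    induction n with
    | zero => intro x _ _; simp
    | succ n ih =>
      intro x hx hle
      have hx0 : 0 < x := ha.trans hx
      have hpn : (1 : ℝ) ≤ (2 ^ m) ^ n := one_le_pow₀ hΛ.le
      have e : x * (2 ^ m) ^ (n + 1) = 2 ^ m * (x * (2 ^ m) ^ n) := by ring
      rw [e] at hle ⊢
      have hle' : x * (2 ^ m) ^ n ≤ 2 ^ S * a :=
        le_of_mul_le_mul_left (hle.trans_eq (by ring)) (one_pos.trans hΛ)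
      rw [hcol _ (hx.trans_le (le_mul_of_one_le_right hx0.le hpn)) hle']
      refine ih x hx (hle'.trans ?_)
      gcongr
      exact le_mul_of_one_le_left ha.le hΛ.le
  suffices ∃ c : Cycle Φ, t - ε / 2 - ε / 2 ≤ c.delta by
    rwa [sub_sub, add_halves] at this
  refine hκc _ hR (fun b hb => step_left_const _ hb) a ha (2 ^ m) hΛ (t - ε / 2) ?_ ?_
  · intro b hab hbL e
    refine le_trans ?_ hQκ
    refine abs_sub_le_of_colour_eq (by exact_mod_cast hQ0) (hprob _) (hprob _) ?_ e
    obtain ⟨n, hn⟩ := exists_eq_fold_mul ha hΛ hab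
    conv_lhs => rw [hn]
    refine hkey n _ (fold_mem ha hΛ (ha.trans hab)).1 ?_
    rw [← hn]
    refine hbL.trans ?_
    gcongr
  · intro B hB
    refine hR.sub_le_deltaRB hb ht (half_pos hε) (fun n hn => (hN n hn).le) (le_trans ?_ hB)
    rw [le_div_iff₀ hκ]
    have h1 : (2 : ℝ) ^ k₀ ≤ a := by
      rw [ha_def]
      have : 2 ^ k₀ ≤ 2 ^ k₁ * M :=
        (Nat.pow_le_pow_right two_pos hk₁).trans (Nat.le_mul_of_pos_right _ hM)
      exact_mod_cast this
    linarith

end Extraction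

section MeanErgodic

/-- averages along orbits of an isometry converge uniformly in the starting time -/
theorem exists_tendsto_shifted_average {E : Type*} [NormedAddCommGroup E] [InnerProductSpace ℝ E]
    [CompleteSpace E] (U : E →ₗᵢ[ℝ] E) (x : E) :
    ∃ z, ∀ m g : ℕ → ℕ, Tendsto g atTop atTop →
      Tendsto (fun k => (g k : ℝ)⁻¹ • ∑ i ∈ Finset.range (g k), U^[m k + i] x) atTop (𝓝 z) := by
  have hlim := U.toContinuousLinearMap.tendsto_birkhoffAverage_orthogonalProjection
    U.norm_toContinuousLinearMap_le x
  set z := (U.toContinuousLinearMap.eqLocus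
    (1 : E →L[ℝ] E)).orthogonalProjectionOnto x with hz
  have hfix : U z = z := z.2
  refine ⟨z, fun m g hg => ?_⟩
  have h1 := hlim.comp hg
  rw [tendsto_iff_norm_sub_tendsto_zero] at h1 ⊢
  refine h1.congr fun k => ?_
  have hiso : ∀ n : ℕ, ∀ y, ‖U^[n] y - z‖ = ‖y - z‖ := by
    intro n y
    induction n with
    | zero => rfl
    | succ n ih =>
      rw [Function.iterate_succ_apply', ← ih]
      conv_lhs => rw [← hfix]
      rw [← map_sub, U.norm_map]
  rw [← hiso (m k)]
  congr 2
  simp only [Function.comp_apply, birkhoffAverage, birkhoffSum, id_eq]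
  have hpow : ∀ n : ℕ, ∀ y, U^[n] y = (U ^ n) y := fun n y => by
    rw [← LinearIsometry.coe_pow]
  simp only [hpow, map_smul, map_sum]
  congr 1
  refine Finset.sum_congr rfl fun i _ => ?_
  rw [← hpow, ← hpow, Function.iterate_add_apply]
  rfl

variable {Φ : DiagIFS d A}

theorem exists_tendstoInMeasure_average {μ : Measure (ℕ → Φ.Symb)} [IsProbabilityMeasure μ]
    (hμ : Measure.map shift μ = μ) (a : Φ.Symb) :
    ∃ z : (ℕ → Φ.Symb) → ℝ, ∀ m g : ℕ → ℕ, Tendsto g atTop atTop →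
      TendstoInMeasure μ (fun k ω => (g k : ℝ)⁻¹ *
        ∑ i ∈ Finset.range (g k), if ω (m k + i) = a then (1 : ℝ) else 0) atTop z := by
  have hshift : Measurable (shift : (ℕ → Φ.Symb) → ℕ → Φ.Symb) :=
    measurable_pi_lambda _ fun n => measurable_pi_apply (X := fun _ : ℕ => Φ.Symb) (n + 1)
  have hmp : MeasurePreserving shift μ μ := ⟨hshift, hμ⟩
  have hf : ∀ n : ℕ, MemLp (fun ω : ℕ → Φ.Symb => if ω n = a then (1 : ℝ) else 0) 2 μ := by
    intro n
    refine MemLp.of_bound (Measurable.aestronglyMeasurable ?_) 1 (Eventually.of_forall fun ω => ?_)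
    · exact (measurable_from_top (f := fun e : Φ.Symb => if e = a then (1 : ℝ) else 0)).comp
        (measurable_pi_apply (X := fun _ : ℕ => Φ.Symb) n)
    · split_ifs <;> simp
  have hU : ∀ n, (Lp.compMeasurePreservingₗᵢ ℝ shift hmp)^[n] (hf 0).toLp = (hf n).toLp := by
    intro n
    induction n with
    | zero => rfl
    | succ n ih =>
      rw [Function.iterate_succ_apply', ih]
      rfl
  obtain ⟨z, hz⟩ := exists_tendsto_shifted_average (Lp.compMeasurePreservingₗᵢ ℝ shift hmp)
    (hf 0).toLp
  refine ⟨z, fun m g hg => (tendstoInMeasure_of_tendsto_Lp (hz m g hg)).congr_left fun k => ?_⟩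
  simp only [hU]
  refine (Lp.coeFn_smul _ _).trans ?_
  have h1 := Lp.coeFn_finsetSum (Finset.range (g k)) fun i => (hf (m k + i)).toLp
  have h2 : ∀ᵐ ω ∂μ, ∀ i, (hf i).toLp _ ω = if ω i = a then (1 : ℝ) else 0 :=
    ae_all_iff.2 fun i => (hf i).coeFn_toLp
  filter_upwards [h1, h2] with ω h1 h2
  rw [Pi.smul_apply, h1, Finset.sum_apply, smul_eq_mul]
  simp only [h2]

end MeanErgodic

section UpperBounds

variable {Φ : DiagIFS d A} {lo hi : ℝ}

theorem dimH_image_coding_le_of_frequently (hV : Φ.Valid) {s : ℝ} (hs : 0 ≤ s)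
    {X : Set (ℕ → Φ.Symb)}
    (hX : ∀ M : ℕ, 0 < M → ∀ m : ℕ, ∀ ω ∈ X,
      ∃ᶠ n : ℕ in atTop, deltaRB Φ (step (empFreq (dyWin M) ω)) n ≤ s + 1 / ((m : ℝ) + 1)) :
    dimH (Φ.coding '' X) ≤ ENNReal.ofReal s := by
  obtain ⟨lo, hi, hb⟩ := hV.exists_lyapBounds
  obtain ⟨H, hH0, hH⟩ := Φ.exists_entropy_bound
  have h1 : Tendsto (fun m : ℕ => s + 1 / ((m : ℝ) + 1) + H * d / lo / ((m : ℝ) + 1)) atTop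
      (𝓝 (s + 0 + 0)) := by
    refine (tendsto_const_nhds.add tendsto_one_div_add_atTop_nhds_zero_nat).add ?_
    have := (tendsto_one_div_add_atTop_nhds_zero_nat (𝕜 := ℝ)).const_mul (H * d / lo)
    simpa only [mul_zero, mul_one_div] using this
  rw [add_zero, add_zero] at h1
  refine ge_of_tendsto (ENNReal.tendsto_ofReal h1) (Eventually.of_forall fun m => ?_)
  have := dimH_image_coding_le hV hb hH hH0.le m.succ_pos
    (by positivity : 0 ≤ s + 1 / ((m : ℝ) + 1)) fun ω hω => hX _ m.succ_pos m ω hω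
  rwa [Nat.cast_succ] at this

theorem dimH_limitSet_le (hV : Φ.Valid) {s : ℝ} (hs : 0 ≤ s) (h : ∀ c : Cycle Φ, c.delta ≤ s) :
    dimH Φ.limitSet ≤ ENNReal.ofReal s := by
  obtain ⟨lo, hi, hb⟩ := hV.exists_lyapBounds
  rw [DiagIFS.limitSet, ← image_univ]
  refine dimH_image_coding_le_of_frequently hV hs fun M hM m ω _ => ?_
  by_contra hcon
  simp only [not_frequently, not_le] at hcon
  have hm : (0 : ℝ) < 1 / ((m : ℝ) + 1) := by positivity
  obtain ⟨c, hc⟩ := exists_cycle_of_eventually_lt hb hM ω (by positivity) hcon (half_pos hm)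
  linarith [h c]

theorem freq_eq_average {T : ℕ → ℕ} (hT : StrictMono T) (ω : ℕ → Φ.Symb) (w : ℕ) (a : Φ.Symb) :
    freq T ω w a = ((T (w + 1) - T w : ℕ) : ℝ)⁻¹ *
      ∑ i ∈ Finset.range (T (w + 1) - T w), if ω (T w + i) = a then (1 : ℝ) else 0 := by
  have hle := (hT w.lt_succ_self).le
  rw [freq, Nat.cast_sub hle, div_eq_inv_mul, ← Finset.sum_Ico_eq_sum_range
    (fun k => if ω k = a then (1 : ℝ) else 0), Finset.sum_boole]

theorem pow_le_dyWin_sub {M : ℕ} (hM : 0 < M) (k j : ℕ) :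
    2 ^ k ≤ dyWin M (k * M + j + 1 + 1) - dyWin M (k * M + j + 1) := by
  rw [dyWin_add_two hM, Nat.add_sub_cancel_left]
  refine Nat.pow_le_pow_right two_pos ?_
  rw [Nat.le_div_iff_mul_le hM]
  exact Nat.le_add_right _ _

/-- for a stationary word, the frequencies on boundedly many consecutive dyadic windows almost
agree infinitely often -/
theorem ae_frequently_freq_close {μ : Measure (ℕ → Φ.Symb)} [IsProbabilityMeasure μ]
    (hμ : Measure.map shift μ = μ) {M : ℕ} (hM : 0 < M) (J : ℕ) {κ : ℝ} (hκ : 0 < κ) :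
    ∀ᵐ ω ∂μ, ∃ᶠ k in atTop, ∀ j < J, ∀ a,
      |freq (dyWin M) ω (k * M + j + 1) a - freq (dyWin M) ω (k * M + 1) a| < κ := by
  have hT := dyWin_strictMono hM
  choose z hz using fun a : Φ.Symb => exists_tendstoInMeasure_average hμ a
  have hconv : ∀ j a, Tendsto (fun k => μ {ω | κ / 2 ≤
      ‖freq (dyWin M) ω (k * M + j + 1) a - z a ω‖}) atTop (𝓝 0) := by
    intro j a
    have h1 := hz a (fun k => dyWin M (k * M + j + 1))
      (fun k => dyWin M (k * M + j + 1 + 1) - dyWin M (k * M + j + 1))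
      (tendsto_atTop_mono (fun k => Nat.lt_two_pow_self.le.trans (pow_le_dyWin_sub hM k j))
        tendsto_id)
    rw [tendstoInMeasure_iff_norm] at h1
    simp only [← freq_eq_average hT] at h1
    exact h1 _ (half_pos hκ)
  set bad : ℕ → Set (ℕ → Φ.Symb) := fun k => ⋃ j ∈ Finset.range (J + 1), ⋃ a ∈ Finset.univ (α := Φ.Symb),
    {ω | κ / 2 ≤ ‖freq (dyWin M) ω (k * M + j + 1) a - z a ω‖} with hbad
  have hbad0 : Tendsto (fun k => μ (bad k)) atTop (𝓝 0) := by
    have hsum : Tendsto (fun k => ∑ j ∈ Finset.range (J + 1), ∑ a : Φ.Symb, μ {ω | κ / 2 ≤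
      ‖freq (dyWin M) ω (k * M + j + 1) a - z a ω‖}) atTop
        (𝓝 (∑ j ∈ Finset.range (J + 1), ∑ a : Φ.Symb, 0)) :=
      tendsto_finsetSum _ fun j _ => tendsto_finsetSum _ fun a _ => hconv j a
    simp only [Finset.sum_const_zero] at hsum
    refine tendsto_of_tendsto_of_tendsto_of_le_of_le tendsto_const_nhds hsum (fun _ => zero_le)
      fun k => ?_
    exact (measure_biUnion_finset_le _ _).trans
      (Finset.sum_le_sum fun j _ => measure_biUnion_finset_le _ _)
  have hall : ∀ᵐ ω ∂μ, ∃ᶠ k in atTop, ω ∉ bad k := by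
    have hN : ∀ N : ℕ, ∀ᵐ ω ∂μ, ∃ k ≥ N, ω ∉ bad k := by
      intro N
      rw [ae_iff]
      refine le_antisymm (ge_of_tendsto hbad0 ?_) zero_le
      filter_upwards [eventually_ge_atTop N] with k hk
      refine measure_mono fun ω hω => ?_
      by_contra h
      exact hω ⟨k, hk, h⟩
    filter_upwards [ae_all_iff.2 hN] with ω hω
    exact frequently_atTop.2 hω
  filter_upwards [hall] with ω hω
  refine hω.mono fun k hk j hj a => ?_
  simp only [hbad, mem_iUnion, not_exists, Finset.mem_range, mem_ofPred_eq, not_le] at hk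
  have h1 := hk j (by omega) a (Finset.mem_univ a)
  have h2 := hk 0 (by omega) a (Finset.mem_univ a)
  rw [add_zero] at h2
  rw [Real.norm_eq_abs] at h1 h2
  rw [abs_sub_comm] at h2
  have h3 := abs_sub_le (freq (dyWin M) ω (k * M + j + 1) a) (z a ω)
    (freq (dyWin M) ω (k * M + 1) a)
  linarith

theorem ae_frequently_deltaRB_le {μ : Measure (ℕ → Φ.Symb)} [IsProbabilityMeasure μ]
    (hb : Φ.LyapBounds lo hi)
    (hμ : Measure.map shift μ = μ) {s : ℝ} (hs : ∀ p, IsProbVec p → deltaP Φ p ≤ s)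
    {M : ℕ} (hM : 0 < M) {ε : ℝ} (hε : 0 < ε) :
    ∀ᵐ ω ∂μ, ∃ᶠ n : ℕ in atTop, deltaRB Φ (step (empFreq (dyWin M) ω)) n ≤ s + ε := by
  have hT := dyWin_strictMono hM
  have hlo := hb.lo_pos
  obtain ⟨κ, hκ, hclose⟩ := hb.exists_deltaRB_close hε
  obtain ⟨Q, hQ⟩ := exists_nat_gt (1 / κ)
  have hQ0 : (0 : ℝ) < Q := (by positivity : 0 < 1 / κ).trans hQ
  obtain ⟨S, hS⟩ := pow_unbounded_of_one_lt (Q / lo) (one_lt_two (α := ℝ))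
  filter_upwards [ae_frequently_freq_close hμ hM (S * M) hκ] with ω hω
  refine frequently_atTop.2 fun N => ?_
  obtain ⟨k, hk, hfreq⟩ := frequently_atTop.1 hω N
  have hτ : 0 < 2 ^ k * M := by positivity
  set τ := 2 ^ k * M with hτ_def
  have hτ0 : (0 : ℝ) < τ := by exact_mod_cast hτ
  have hprob := isProbVec_freq hT ω (k * M + 1)
  refine ⟨Q * τ, ?_, ?_⟩
  · have h1 : k ≤ τ := Nat.lt_two_pow_self.le.trans (Nat.le_mul_of_pos_right _ hM)
    have h2 : 0 < Q := by exact_mod_cast hQ0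
    exact (le_trans hk h1).trans (Nat.le_mul_of_pos_left _ h2)
  have hB : (0 : ℝ) < (Q * τ : ℕ) := by rw [Nat.cast_mul]; positivity
  have h := hclose (step (empFreq (dyWin M) ω)) (fun _ => freq (dyWin M) ω (k * M + 1))
    (isProfile_step (isProbVec_empFreq hT ω)) (isProfile_const hprob) _ hB (Ioc 0 τ)
    measurableSet_Ioc ?_ ?_
  · rw [deltaRB_const hb hprob hB] at h
    linarith [hs _ hprob]
  · have h1 : volume.real (Ioc (0 : ℝ) τ ∩ Ioc 0 ((Q * τ : ℕ) / lo)) ≤ volume.real (Ioc (0 : ℝ) τ) :=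
      measureReal_mono inter_subset_left (by simp)
    have h2 : volume.real (Ioc (0 : ℝ) τ) = τ := by simp
    rw [div_lt_iff₀ hκ] at hQ
    have h3 := mul_lt_mul_of_pos_right hQ hτ0
    rw [h2] at h1
    refine h1.trans ?_
    rw [Nat.cast_mul Q τ]
    linarith
  · intro b hb0 hbB hbS a
    have hτb : (τ : ℝ) < b := by
      by_contra! h
      exact hbS ⟨hb0, h⟩
    obtain ⟨w, hw1, hw2⟩ := exists_mem_window hT rfl hb0
    have e1 : dyWin M (k * M + 1) < dyWin M (w + 1) := by
      rw [dyWin_mul_add_one hM]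
      exact_mod_cast hτb.trans_le hw2
    have e2 : dyWin M w < dyWin M ((k + S) * M + 1) := by
      rw [dyWin_mul_add_one hM, pow_add]
      have h1 : ((Q * τ : ℕ) : ℝ) / lo ≤ 2 ^ S * τ := by
        rw [Nat.cast_mul, mul_div_right_comm]
        gcongr
      have h3 : dyWin M w < 2 ^ S * τ := by exact_mod_cast (hw1.trans_le hbB).trans_le h1
      exact h3.trans_eq (by rw [hτ_def]; ring)
    rw [hT.lt_iff_lt] at e1 e2
    obtain ⟨j, rfl⟩ : ∃ j, w = k * M + j + 1 := ⟨w - 1 - k * M, by omega⟩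
    rw [step_empFreq hT rfl ω hw1 hw2]
    refine (hfreq j ?_ a).le
    rw [add_mul] at e2
    omega

theorem measDim_map_coding_le (hV : Φ.Valid) {μ : Measure (ℕ → Φ.Symb)} [IsProbabilityMeasure μ]
    (hμ : Measure.map shift μ = μ) {s : ℝ} (hs0 : 0 ≤ s)
    (hs : ∀ p, IsProbVec p → deltaP Φ p ≤ s) :
    measDim (Measure.map Φ.coding μ) ≤ ENNReal.ofReal s := by
  obtain ⟨lo, hi, hb⟩ := hV.exists_lyapBounds
  have hmeas := measurable_coding hV
  have : IsProbabilityMeasure (Measure.map Φ.coding μ) :=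
    Measure.isProbabilityMeasure_map hmeas.aemeasurable
  set ν := Measure.map Φ.coding μ with hν
  have hae : ∀ᵐ ω ∂μ, ∀ M : ℕ, 0 < M → ∀ m : ℕ, ∃ᶠ n : ℕ in atTop,
      deltaRB Φ (step (empFreq (dyWin M) ω)) n ≤ s + 1 / ((m : ℝ) + 1) := by
    refine ae_all_iff.2 fun M => ?_
    by_cases hM : 0 < M
    · filter_upwards [ae_all_iff.2 fun m : ℕ => ae_frequently_deltaRB_le hb hμ hs hM
        (by positivity : 0 < 1 / ((m : ℝ) + 1))] with ω hω _ using hω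
    · exact Eventually.of_forall fun ω h => absurd h hM
  obtain ⟨N, hNsub, hNm, hN0⟩ := exists_measurable_superset_of_null (ae_iff.1 hae)
  refine essSup_le_of_ae_le _ ?_
  have hlt : ∀ t : ℝ≥0, ENNReal.ofReal s < t → ∀ᵐ x ∂ν, lowerPtDim ν x ≤ t := by
    intro t ht
    by_contra hcon
    rw [ae_iff] at hcon
    simp only [not_le] at hcon
    obtain ⟨K, hKX, hK, hKμ⟩ := hNm.compl.exists_isCompact_lt_add (measure_ne_top μ _) hcon
    have hcK : MeasurableSet (Φ.coding '' K) := (hK.image (continuous_coding hV)).measurableSet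
    have hνK : μ K ≤ ν (Φ.coding '' K) := by
      rw [hν, Measure.map_apply hmeas hcK]
      exact measure_mono (subset_preimage_image _ _)
    set Z := {x | (t : ℝ≥0∞) < lowerPtDim ν x} with hZ
    have hZK : ν (Z ∩ Φ.coding '' K) ≠ 0 := by
      intro h0
      have h1 : ν Z ≤ ν (Φ.coding '' K)ᶜ := by
        refine (measure_le_inter_add_sdiff ν Z (Φ.coding '' K)).trans ?_
        rw [h0, zero_add]
        exact measure_mono fun x hx => hx.2
      have h2 := prob_add_prob_compl (μ := ν) hcK
      have h3 : μ Nᶜ = 1 := (prob_compl_eq_one_iff hNm).2 hN0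
      rw [h3] at hKμ
      refine absurd hKμ (not_lt.2 ?_)
      rw [← h2]
      exact add_le_add hνK h1
    have h1 := le_dimH_of_lt_lowerPtDim hZK (t := t) fun x hx => hx.1
    have h2 : dimH (Z ∩ Φ.coding '' K) ≤ ENNReal.ofReal s :=
      (dimH_mono (inter_subset_right.trans (image_mono hKX))).trans
        (dimH_image_coding_le_of_frequently hV hs0 fun M hM m ω hω =>
          not_not.1 (fun h => hω (hNsub h)) M hM m)
    exact absurd (h1.trans h2) (not_le.2 ht)
  have hseq : ∀ᵐ x ∂ν, ∀ n : ℕ, lowerPtDim ν x ≤ ((s.toNNReal + 1 / ((n : ℝ≥0) + 1) : ℝ≥0) : ℝ≥0∞) := by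
    refine ae_all_iff.2 fun n => hlt _ ?_
    rw [ENNReal.ofReal, ENNReal.coe_lt_coe]
    exact lt_add_of_pos_right _ (by positivity)
  filter_upwards [hseq] with x hx
  have hlim : Tendsto (fun n : ℕ => ((s.toNNReal + 1 / ((n : ℝ≥0) + 1) : ℝ≥0) : ℝ≥0∞)) atTop
      (𝓝 ((s.toNNReal + 0 : ℝ≥0) : ℝ≥0∞)) :=
    ENNReal.tendsto_coe.2 (tendsto_const_nhds.add tendsto_one_div_add_atTop_nhds_zero_nat)
  rw [add_zero] at hlim
  exact ge_of_tendsto' hlim hx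

end UpperBounds

/-- For a good sponge (one all of whose probability measures are good):
`HD(Λ_Φ) = sup_{r∈R} δ(r)` and `DynD(Φ) = sup_{p∈P} δ(p)`. -/
theorem good_sponge_dims {d : ℕ} {A : Fin d → Type} [∀ i, Fintype (A i)]
    (Φ : DiagIFS d A) (hV : Φ.Valid)
    (hGood : ∀ p : Φ.Symb → ℝ, IsProbVec p → Φ.GoodVec p) :
    dimH Φ.limitSet = sSup {x : ℝ≥0∞ | ∃ c : Cycle Φ, x = ENNReal.ofReal c.delta} ∧
    Φ.dynDim = sSup {x : ℝ≥0∞ | ∃ p : Φ.Symb → ℝ, IsProbVec p ∧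
      x = ENNReal.ofReal (deltaP Φ p)} := by
  refine ⟨le_antisymm ?_ ?_, le_antisymm ?_ ?_⟩
  · rcases eq_or_ne (sSup {x : ℝ≥0∞ | ∃ c : Cycle Φ, x = ENNReal.ofReal c.delta}) ⊤ with h | h
    · rw [h]; exact le_top
    rw [← ENNReal.ofReal_toReal h]
    exact dimH_limitSet_le hV ENNReal.toReal_nonneg fun c =>
      (ENNReal.ofReal_le_iff_le_toReal h).1 (le_sSup ⟨c, rfl⟩)
  · refine sSup_le ?_
    rintro _ ⟨c, rfl⟩
    exact c.ofReal_delta_le_dimH hV hGood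
  · rcases eq_or_ne (sSup {x : ℝ≥0∞ | ∃ p : Φ.Symb → ℝ, IsProbVec p ∧
      x = ENNReal.ofReal (deltaP Φ p)}) ⊤ with h | h
    · rw [h]; exact le_top
    rw [← ENNReal.ofReal_toReal h]
    refine sSup_le ?_
    rintro _ ⟨μ, hμp, hμ, rfl⟩
    exact measDim_map_coding_le hV hμ ENNReal.toReal_nonneg fun p hp =>
      (ENNReal.ofReal_le_iff_le_toReal h).1 (le_sSup ⟨p, hp, rfl⟩)
  · refine sSup_le ?_
    rintro _ ⟨p, hp, rfl⟩
    exact ofReal_deltaP_le_dynDim hV hGood hp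

end SelfAffineSponge
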